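/- SSV satisfies Reversal Symmetry up to 6 alternatives: for any linear ordinal margin matrix (X, ≻) with 2 ≤ |X| ≤ 6, if a is the SSV winner of (X, ≻), then a is not the SSV winner of the reversed ordinal margin matrix (X, ≻ʳ), where (x,y) ≻ʳ (z,w) if and only if (y,x) ≻ (w,z). -/

import Mathlib

variable {X : Type} [DecidableEq X]

/-- `(V, succ)` is an ordinal margin matrix: `V` is a nonempty (finite) set of alternatives
and `succ` (the relation `≻`) is asymmetric, negatively transitive, and ordinally
skew-symmetric on `V × V`. -/
def IsOMM (V : Finset X) (succ : X × X → X × X → Prop) : Prop :=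
  V.Nonempty ∧
  (∀ p q : X × X, p.1 ∈ V → p.2 ∈ V → q.1 ∈ V → q.2 ∈ V → succ p q → ¬ succ q p) ∧
  (∀ p q r : X × X, p.1 ∈ V → p.2 ∈ V → q.1 ∈ V → q.2 ∈ V → r.1 ∈ V → r.2 ∈ V →
      ¬ succ p q → ¬ succ q r → ¬ succ p r) ∧
  (∀ a b c d : X, a ∈ V → b ∈ V → c ∈ V → d ∈ V →
      (succ (a, b) (c, d) ↔ succ (d, c) (b, a)))

/-- A linear ordinal margin matrix: additionally `≻` is connected on pairs of
distinct alternatives, hence a strict linear order there. -/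
def IsLinearOMM (V : Finset X) (succ : X × X → X × X → Prop) : Prop :=
  IsOMM V succ ∧
  ∀ a b c d : X, a ∈ V → b ∈ V → c ∈ V → d ∈ V → a ≠ b → c ≠ d → (a, b) ≠ (c, d) →
    (succ (a, b) (c, d) ∨ succ (c, d) (a, b))

/-- `a` defeats `b` according to Split Cycle in `(V, succ)`: `(a,b) ≻ (b,a)` and there is no
cycle in the majority graph (a duplicate-free list `l` of vertices of `V` whose consecutive
steps, including the wrap-around step — i.e. all the pairs of `l.zip (l.rotate 1)` — are
majority edges) such that `(a,b)` is an edge of the cycle that is weakest in the cycle,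
i.e. `(a,b)` is not `≻`-stronger than any edge of the cycle. -/
def SCdefeats (V : Finset X) (succ : X × X → X × X → Prop) (a b : X) : Prop :=
  a ∈ V ∧ b ∈ V ∧ succ (a, b) (b, a) ∧
    ¬ ∃ l : List X, l.Nodup ∧ (∀ x ∈ l, x ∈ V) ∧
        (∀ e ∈ l.zip (l.rotate 1), succ (e.1, e.2) (e.2, e.1)) ∧
        (a, b) ∈ l.zip (l.rotate 1) ∧
        (∀ e ∈ l.zip (l.rotate 1), ¬ succ (a, b) (e.1, e.2))

/-- `a` is a Split Cycle winner in `(V, succ)`: `a` is not defeated by any alternative. -/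
def SCwinner (V : Finset X) (succ : X × X → X × X → Prop) (a : X) : Prop :=
  a ∈ V ∧ ∀ b ∈ V, ¬ SCdefeats V succ b a

/-- Auxiliary definition of Simple Stable Voting winners, by recursion on a fuel parameter
that is always instantiated to the cardinality of the set of alternatives (deleting a member
of `V` decreases the cardinality by exactly one, so the fuel always matches). -/
def SSVwinAux (succ : X × X → X × X → Prop) : ℕ → Finset X → X → Prop
  | 0, _, _ => False
  | n + 1, V, a =>
      V = {a} ∨
        (1 < V.card ∧ ∃ b ∈ V, a ∈ V.erase b ∧ SSVwinAux succ n (V.erase b) a ∧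
          ∀ c d : X, d ∈ V → c ∈ V.erase d → (c, d) ≠ (a, b) →
            SSVwinAux succ n (V.erase d) c → succ (a, b) (c, d))

/-- `a` is a Simple Stable Voting (SSV) winner in `(V, succ)`: either `V = {a}`, or there is
`b` such that `a` is the SSV winner of `V` with `b` deleted and `(a,b)` is the `≻`-maximal
pair `(c,d)` of distinct alternatives such that `c` is the SSV winner of `V` with `d`
deleted (i.e. `(a,b)` is `≻`-stronger than every other such pair). -/
def SSVwin (V : Finset X) (succ : X × X → X × X → Prop) (a : X) : Prop :=
  SSVwinAux succ V.card V a

/-- Auxiliary definition of Stable Voting winners (fuel-indexed as in `SSVwinAux`). -/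
def SVwinAux (succ : X × X → X × X → Prop) : ℕ → Finset X → X → Prop
  | 0, _, _ => False
  | n + 1, V, a =>
      V = {a} ∨
        (1 < V.card ∧ ∃ b ∈ V, a ∈ V.erase b ∧ SCwinner V succ a ∧
          SVwinAux succ n (V.erase b) a ∧
          ∀ c d : X, d ∈ V → c ∈ V.erase d → (c, d) ≠ (a, b) →
            SCwinner V succ c → SVwinAux succ n (V.erase d) c → succ (a, b) (c, d))

/-- `a` is a Stable Voting (SV) winner in `(V, succ)`: like SSV, but the witnessing pairs
`(c,d)` must additionally have `c` a Split Cycle winner of `(V, succ)`. -/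
def SVwin (V : Finset X) (succ : X × X → X × X → Prop) (a : X) : Prop :=
  SVwinAux succ V.card V a

/-- Auxiliary definition of SSV-SE winners (fuel-indexed as in `SSVwinAux`). -/
def SSVSEwinAux (succ : X × X → X × X → Prop) : ℕ → Finset X → X → Prop
  | 0, _, _ => False
  | n + 1, V, a =>
      V = {a} ∨
        (1 < V.card ∧ ∃ b ∈ V, a ∈ V.erase b ∧ SSVSEwinAux succ n (V.erase b) a ∧
          ∀ c d : X, d ∈ V → c ∈ V.erase d → SSVSEwinAux succ n (V.erase d) c →
            ¬ succ (c, d) (a, b))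

/-- `a` is a Simple Stable Voting with Simultaneous Elimination (SSV-SE) winner in
`(V, succ)`: either `V = {a}`, or `a` is the first coordinate of a `≻`-maximal element
`(a,b)` of the set of pairs `(c,d)` of distinct alternatives such that `c` is an SSV-SE
winner of `V` with `d` deleted (maximal: no such pair is `≻`-stronger than `(a,b)`). -/
def SSVSEwin (V : Finset X) (succ : X × X → X × X → Prop) (a : X) : Prop :=
  SSVSEwinAux succ V.card V a

/-- `succ'` is a linearization of `succ` on `V`: `succ'` is a linear ordinal margin matrix
relation on `V` extending `succ` on `V`. -/
def IsLinearization (V : Finset X) (succ succ' : X × X → X × X → Prop) : Prop :=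
  IsLinearOMM V succ' ∧
  ∀ p q : X × X, p.1 ∈ V → p.2 ∈ V → q.1 ∈ V → q.2 ∈ V → succ p q → succ' p q

/-- `a` is an SSV-PUT (parallel-universe tiebreaking) winner in `(V, succ)`:
`a` is the SSV winner of some linearization of `(V, succ)`. -/
def SSVPUTwin (V : Finset X) (succ : X × X → X × X → Prop) (a : X) : Prop :=
  ∃ succ' : X × X → X × X → Prop, IsLinearization V succ succ' ∧ SSVwin V succ' a

/-- `r` is a strict linear order on (the elements of) `V`. -/
def IsLinOrderOn (V : Finset X) (r : X → X → Prop) : Prop :=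
  (∀ a ∈ V, ¬ r a a) ∧
  (∀ a ∈ V, ∀ b ∈ V, ∀ c ∈ V, r a b → r b c → r a c) ∧
  (∀ a ∈ V, ∀ b ∈ V, a ≠ b → (r a b ∨ r b a))

open Classical in
/-- The margin of `a` vs. `b` in the profile `P` with voters `Fin m`: the number of voters
ranking `a` above `b` minus the number of voters ranking `b` above `a`. -/
noncomputable def margin {m : ℕ} (P : Fin m → X → X → Prop) (a b : X) : ℤ :=
  ((Finset.univ.filter fun i => P i a b).card : ℤ) -
  ((Finset.univ.filter fun i => P i b a).card : ℤ)


/-! ## A small certificate checker for propositional refutations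

Literals are natural numbers `2 * atom + sign`, clauses are bit masks of literals. -/

namespace SSVCert

/-- Strict `let` for natural numbers (forces evaluation in the kernel). -/
def seqN {α : Type} (x : ℕ) (f : ℕ → α) : α :=
  match x with
  | 0 => f 0
  | k + 1 => f (Nat.succ k)

theorem seqN_eq {α : Type} (x : ℕ) (f : ℕ → α) : seqN x f = f x := by
  cases x <;> rfl

/-- Strict `let` for large natural numbers. The value is tagged with a fingerprint in its low
bits, which keeps the hash tables of the kernel well distributed. -/
def seqS {α : Type} (x : ℕ) (f : ℕ → α) : α :=
  seqN (Nat.add (Nat.shiftLeft x 64) (Nat.mod x 1000000000000000009)) fun y =>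
    f (Nat.shiftRight y 64)

/-- Bit mask of a list of literals. -/
def mask : List ℕ → ℕ
  | [] => 0
  | l :: ls => Nat.lor (Nat.pow 2 l) (mask ls)

/-- Code of the atom `(a,b) ≻ (c,d)`. -/
def gCode (a b c d : ℕ) : ℕ :=
  Nat.add (Nat.mul (Nat.add (Nat.mul (Nat.add (Nat.mul a 6) b) 6) c) 6) d

/-- Smaller of two numbers. -/
def mn (x y : ℕ) : ℕ := cond (Nat.ble x y) x y

/-- The canonical literal for `(a,b) ≻ (c,d)`. -/
def gLit (a b c d : ℕ) : ℕ :=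
  seqN (mn (gCode a b c d) (gCode d c b a)) fun u =>
  seqN (mn (gCode c d a b) (gCode b a d c)) fun v =>
    cond (Nat.ble u v) (Nat.mul 2 u) (Nat.succ (Nat.mul 2 v))

/-- The literal for `(a,b) ≻ (c,d)` in the original (`s = 0`) or reversed (`s ≠ 0`) matrix. -/
def gsLit (s a b c d : ℕ) : ℕ := cond (Nat.beq s 0) (gLit a b c d) (gLit b a d c)

/-- Atom: `x` wins in the subset with mask `S`. -/
def wAt (s S x : ℕ) : ℕ := Nat.add 1296 (Nat.add (Nat.mul (Nat.add (Nat.mul s 64) S) 6) x)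

/-- Atom: the maximal pair for the subset with mask `S` has second coordinate `b`. -/
def mAt (s S x : ℕ) : ℕ := Nat.add 2064 (Nat.add (Nat.mul (Nat.add (Nat.mul s 64) S) 6) x)

/-- positive literal -/
def pos (k : ℕ) : ℕ := Nat.mul 2 k

/-- negative literal -/
def neg (k : ℕ) : ℕ := Nat.succ (Nat.mul 2 k)

/-- complement of a literal -/
def flipL (l : ℕ) : ℕ := cond (Nat.beq (Nat.mod l 2) 0) (Nat.succ l) (Nat.pred l)

/-- Given `2 ^ l`, the power `2 ^ flipL l` -/
def flipM (r : ℕ) : ℕ := cond (Nat.beq (Nat.mod r 3) 1) (Nat.mul r 2) (Nat.div r 2)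

/-- bit test -/
def tb (S i : ℕ) : Bool := Nat.beq (Nat.mod (Nat.shiftRight S i) 2) 1

/-- elements of the subset with mask `S` -/
def els (S : ℕ) : List ℕ := List.filter (fun i => tb S i) [0, 1, 2, 3, 4, 5]

/-- remove an element from a subset -/
def del (S b : ℕ) : ℕ := Nat.xor S (Nat.pow 2 b)

/-- strict comparison -/
def ltb (a b : ℕ) : Bool := Nat.ble (Nat.succ a) b

/-- disequality -/
def neb (a b : ℕ) : Bool := not (Nat.beq a b)

/-- decimal digit -/
def dig (w p : ℕ) : ℕ := Nat.mod (Nat.div w p) 10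

/-- guarded clause; when the guard fails, we return a tautology -/
def guardC (b : Bool) (c : List ℕ) : List ℕ := cond b c [0, 1]

/-- Transitivity axiom. -/
def axT (n a b c d e f : ℕ) : List ℕ :=
  guardC (ltb a n && ltb b n && ltb c n && ltb d n && ltb e n && ltb f n &&
      neb a b && neb c d && neb e f && (neb a c || neb b d) && (neb c e || neb d f) &&
      (neb a e || neb b f))
    [flipL (gLit a b c d), flipL (gLit c d e f), gLit a b e f]

/-- Axioms by tag: `s` side, `S` mask, `b a d c` alternatives. -/
def axO (n tag s S b a d c : ℕ) : List ℕ :=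
  guardC (ltb s 2 && ltb S (Nat.pow 2 n) && ltb b n && ltb a n && ltb d n && ltb c n)
    (match tag with
     | 2 => [pos (wAt s (Nat.pow 2 b) b)]
     | 3 => guardC (Nat.ble 2 (els S).length) ((els S).map fun b => pos (mAt s S b))
     | 4 => guardC (Nat.ble 1 (els S).length) ((els S).map fun b => pos (wAt s S b))
     | 5 => guardC (neb b a) [neg (wAt s S b), neg (wAt s S a)]
     | 6 => guardC (Nat.ble 2 (els S).length && ltb (Nat.succ S) (Nat.pow 2 n))
              [neg (wAt 0 S b), neg (wAt 1 S b)]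
     | 7 => guardC (tb S b) [neg (mAt s S b), neg (wAt s (del S b) a), pos (wAt s S a)]
     | 8 => guardC (tb S b) [neg (mAt s S b), pos (wAt s (del S b) a), neg (wAt s S a)]
     | 9 => guardC (tb S b && tb S d && neb b d && neb a b && neb c d)
              [neg (mAt s S b), neg (wAt s (del S b) a), neg (wAt s (del S d) c),
                gsLit s a b c d]
     | 10 => [pos (wAt s (Nat.pred (Nat.pow 2 n)) 0)]
     | _ => [0, 1])

/-- Decoding of an axiom hint. -/
def axm (n w : ℕ) : List ℕ :=
  seqN (Nat.div w 10000000) fun tag =>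
  seqN (dig w 1000) fun x1 => seqN (dig w 100) fun x2 =>
  seqN (dig w 10) fun x3 => seqN (dig w 1) fun x4 =>
  cond (Nat.beq tag 1)
    (seqN (dig w 100000) fun y1 => seqN (dig w 10000) fun y2 => axT n y1 y2 x1 x2 x3 x4)
    (seqN (dig w 1000000) fun s => seqN (Nat.mod (Nat.div w 10000) 100) fun S =>
      axO n tag s S x1 x2 x3 x4)

/-- Database of derived clauses. -/
inductive DB where
  | nil : DB
  | node (v : ℕ) (l r : DB) : DB

/-- lookup -/
def DB.get : DB → ℕ → ℕ
  | .nil, _ => 3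
  | .node v l r, i =>
      cond (Nat.ble i 1) v
        (cond (Nat.beq (Nat.mod i 2) 0) (l.get (Nat.div i 2)) (r.get (Nat.div i 2)))

/-- insertion with fuel -/
def DB.ins : ℕ → DB → ℕ → ℕ → DB
  | 0, t, _, _ => t
  | f + 1, .nil, i, x =>
      cond (Nat.ble i 1) (.node x .nil .nil)
        (cond (Nat.beq (Nat.mod i 2) 0) (.node 3 (DB.ins f .nil (Nat.div i 2) x) .nil)
          (.node 3 .nil (DB.ins f .nil (Nat.div i 2) x)))
  | f + 1, .node v l r, i, x =>
      cond (Nat.ble i 1) (.node x l r)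
        (cond (Nat.beq (Nat.mod i 2) 0) (.node v (DB.ins f l (Nat.div i 2) x) r)
          (.node v l (DB.ins f r (Nat.div i 2) x)))

/-- insertion in continuation passing style (forces evaluation in the kernel) -/
def DB.insK {α : Type} : ℕ → DB → ℕ → ℕ → (DB → α) → α
  | 0, t, _, _, k => k t
  | f + 1, .nil, i, x, k =>
      cond (Nat.ble i 1) (k (.node x .nil .nil))
        (seqN (Nat.div i 2) fun j =>
          cond (Nat.beq (Nat.mod i 2) 0) (DB.insK f .nil j x fun t => k (.node 3 t .nil))
            (DB.insK f .nil j x fun t => k (.node 3 .nil t)))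
  | f + 1, .node v l r, i, x, k =>
      cond (Nat.ble i 1) (k (.node x l r))
        (seqN (Nat.div i 2) fun j =>
          cond (Nat.beq (Nat.mod i 2) 0) (DB.insK f l j x fun t => k (.node v t r))
            (DB.insK f r j x fun t => k (.node v l t)))

/-- Clause denoted by a hint. -/
def hintC (n : ℕ) (db : DB) (h : ℕ) : ℕ :=
  cond (ltb h 10000) (db.get h) (mask (axm n h))

/-- Reverse unit propagation along hints; `F` is the mask of literals known to be false. -/
def rup (n : ℕ) (db : DB) : List ℕ → ℕ → Bool
  | [], _ => false
  | h :: hs, F =>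
    seqS (hintC n db h) fun C =>
    seqS (Nat.xor C (Nat.land C F)) fun r =>
    cond (Nat.beq r 0) true
      (cond (Nat.beq (Nat.mod (Nat.pow 2 5664) r) 0)
        (seqS (Nat.lor F (flipM r)) fun F' => rup n db hs F') false)

/-- Check all lemmas; success when the empty clause is derived. -/
def run (n : ℕ) : List (List ℕ × List ℕ) → DB → ℕ → Bool
  | [], _, _ => false
  | (ls, hs) :: rest, db, i =>
    seqS (mask ls) fun C =>
      cond (rup n db hs C)
        (cond (Nat.beq C 0) true
          (seqN (Nat.succ i) fun j => DB.insK 12 db i C fun db' => run n rest db' j))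
        false

/-! ### Soundness of the checker -/

theorem seqS_eq {α : Type} (x : ℕ) (f : ℕ → α) : seqS x f = f x := by
  unfold seqS
  rw [seqN_eq]
  congr 1
  have h1 : Nat.shiftRight (Nat.add (Nat.shiftLeft x 64) (Nat.mod x 1000000000000000009)) 64
      = (x <<< 64 + x % 1000000000000000009) >>> 64 := rfl
  rw [h1, Nat.shiftRight_eq_div_pow, Nat.shiftLeft_eq]
  omega

/-- An abstract structure satisfying the axioms used in the certificates. -/
structure Model (n : ℕ) where
  g : ℕ → ℕ → ℕ → ℕ → Prop
  W : ℕ → ℕ → ℕ → Prop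
  M : ℕ → ℕ → ℕ → Prop
  n6 : n ≤ 6
  n1 : 1 ≤ n
  skew : ∀ a b c d, a < n → b < n → c < n → d < n → (g a b c d ↔ g d c b a)
  anti : ∀ a b c d, a < n → b < n → c < n → d < n → a ≠ b → c ≠ d → (a ≠ c ∨ b ≠ d) →
    (g a b c d ↔ ¬ g c d a b)
  tran : ∀ a b c d e f, a < n → b < n → c < n → d < n → e < n → f < n → a ≠ b → c ≠ d → e ≠ f →
    (a ≠ e ∨ b ≠ f) → g a b c d → g c d e f → g a b e f
  one : ∀ s x, s < 2 → x < n → W s (2 ^ x) x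
  mex : ∀ s S, s < 2 → S < 2 ^ n → 2 ≤ (els S).length → ∃ b ∈ els S, M s S b
  wex : ∀ s S, s < 2 → S < 2 ^ n → 1 ≤ (els S).length → ∃ b ∈ els S, W s S b
  wun : ∀ s S x y, s < 2 → S < 2 ^ n → x < n → y < n → W s S x → W s S y → x = y
  ih : ∀ S x, S + 1 < 2 ^ n → 2 ≤ (els S).length → x < n → W 0 S x → ¬ W 1 S x
  dd : ∀ s S b a, s < 2 → S < 2 ^ n → b < n → a < n → tb S b = true →
    M s S b → W s (del S b) a → W s S a
  ee : ∀ s S b a, s < 2 → S < 2 ^ n → b < n → a < n → tb S b = true →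
    M s S b → W s S a → W s (del S b) a
  ff : ∀ s S b a d c, s < 2 → S < 2 ^ n → b < n → a < n → d < n → c < n →
    tb S b = true → tb S d = true → b ≠ d → a ≠ b → c ≠ d →
    M s S b → W s (del S b) a → W s (del S d) c →
    (s = 0 → g a b c d) ∧ (s ≠ 0 → g b a d c)
  top : ∀ s, s < 2 → W s (2 ^ n - 1) 0

namespace Model

variable {n : ℕ} (m : Model n)

/-- Truth value of an atom. -/
def vat (k : ℕ) : Prop :=
  if k < 1296 then m.g (k / 216) (k / 36 % 6) (k / 6 % 6) (k % 6)
  else if k < 2064 then m.W ((k - 1296) / 384) ((k - 1296) / 6 % 64) ((k - 1296) % 6)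
  else m.M ((k - 2064) / 384) ((k - 2064) / 6 % 64) ((k - 2064) % 6)

/-- Truth value of a literal. -/
def val (l : ℕ) : Prop := if l % 2 = 0 then m.vat (l / 2) else ¬ m.vat (l / 2)

/-- Truth of a clause given by a mask. -/
def Holds (C : ℕ) : Prop := ∃ i, C.testBit i = true ∧ m.val i

/-- Truth of a clause given by a list. -/
def HoldsL (ls : List ℕ) : Prop := ∃ l ∈ ls, m.val l

theorem val_pos (k : ℕ) : m.val (pos k) ↔ m.vat k := by
  have h1 : pos k = 2 * k := rfl
  have h2 : 2 * k % 2 = 0 := by omega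
  have h3 : 2 * k / 2 = k := by omega
  rw [h1, val, if_pos h2, h3]

theorem val_neg (k : ℕ) : m.val (neg k) ↔ ¬ m.vat k := by
  have h1 : neg k = 2 * k + 1 := rfl
  have h2 : ¬ (2 * k + 1) % 2 = 0 := by omega
  have h3 : (2 * k + 1) / 2 = k := by omega
  rw [h1, val, if_neg h2, h3]

theorem flipL_eq (l : ℕ) : flipL l = if l % 2 = 0 then l + 1 else l - 1 := by
  have h1 : flipL l = cond (Nat.beq (l % 2) 0) (l + 1) (l - 1) := rfl
  rw [h1]
  split_ifs with h
  · rw [h]; rfl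
  · have h' : l % 2 = 1 := by omega
    rw [h']; rfl

theorem val_flip (l : ℕ) : m.val (flipL l) ↔ ¬ m.val l := by
  rw [flipL_eq]
  by_cases h : l % 2 = 0
  · have h2 : ¬ (l + 1) % 2 = 0 := by omega
    have h3 : (l + 1) / 2 = l / 2 := by omega
    rw [if_pos h, val, val, if_neg h2, if_pos h, h3]
  · have h2 : (l - 1) % 2 = 0 := by omega
    have h3 : (l - 1) / 2 = l / 2 := by omega
    rw [if_neg h, val, val, if_pos h2, if_neg h, h3, not_not]

theorem vat_g (a b c d : ℕ) (ha : a < 6) (hb : b < 6) (hc : c < 6) (hd : d < 6) :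
    m.vat (gCode a b c d) ↔ m.g a b c d := by
  have h1 : gCode a b c d = ((a * 6 + b) * 6 + c) * 6 + d := rfl
  rw [h1, vat, if_pos (by omega)]
  have e1 : (((a * 6 + b) * 6 + c) * 6 + d) / 216 = a := by omega
  have e2 : (((a * 6 + b) * 6 + c) * 6 + d) / 36 % 6 = b := by omega
  have e3 : (((a * 6 + b) * 6 + c) * 6 + d) / 6 % 6 = c := by omega
  have e4 : (((a * 6 + b) * 6 + c) * 6 + d) % 6 = d := by omega
  rw [e1, e2, e3, e4]

theorem vat_w (s S x : ℕ) (hs : s < 2) (hS : S < 64) (hx : x < 6) :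
    m.vat (wAt s S x) ↔ m.W s S x := by
  have h1 : wAt s S x = 1296 + ((s * 64 + S) * 6 + x) := rfl
  rw [h1, vat, if_neg (by omega), if_pos (by omega)]
  have e1 : (1296 + ((s * 64 + S) * 6 + x) - 1296) / 384 = s := by omega
  have e2 : (1296 + ((s * 64 + S) * 6 + x) - 1296) / 6 % 64 = S := by omega
  have e3 : (1296 + ((s * 64 + S) * 6 + x) - 1296) % 6 = x := by omega
  rw [e1, e2, e3]

theorem vat_m (s S x : ℕ) (hs : s < 2) (hS : S < 64) (hx : x < 6) :
    m.vat (mAt s S x) ↔ m.M s S x := by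
  have h1 : mAt s S x = 2064 + ((s * 64 + S) * 6 + x) := rfl
  rw [h1, vat, if_neg (by omega), if_neg (by omega)]
  have e1 : (2064 + ((s * 64 + S) * 6 + x) - 2064) / 384 = s := by omega
  have e2 : (2064 + ((s * 64 + S) * 6 + x) - 2064) / 6 % 64 = S := by omega
  have e3 : (2064 + ((s * 64 + S) * 6 + x) - 2064) % 6 = x := by omega
  rw [e1, e2, e3]

theorem mn_cases (x y : ℕ) : mn x y = x ∨ mn x y = y := by
  unfold mn
  cases Nat.ble x y <;> simp

theorem val_gLit (a b c d : ℕ) (ha : a < n) (hb : b < n) (hc : c < n) (hd : d < n)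
    (hab : a ≠ b) (hcd : c ≠ d) (hne : a ≠ c ∨ b ≠ d) :
    m.val (gLit a b c d) ↔ m.g a b c d := by
  have h6 := m.n6
  have k1 := m.vat_g a b c d (by omega) (by omega) (by omega) (by omega)
  have k2 := m.vat_g d c b a (by omega) (by omega) (by omega) (by omega)
  have k3 := m.vat_g c d a b (by omega) (by omega) (by omega) (by omega)
  have k4 := m.vat_g b a d c (by omega) (by omega) (by omega) (by omega)
  have s1 := m.skew a b c d ha hb hc hd
  have s2 := m.skew c d a b hc hd ha hb
  have s3 := m.anti a b c d ha hb hc hd hab hcd hne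
  have hu : m.vat (mn (gCode a b c d) (gCode d c b a)) ↔ m.g a b c d := by
    rcases mn_cases (gCode a b c d) (gCode d c b a) with h | h <;> rw [h]
    · exact k1
    · exact k2.trans s1.symm
  have hv : m.vat (mn (gCode c d a b) (gCode b a d c)) ↔ ¬ m.g a b c d := by
    rcases mn_cases (gCode c d a b) (gCode b a d c) with h | h <;> rw [h]
    · rw [k3, s3, not_not]
    · rw [k4, ← s2, s3, not_not]
  unfold gLit
  rw [seqN_eq, seqN_eq]
  cases Nat.ble _ _
  · exact (m.val_neg _).trans ((not_congr hv).trans not_not)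
  · exact (m.val_pos _).trans hu

theorem holds_mask (ls : List ℕ) : m.Holds (mask ls) ↔ m.HoldsL ls := by
  induction ls with
  | nil => simp [Holds, HoldsL, mask]
  | cons l ls ih =>
    have h1 : mask (l :: ls) = 2 ^ l ||| mask ls := rfl
    have h2 : m.HoldsL (l :: ls) ↔ m.val l ∨ m.HoldsL ls := by simp [HoldsL]
    rw [h2, ← ih, h1]
    simp only [Holds, Nat.testBit_or, Nat.testBit_two_pow, Bool.or_eq_true, decide_eq_true_eq]
    constructor
    · rintro ⟨i, rfl | hi, hv⟩
      · exact Or.inl hv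
      · exact Or.inr ⟨i, hi, hv⟩
    · rintro (hv | ⟨i, hi, hv⟩)
      · exact ⟨l, Or.inl rfl, hv⟩
      · exact ⟨i, Or.inr hi, hv⟩

theorem holdsL_taut : m.HoldsL [0, 1] := by
  have h1 := m.val_pos 0
  have h2 := m.val_neg 0
  have e1 : pos 0 = 0 := rfl
  have e2 : neg 0 = 1 := rfl
  rw [e1] at h1
  rw [e2] at h2
  by_cases h : m.vat 0
  · exact ⟨0, by simp, h1.2 h⟩
  · exact ⟨1, by simp, h2.2 h⟩

theorem holds_three : m.Holds 3 := (m.holds_mask [0, 1]).2 m.holdsL_taut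

theorem holdsL_guard (b : Bool) (c : List ℕ) (h : b = true → m.HoldsL c) :
    m.HoldsL (guardC b c) := by
  cases b
  · exact m.holdsL_taut
  · exact h rfl

theorem holdsL2 (x y : ℕ) (h : ¬ m.val x → m.val y) : m.HoldsL [x, y] := by
  by_cases hx : m.val x
  · exact ⟨x, by simp, hx⟩
  · exact ⟨y, by simp, h hx⟩

theorem holdsL3 (x y z : ℕ) (h : ¬ m.val x → ¬ m.val y → m.val z) : m.HoldsL [x, y, z] := by
  by_cases hx : m.val x
  · exact ⟨x, by simp, hx⟩
  · by_cases hy : m.val y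
    · exact ⟨y, by simp, hy⟩
    · exact ⟨z, by simp, h hx hy⟩

theorem holdsL4 (x y z w : ℕ) (h : ¬ m.val x → ¬ m.val y → ¬ m.val z → m.val w) :
    m.HoldsL [x, y, z, w] := by
  by_cases hx : m.val x
  · exact ⟨x, by simp, hx⟩
  · by_cases hy : m.val y
    · exact ⟨y, by simp, hy⟩
    · by_cases hz : m.val z
      · exact ⟨z, by simp, hz⟩
      · exact ⟨w, by simp, h hx hy hz⟩

theorem ltb_iff (a b : ℕ) : ltb a b = true ↔ a < b := by
  unfold ltb; rw [Nat.ble_eq]; rfl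

theorem neb_iff (a b : ℕ) : neb a b = true ↔ a ≠ b := by
  unfold neb
  rw [Bool.not_eq_true', ← Bool.not_eq_true, Nat.beq_eq]

theorem holdsL_axT (a b c d e f : ℕ) : m.HoldsL (axT n a b c d e f) := by
  apply m.holdsL_guard
  intro h
  simp only [Bool.and_eq_true, Bool.or_eq_true, ltb_iff, neb_iff] at h
  obtain ⟨⟨⟨⟨⟨⟨⟨⟨⟨⟨⟨ha, hb⟩, hc⟩, hd⟩, he⟩, hf⟩, hab⟩, hcd⟩, hef⟩, h1⟩, h2⟩, h3⟩ := h
  have v1 := m.val_gLit a b c d ha hb hc hd hab hcd h1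
  have v2 := m.val_gLit c d e f hc hd he hf hcd hef h2
  have v3 := m.val_gLit a b e f ha hb he hf hab hef h3
  have t := m.tran a b c d e f ha hb hc hd he hf hab hcd hef h3
  have f1 := m.val_flip (gLit a b c d)
  have f2 := m.val_flip (gLit c d e f)
  refine m.holdsL3 _ _ _ fun x y => ?_
  rw [f1, not_not, v1] at x
  rw [f2, not_not, v2] at y
  exact v3.2 (t x y)

theorem del_lt (S b : ℕ) (hS : S < 2 ^ n) (hb : b < n) : del S b < 2 ^ n :=
  Nat.xor_lt_two_pow hS (Nat.pow_lt_pow_right (by norm_num) hb)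

theorem els_lt {S x : ℕ} (h : x ∈ els S) : x < 6 := by
  have h1 := (List.mem_filter.1 h).1
  fin_cases h1 <;> norm_num

theorem holdsL_axO (tag s S b a d c : ℕ) : m.HoldsL (axO n tag s S b a d c) := by
  apply m.holdsL_guard
  intro h
  simp only [Bool.and_eq_true, ltb_iff] at h
  obtain ⟨⟨⟨⟨⟨hs, hS⟩, hb⟩, ha⟩, hd⟩, hc⟩ := h
  replace hS : S < 2 ^ n := hS
  have h6 := m.n6
  have h64 : 2 ^ n ≤ 64 := Nat.pow_le_pow_right (by norm_num) h6
  have hdb := del_lt S b hS hb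
  have hdd := del_lt S d hS hd
  have wS : ∀ x, x < 6 → (m.vat (wAt s S x) ↔ m.W s S x) :=
    fun x hx => m.vat_w s S x hs (by omega) hx
  have mS : ∀ x, x < 6 → (m.vat (mAt s S x) ↔ m.M s S x) :=
    fun x hx => m.vat_m s S x hs (by omega) hx
  have wDb := m.vat_w s (del S b) a hs (by omega) (by omega)
  have wDd := m.vat_w s (del S d) c hs (by omega) (by omega)
  split
  · have hp : 2 ^ b < 2 ^ n := Nat.pow_lt_pow_right (by norm_num) hb
    refine ⟨_, List.mem_singleton.2 rfl, (m.val_pos _).2 ?_⟩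
    exact (m.vat_w s (2 ^ b) b hs (by omega) (by omega)).2 (m.one s b hs hb)
  · apply m.holdsL_guard
    intro h
    obtain ⟨x, hx, hM⟩ := m.mex s S hs hS (Nat.le_of_ble_eq_true h)
    exact ⟨_, List.mem_map.2 ⟨x, hx, rfl⟩, (m.val_pos _).2 ((mS x (els_lt hx)).2 hM)⟩
  · apply m.holdsL_guard
    intro h
    obtain ⟨x, hx, hM⟩ := m.wex s S hs hS (Nat.le_of_ble_eq_true h)
    exact ⟨_, List.mem_map.2 ⟨x, hx, rfl⟩, (m.val_pos _).2 ((wS x (els_lt hx)).2 hM)⟩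
  · apply m.holdsL_guard
    intro h
    rw [neb_iff] at h
    have u := m.wun s S b a hs hS hb ha
    have w1 := wS b (by omega)
    have w2 := wS a (by omega)
    refine m.holdsL2 _ _ fun x => ?_
    rw [val_neg, not_not, w1] at x
    rw [val_neg, w2]
    exact fun y => h (u x y)
  · apply m.holdsL_guard
    intro h
    simp only [Bool.and_eq_true, ltb_iff] at h
    have u := m.ih S b h.2 (Nat.le_of_ble_eq_true h.1) hb
    have w1 := m.vat_w 0 S b (by omega) (by omega) (by omega)
    have w2 := m.vat_w 1 S b (by omega) (by omega) (by omega)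
    refine m.holdsL2 _ _ fun x => ?_
    rw [val_neg, not_not, w1] at x
    rw [val_neg, w2]
    exact u x
  · apply m.holdsL_guard
    intro h
    have u := m.dd s S b a hs hS hb ha h
    have w1 := wS a (by omega)
    have w2 := mS b (by omega)
    refine m.holdsL3 _ _ _ fun x y => ?_
    rw [val_neg, not_not, w2] at x
    rw [val_neg, not_not, wDb] at y
    rw [val_pos, w1]
    exact u x y
  · apply m.holdsL_guard
    intro h
    have u := m.ee s S b a hs hS hb ha h
    have w1 := wS a (by omega)
    have w2 := mS b (by omega)
    refine m.holdsL3 _ _ _ fun x y => ?_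
    rw [val_neg, not_not, w2] at x
    rw [val_pos, wDb] at y
    rw [val_neg, w1]
    exact fun z => y (u x z)
  · apply m.holdsL_guard
    intro h
    simp only [Bool.and_eq_true, neb_iff] at h
    obtain ⟨⟨⟨⟨h1, h2⟩, h3⟩, h4⟩, h5⟩ := h
    have u := m.ff s S b a d c hs hS hb ha hd hc h1 h2 h3 h4 h5
    have w2 := mS b (by omega)
    have w3 : m.val (gsLit s a b c d) ↔ (s = 0 → m.g a b c d) ∧ (s ≠ 0 → m.g b a d c) := by
      rcases Nat.eq_zero_or_pos s with hs0 | hs0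
      · subst hs0
        have e : gsLit 0 a b c d = gLit a b c d := rfl
        rw [e, m.val_gLit a b c d ha hb hc hd h4 h5 (Or.inr h3)]
        simp
      · have hs1 : s = 1 := by omega
        subst hs1
        have e : gsLit 1 a b c d = gLit b a d c := rfl
        rw [e, m.val_gLit b a d c hb ha hd hc h4.symm h5.symm (Or.inl h3)]
        simp
    refine m.holdsL4 _ _ _ _ fun x y z => ?_
    rw [val_neg, not_not, w2] at x
    rw [val_neg, not_not, wDb] at y
    rw [val_neg, not_not, wDd] at z
    exact w3.2 (u x y z)
  · refine ⟨_, List.mem_singleton.2 rfl, (m.val_pos _).2 ?_⟩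
    have h1 := m.n1
    have e : Nat.pred (Nat.pow 2 n) = 2 ^ n - 1 := rfl
    have hp : 0 < 2 ^ n := by positivity
    rw [e]
    exact (m.vat_w s (2 ^ n - 1) 0 hs (by omega) (by omega)).2 (m.top s hs)
  · exact m.holdsL_taut

theorem holdsL_axm (w : ℕ) : m.HoldsL (axm n w) := by
  unfold axm
  simp only [seqN_eq]
  cases Nat.beq _ _
  · exact m.holdsL_axO ..
  · exact m.holdsL_axT ..

/-- All clauses of a database hold. -/
def OK : DB → Prop
  | .nil => True
  | .node v l r => m.Holds v ∧ OK l ∧ OK r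

theorem holds_get (db : DB) (h : m.OK db) (i : ℕ) : m.Holds (db.get i) := by
  induction db generalizing i with
  | nil => exact m.holds_three
  | node v l r ihl ihr =>
    obtain ⟨hv, hl, hr⟩ := h
    unfold DB.get
    cases Nat.ble i 1
    · cases Nat.beq (Nat.mod i 2) 0
      · exact ihr hr _
      · exact ihl hl _
    · exact hv

theorem insK_spec {α : Type} (f : ℕ) (db : DB) (i x : ℕ) (k : DB → α) (h : m.OK db)
    (hx : m.Holds x) : ∃ db', m.OK db' ∧ DB.insK f db i x k = k db' := by
  induction f generalizing db i k with
  | zero => exact ⟨db, h, by simp [DB.insK]⟩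
  | succ f ih =>
    cases db with
    | nil =>
      unfold DB.insK
      cases Nat.ble i 1
      · rw [seqN_eq]
        cases Nat.beq (Nat.mod i 2) 0
        · obtain ⟨t, ht, he⟩ := ih .nil (Nat.div i 2) (fun t => k (.node 3 .nil t)) trivial
          exact ⟨.node 3 .nil t, ⟨m.holds_three, trivial, ht⟩, he⟩
        · obtain ⟨t, ht, he⟩ := ih .nil (Nat.div i 2) (fun t => k (.node 3 t .nil)) trivial
          exact ⟨.node 3 t .nil, ⟨m.holds_three, ht, trivial⟩, he⟩
      · exact ⟨.node x .nil .nil, ⟨hx, trivial, trivial⟩, rfl⟩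
    | node v l r =>
      obtain ⟨hv, hl, hr⟩ := h
      unfold DB.insK
      cases Nat.ble i 1
      · rw [seqN_eq]
        cases Nat.beq (Nat.mod i 2) 0
        · obtain ⟨t, ht, he⟩ := ih r (Nat.div i 2) (fun t => k (.node v l t)) hr
          exact ⟨.node _ _ _, ⟨hv, hl, ht⟩, he⟩
        · obtain ⟨t, ht, he⟩ := ih l (Nat.div i 2) (fun t => k (.node v t r)) hl
          exact ⟨.node _ _ _, ⟨hv, ht, hr⟩, he⟩
      · exact ⟨.node _ _ _, ⟨hx, hl, hr⟩, rfl⟩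

theorem holds_hint (db : DB) (h : m.OK db) (i : ℕ) : m.Holds (hintC n db i) := by
  unfold hintC
  cases ltb i 10000
  · exact (m.holds_mask _).2 (m.holdsL_axm i)
  · exact m.holds_get db h i

theorem two_pow_mod_three (l : ℕ) : 2 ^ l % 3 = if l % 2 = 0 then 1 else 2 := by
  induction l with
  | zero => rfl
  | succ l ih =>
    rw [pow_succ]
    split_ifs at ih ⊢ <;> omega

theorem flipM_eq (l : ℕ) : flipM (2 ^ l) = 2 ^ flipL l := by
  have h1 : flipM (2 ^ l) = cond (Nat.beq (2 ^ l % 3) 1) (2 ^ l * 2) (2 ^ l / 2) := rfl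
  rw [h1, two_pow_mod_three, flipL_eq]
  by_cases h : l % 2 = 0
  · rw [if_pos h, if_pos h, pow_succ]; rfl
  · rw [if_neg h, if_neg h]
    obtain ⟨k, rfl⟩ : ∃ k, l = k + 1 := ⟨l - 1, by omega⟩
    have e : (2 : ℕ) ^ (k + 1) / 2 = 2 ^ k := by rw [pow_succ]; omega
    rw [e]; rfl

theorem rup_sound (db : DB) (h : m.OK db) (hs : List ℕ) (F : ℕ)
    (hF : ∀ i, F.testBit i = true → ¬ m.val i) : ¬ rup n db hs F = true := by
  induction hs generalizing F with
  | nil => simp [rup]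
  | cons x hs ih =>
    unfold rup
    rw [seqS_eq, seqS_eq]
    obtain ⟨i, hi, hv⟩ := m.holds_hint db h x
    generalize hintC n db x = C at hi
    have hr : Nat.xor C (Nat.land C F) = C ^^^ (C &&& F) := rfl
    rw [hr]
    have hFi : F.testBit i = false := by
      cases hh : F.testBit i
      · rfl
      · exact absurd hv (hF i hh)
    have hbit : (C ^^^ (C &&& F)).testBit i = true := by
      rw [Nat.testBit_xor, Nat.testBit_and, hi, hFi]; rfl
    generalize C ^^^ (C &&& F) = r at hbit
    cases h0 : Nat.beq r 0
    · cases h1 : Nat.beq (Nat.mod (Nat.pow 2 5664) r) 0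
      · simp
      · rw [cond_false, cond_true, seqS_eq]
        apply ih
        have hdvd : r ∣ 2 ^ 5664 := Nat.dvd_of_mod_eq_zero (Nat.eq_of_beq_eq_true h1)
        obtain ⟨l, -, rfl⟩ := (Nat.dvd_prime_pow Nat.prime_two).1 hdvd
        rw [flipM_eq]
        intro j hj
        have hj' : (F ||| 2 ^ flipL l).testBit j = true := hj
        rw [Nat.testBit_or, Nat.testBit_two_pow, Bool.or_eq_true, decide_eq_true_eq] at hj'
        rw [Nat.testBit_two_pow, decide_eq_true_eq] at hbit
        rcases hj' with hj' | rfl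
        · exact hF j hj'
        · rw [m.val_flip, not_not, hbit]; exact hv
    · have : r = 0 := Nat.eq_of_beq_eq_true h0
      rw [this] at hbit
      simp at hbit

theorem run_sound (cert : List (List ℕ × List ℕ)) (db : DB) (h : m.OK db) (i : ℕ) :
    ¬ run n cert db i = true := by
  induction cert generalizing db i with
  | nil => simp [run]
  | cons x rest ih =>
    obtain ⟨ls, hs⟩ := x
    unfold run
    rw [seqS_eq]
    cases hr : rup n db hs (mask ls)
    · simp
    · have hC : m.Holds (mask ls) := by
        by_contra hc
        refine m.rup_sound db h hs (mask ls) ?_ hr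
        intro j hj hv
        exact hc ⟨j, hj, hv⟩
      rw [cond_true]
      cases h0 : Nat.beq (mask ls) 0
      · rw [cond_false, seqN_eq]
        obtain ⟨db', hdb, he⟩ := m.insK_spec 12 db i (mask ls)
          (fun db' => run n rest db' (Nat.succ i)) h hC
        rw [he]
        exact ih db' hdb _
      · exfalso
        rw [Nat.eq_of_beq_eq_true h0] at hC
        obtain ⟨j, hj, -⟩ := hC
        simp at hj

end Model

/-- Part 0 of the certificate for 2 alternatives. -/
def cert2_0 : List (List ℕ × List ℕ) := [
    ([2631],
      [100000000, 50030100]),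
    ([3399],
      [101000000, 51030100]),
    ([4933],
      [21001000, 2, 71030100]),
    ([4934],
      [3, 31030000]),
    ([85],
      [4, 21000000, 21001000, 91031001]),
    ([4165],
      [20001000, 1, 70030100]),
    ([4167],
      [20001000, 20000000, 5, 90031001]),
    ([],
      [6, 7, 30030000])]

/-- The certificate for 2 alternatives. -/
def cert2 : List (List ℕ × List ℕ) :=
    cert2_0

theorem run2 : run 2 cert2 .nil 1 = true := by decide +kernel

/-- Part 0 of the certificate for 3 alternatives. -/
def cert3_0 : List (List ℕ × List ℕ) := [
    ([4933, 3373, 84],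
      [21001000, 91030110]),
    ([4165, 2605, 85],
      [20001000, 90030110]),
    ([3447],
      [101000000, 51070100]),
    ([3449],
      [101000000, 51070200]),
    ([2679],
      [100000000, 50070100]),
    ([2681],
      [100000000, 50070200]),
    ([3397, 4215],
      [100000000, 101000000, 20000000, 3, 80071000, 60050000, 81071000, 60030000, 70031000,
      30030000, 2, 90071001, 40060000, 90071002, 60062000, 41060000, 71070100, 91072001,
      31070000]),
    ([4981],
      [4, 3, 71070200, 71070100, 41060000]),
    ([4215],
      [100000000, 101000000, 8, 80071000, 7, 60050000, 81072000, 81071000, 31070000]),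
    ([96, 2667, 2629],
      [9, 5, 90072001, 70070100, 30070000]),
    ([3396],
      [8, 21000000, 101000000, 41030000, 71031000, 81072000, 60031000, 31030000, 31070000,
      40030000, 1, 81071000, 91071001, 41060000, 60062000, 91071002, 40060000, 10]),
    ([2629],
      [11, 60030000]),
    ([4217],
      [12, 100000000, 80072000]),
    ([4212],
      [13, 9, 30070000]),
    ([2669],
      [14, 6, 70070200]),
    ([2667],
      [14, 5, 70070100]),
    ([],
      [16, 15, 40060000])]

/-- The certificate for 3 alternatives. -/
def cert3 : List (List ℕ × List ℕ) :=
    cert3_0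

theorem run3 : run 3 cert3 .nil 1 = true := by decide +kernel

/-- Part 0 of the certificate for 4 alternatives. -/
def cert4_0 : List (List ℕ × List ℕ) := [
    ([2779],
      [100000000, 50150300]),
    ([2775],
      [100000000, 50150100]),
    ([4309, 2767],
      [1, 70150300]),
    ([4933, 3398],
      [21001000, 71030100]),
    ([4167, 2619, 84],
      [20000000, 90031001]),
    ([4313, 2724],
      [100000000, 80152000]),
    ([4237, 2695, 253],
      [20000000, 90090330]),
    ([4165, 2630],
      [20001000, 70030100]),
    ([3547],
      [101000000, 51150300]),
    ([3545],
      [101000000, 51150200]),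
    ([3543],
      [101000000, 51150100]),
    ([4311, 2748],
      [100000000, 80151000]),
    ([5079, 3521],
      [10, 71151200]),
    ([4309, 2763],
      [2, 70150100]),
    ([4313, 2727],
      [2, 70152100]),
    ([5011, 3468],
      [21000000, 71093000]),
    ([5079, 3523],
      [9, 71151300]),
    ([5083, 3447],
      [11, 71153100]),
    ([4933, 84],
      [21001000, 21000000, 91030110]),
    ([5077, 3531],
      [11, 71150100]),
    ([4315, 2676],
      [100000000, 80153000]),
    ([4243, 2700],
      [20000000, 70093000]),
    ([5077, 3535],
      [9, 71150300]),
    ([4957, 3424],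
      [21002000, 71050200]),
    ([4167, 2628],
      [20000000, 70031000]),
    ([5081, 3492],
      [101000000, 81152000]),
    ([4243, 252],
      [20003000, 20000000, 90093003]),
    ([4935, 85],
      [21001000, 21000000, 91031001]),
    ([5005, 252],
      [21003000, 21000000, 91090330]),
    ([4237, 2706],
      [20003000, 70090300]),
    ([2777],
      [100000000, 50150200]),
    ([5077],
      [10, 71150200, 20, 23, 41140000]),
    ([4981, 5083],
      [10, 18, 71153200, 71070100, 71070200, 41060000]),
    ([5081, 5029],
      [11, 9, 71152100, 71152300, 71110100, 71110300, 41100000]),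
    ([4315, 2765, 180],
      [90153002, 21]),
    ([4289, 2749, 2743, 180],
      [90132003, 80132000]),
    ([4311, 4290, 2741, 168],
      [31, 12, 70151200, 70130200, 30130000, 90132002, 80132000]),
    ([4309, 2766],
      [31, 70150200, 14, 40140000]),
    ([2701, 3487, 3493, 5028],
      [50090300, 60090000, 30, 81111000, 30090000, 31110000, 27, 91113003, 81113000]),
    ([4315, 108, 2766, 180],
      [35, 21, 40140000, 90153001]),
    ([2741, 4288, 2653, 2752, 180],
      [70130200, 90133002, 30130000]),
    ([4311, 180, 96, 2762],
      [1, 31, 20000000, 20002000, 70151300, 12, 70151200, 90151002, 40140000, 90151003, 10013002,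
      10010220, 90052002, 30050000, 70050200, 70133200, 37, 40120000, 70130300, 36, 30130000]),
    ([4315, 168, 2669],
      [20000000, 20002000, 31, 90052002, 30050000, 70050200, 70153200, 21, 70071200, 70070200,
      30070000, 90072002, 80072000]),
    ([4309],
      [3, 38]),
    ([168, 4315, 96],
      [2, 31, 20000000, 20002000, 21, 70153200, 70153100, 90052002, 43, 30050000, 40060000,
      70050200, 70070100, 70071200, 30070000, 90072001, 80072000]),
    ([2667, 2653, 84, 2678],
      [20001000, 5, 30030000, 8, 70072100, 70070100, 90071001, 30070000]),
    ([4315, 96],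
      [2, 31, 20002000, 20000000, 20001000, 70153100, 70153200, 45, 90050220, 10010220, 30050000,
      10011002, 70052000, 5, 30030000, 8, 70072100, 46, 40060000, 70070200, 90071002, 30070000]),
    ([85, 97, 4980, 3446, 3445],
      [28, 31030000, 4, 71072100, 31070000, 81071000, 91071001, 91071002, 41060000]),
    ([5053, 5079],
      [17, 13, 71130200, 71130300, 41120000]),
    ([5057, 3509, 181, 5079],
      [101000000, 21003000, 21000000, 17, 81151000, 71132300, 81132000, 71090300, 91132002,
      31090000, 10020320, 91093003, 10023003])]

/-- Part 1 of the certificate for 4 alternatives. -/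
def cert4_1 : List (List ℕ × List ℕ) := [
    ([3509, 181, 5079],
      [101000000, 49, 81151000, 50, 31130000, 81133000, 91133002]),
    ([5059, 181, 5079],
      [101000000, 21002000, 21000000, 51, 41120000, 13, 81151000, 71133200, 81133000, 24,
      91133003, 31050000, 10023003, 91052002, 10020320]),
    ([181, 5079],
      [101000000, 49, 81151000, 51, 41120000, 52, 31130000, 91132003, 81132000]),
    ([109, 97, 5079],
      [101000000, 53, 10012003, 81151000, 91151002, 10010310, 91151003, 91151001, 41140000]),
    ([4313, 2707, 2628],
      [1, 70152300, 6, 15, 70111300, 80113000, 30110000, 70110100, 70110300, 40100000]),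
    ([4311, 180, 84, 96],
      [12, 42, 90151001]),
    ([180, 84, 96],
      [20001000, 44, 5, 30030000, 8, 50030100, 47, 56, 30150000, 6, 55, 90152001, 90152003, 30,
      40140000, 30090000, 90152002, 27, 10022003, 10020330]),
    ([2719, 2701, 4266, 2730, 108],
      [70110300, 90111003, 30110000]),
    ([4313, 108, 84],
      [20001000, 1, 5, 30030000, 8, 50030100, 70152300, 6, 15, 55, 80113000, 40090000, 58,
      40100000, 90111001, 70110100, 30110000]),
    ([108, 84, 96],
      [44, 47, 59, 30150000, 12, 90151003, 90151002, 90151001, 40140000]),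
    ([5081, 3487, 2701],
      [26, 34, 39]),
    ([5083, 3534, 109, 181],
      [101000000, 81153000, 91153001, 91153002, 41140000]),
    ([5081, 3475, 2701, 109, 3397],
      [9, 71152300, 34, 61, 71111300, 41100000, 31110000, 91113001]),
    ([84, 96],
      [20003000, 21000000, 21003000, 32, 101000000, 19, 31030000, 71031000, 57, 10010320, 53, 60,
      10013003, 7, 91093003, 30090000, 31090000, 22, 71090300, 63, 31150000, 81153000, 91153003,
      62]),
    ([4311, 180, 2701, 168],
      [20000000, 20002000, 1, 90052002, 30050000, 70050200, 50050200, 70151300, 12, 80133000, 37,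
      40120000, 90132003, 70130300, 30130000]),
    ([2701, 109, 5083, 96],
      [101000000, 44, 81153000, 91153001, 64, 10011002, 10010220, 47, 50090300, 30, 30090000, 27,
      91153003, 62, 41140000, 60142000, 65, 30150000, 6, 90152001, 90152003, 40140000]),
    ([4313, 180, 96],
      [64, 10011002, 10010220, 6, 90152003, 90152002, 90152001, 40140000]),
    ([109, 5083, 96],
      [20000000, 20002000, 20003000, 44, 1, 64, 10011002, 10010220, 90052002, 30050000, 70050200,
      50050200, 47, 10013020, 66, 22, 40090000, 30090000, 7, 10023003, 67, 30150000, 70151300, 12,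
       70132300, 80133000, 30130000, 37, 70130300, 40120000]),
    ([108, 96],
      [20000000, 20002000, 44, 1, 64, 10011002, 10010220, 90052002, 30050000, 70050200, 50050200,
      47, 10011003, 10010230, 10010330, 67, 27, 30150000, 30090000, 70151300, 12, 30, 70132300,
      80133000, 30130000, 37, 70130300, 40120000]),
    ([5081, 96],
      [11, 69, 64, 28, 31030000, 4, 71152100, 26, 34, 71113100, 31110000, 81111000, 91111001,
      91111003, 41100000]),
    ([96],
      [32, 101000000, 44, 47, 69, 68, 70, 31150000, 81151000, 53, 60130000, 67, 12, 30150000]),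
    ([85, 5028, 3493, 3494, 109],
      [28, 31030000, 4, 71113100, 31110000, 81111000, 91111001, 91111003, 41100000]),
    ([109, 5082],
      [32, 11, 71, 54, 31150000, 71152100, 26, 34, 91152001, 72, 10010210, 10012002, 10013002,
      91152002, 91152003, 41140000]),
    ([5081, 84, 108],
      [20002000, 20000000, 71, 44, 1, 31, 10010210, 10012002, 90050220, 30050000, 70052000, 59,
      10012030, 26, 91152001, 91152002, 41140000, 91152003, 60143000, 10020330, 40, 27, 30150000,
      30090000, 70151300, 70151200, 30, 70132300, 41, 40120000, 90133003, 70130300, 30130000]),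
    ([84, 5082],
      [71, 32, 101000000, 44, 73, 10012030, 59, 74, 31150000, 81151000, 53, 60130000, 10020330,
      12, 30150000, 21, 40, 90153003]),
    ([4261, 4313],
      [1, 15, 70152300, 70110100, 70110300, 40100000]),
    ([4267, 5082],
      [20000000, 20001000, 75, 90030110, 30030000, 25, 73, 10011003, 10010330, 90113001, 90113003,
       40100000]),
    ([5079, 4312, 5082],
      [101000000, 71, 44, 75, 73, 81151000, 53, 91151001, 91151002, 60130000, 41140000, 12,
      60143000, 30150000, 40]),
    ([4263, 5082],
      [1, 32, 11, 73, 75, 10011003, 10010330, 29, 31090000, 16, 27, 30090000, 30, 28, 31030000, 4,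
       70111300, 70152300, 78, 31150000, 71152100, 34, 71113100, 31110000, 91111001, 91111031,
      41100000, 90111301, 60103000, 40100000]),
    ([4315, 5082],
      [32, 71, 77, 79, 30110000, 76, 78, 31150000, 26, 91152001, 73, 75, 10011003, 10010330, 21,
      90153001, 90153003, 40140000, 40, 60142000, 91152003, 41140000]),
    ([181, 5082],
      [32, 71, 77, 79, 30110000, 76, 78, 31150000, 26, 91152001, 73, 10012030, 10020320, 91152003,
       91152002, 41140000]),
    ([168, 5082],
      [31, 44, 1, 20000000, 20002000, 73, 75, 10011003, 10010330, 27, 30090000, 30, 77, 79,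
      30110000, 76, 80, 30150000, 70151300, 70132300, 70151200, 90052002, 30050000, 70050200,
      70133200, 37, 30130000, 40120000, 70130300]),
    ([5082],
      [44, 1, 31, 20002000, 20000000, 73, 75, 10011003, 10010330, 27, 30090000, 30, 77, 79,
      30110000, 76, 80, 30150000, 70151300, 70151200, 70132300, 81, 82, 90050220, 30050000,
      70052000, 41, 40120000, 90133003, 70130300, 30130000]),
    ([3449],
      [83, 10, 71153200]),
    ([3444],
      [83, 101000000, 81153000]),
    ([3447],
      [83, 18]),
    ([4981],
      [83, 33]),
    ([85],
      [87, 71, 86, 85, 48]),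
    ([4933],
      [88, 19]),
    ([77],
      [88, 71, 10010210]),
    ([4934],
      [89, 31030000]),
    ([168],
      [90, 71, 10012002]),
    ([3396],
      [91, 21000000, 71031000]),
    ([4961],
      [92, 21000000, 21002000, 91052002]),
    ([4956],
      [94, 31050000]),
    ([3424],
      [95, 24]),
    ([4983],
      [96, 84, 71071200]),
    ([4984],
      [97, 87, 31070000]),
    ([3437],
      [98, 92, 93, 91072002]),
    ([3435],
      [98, 93, 71, 91072001])]

/-- Part 2 of the certificate for 4 alternatives. -/
def cert4_2 : List (List ℕ × List ℕ) := [
    ([],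
      [100, 99, 41060000])]

/-- The certificate for 4 alternatives. -/
def cert4 : List (List ℕ × List ℕ) :=
    cert4_0 ++
    (cert4_1 ++
    (cert4_2))

theorem run4 : run 4 cert4 .nil 1 = true := by decide +kernel

/-- Part 0 of the certificate for 5 alternatives. -/
def cert5_0 : List (List ℕ × List ℕ) := [
    ([4167, 2628],
      [20000000, 70031000]),
    ([4167, 2619, 84],
      [20000000, 90031001]),
    ([5191, 3656],
      [21004000, 71243400]),
    ([5193, 1639],
      [21004000, 21003000, 91244334]),
    ([5047, 3508],
      [21002000, 71123200]),
    ([4237, 2695, 253],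
      [20000000, 90090330]),
    ([5019, 3387, 686],
      [21003000, 91101331]),
    ([2971],
      [100000000, 50310300]),
    ([2967],
      [100000000, 50310100]),
    ([4193, 2652],
      [20000000, 70052000]),
    ([4243, 2695, 252],
      [20000000, 90093003]),
    ([5141, 3608],
      [21004000, 71202400]),
    ([4341, 2796],
      [20000000, 70174000]),
    ([4509, 2775],
      [9, 70314100]),
    ([4377, 2645, 1204],
      [20004000, 90204224]),
    ([2969],
      [100000000, 50310200]),
    ([4501, 2957],
      [16, 70310200]),
    ([5101, 3572],
      [21004000, 71170400]),
    ([4165, 2619, 85],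
      [20000000, 90030110]),
    ([4509, 2772],
      [100000000, 80314000]),
    ([4347, 2816],
      [20004000, 70181400]),
    ([5005, 3373, 252],
      [21003000, 91090330]),
    ([4243, 2700],
      [20000000, 70093000]),
    ([4423, 2888],
      [20004000, 70243400]),
    ([4423, 2695, 1639],
      [20004000, 90243443]),
    ([5045, 1120],
      [21003000, 21002000, 91122332]),
    ([4333, 2804],
      [20004000, 70170400]),
    ([4507, 2873],
      [16, 70313200]),
    ([4193, 2645, 168],
      [20000000, 90052002]),
    ([2973],
      [100000000, 50310400]),
    ([4507, 2871],
      [9, 70313100]),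
    ([4333, 337],
      [20004000, 20000000, 90170440]),
    ([4251, 2695, 687],
      [20001000, 90101331]),
    ([5109, 337],
      [21004000, 21000000, 91174004]),
    ([4277, 2645, 1121],
      [20003000, 90122332]),
    ([5145, 1205],
      [21004000, 21002000, 91204224]),
    ([5101, 336],
      [21004000, 21000000, 91170440]),
    ([4933, 84],
      [21001000, 21000000, 91030110]),
    ([4509, 2777],
      [16, 70314200]),
    ([4503, 2947],
      [8, 70311300]),
    ([4353, 770],
      [20004000, 20001000, 90184114]),
    ([4509, 2779],
      [8, 70314300]),
    ([5115, 770],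
      [21004000, 21001000, 91181441]),
    ([4347, 771],
      [20004000, 20001000, 90181441]),
    ([5005, 3474],
      [21003000, 71090300]),
    ([3739],
      [101000000, 51310300]),
    ([3735],
      [101000000, 51310100]),
    ([3741],
      [101000000, 51310400]),
    ([3737],
      [101000000, 51310200]),
    ([4353, 2810],
      [20001000, 70184100])]

/-- Part 1 of the certificate for 5 alternatives. -/
def cert5_1 : List (List ℕ × List ℕ) := [
    ([4961, 3420],
      [21000000, 71052000]),
    ([4501, 2959],
      [8, 70310300]),
    ([4453, 2924, 2922, 2906],
      [70270400, 70270300, 40260000]),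
    ([4501, 2956],
      [9, 30, 70310100, 70310400, 52, 40300000]),
    ([4507, 108, 264, 2956, 252],
      [100000000, 80313000, 90313004, 90313003, 90313001, 40300000]),
    ([4509, 120, 264, 336, 2956],
      [20, 90314001, 90314004, 90314003, 40300000]),
    ([2730, 2724, 4260, 254, 2719, 2707],
      [40110000, 70111300, 30110000, 90113103, 80113100]),
    ([5269, 3722],
      [49, 46, 48, 71310200, 71310300, 71310400, 41300000]),
    ([5053, 3421, 252],
      [21002000, 21000000, 51050200, 71050200, 31050000, 91052002, 22, 31090000, 71093000,
      91130330, 91130220, 41120000]),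
    ([2730, 4260, 2719, 254, 2707],
      [70111300, 57, 30110000, 80113000, 90113013]),
    ([4501],
      [17, 54]),
    ([5125, 3589],
      [51190400, 51190100, 71190100, 71190400, 41180000]),
    ([3565, 121, 5127, 85],
      [91191001, 91191004, 41180000]),
    ([3421, 3444, 3397, 3437],
      [21000000, 21002000, 71072000, 51050200, 71071000, 71050200, 31070000, 31050000, 91070220,
      91052002]),
    ([3629, 5176, 3613, 97, 5180, 3640],
      [71230200, 91231002, 31230000]),
    ([3609, 5156, 3620, 193, 3565],
      [71210400, 91212004, 31210000]),
    ([3613, 193, 3420, 3565],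
      [21002000, 21000000, 51, 31050000, 91050220, 51210200, 51210400, 81214000, 66, 41200000,
      71210200, 91212002, 31210000]),
    ([3627, 5174, 97, 5180, 3638, 3589],
      [91232001, 71230100, 31230000]),
    ([3629, 5174, 169, 5180, 3640, 3589],
      [71230200, 91232002, 31230000]),
    ([2804, 3661, 3469, 3657],
      [20004000, 20000000, 51250400, 71250400, 40170000, 27, 60170000, 30170000, 81253000,
      90174004, 31250000, 91254004]),
    ([109, 84, 252],
      [10010310, 10013003]),
    ([5133, 121, 3397, 337],
      [91194004, 91194001, 41180000]),
    ([91, 84, 687],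
      [10011310, 10011331]),
    ([4505, 2820, 4454, 2727, 2907],
      [9, 100000000, 70312100, 80312000, 70270100, 70274100, 80273000, 30270000]),
    ([2774, 4314, 2727, 4310, 2763],
      [70150100, 70152100, 30150000]),
    ([4503, 84, 2955],
      [100000000, 80311000, 90311001]),
    ([4455, 2917, 84, 2907],
      [90271001, 80271000]),
    ([4505, 4266, 2820, 84, 2715, 2907],
      [9, 100000000, 70312100, 80312000, 70270100, 77, 74, 80273000, 70110100, 30270000, 30110000,
       80274000, 90111001, 80111000]),
    ([4263, 84, 2718],
      [20003000, 20001000, 2, 30030000, 70030100, 70101300, 30100000, 90103113, 40100000,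
      90111331, 90111001, 40090000]),
    ([2917, 4454, 2724, 2820, 2907],
      [50270100, 80273000, 80274000, 70270100, 30270000]),
    ([2822, 4358, 2631, 2811],
      [70194100, 70190100, 30190000]),
    ([4311, 2773, 84, 2763],
      [90151001, 80151000]),
    ([2678, 2631, 4214, 2667],
      [70070100, 70072100, 30070000]),
    ([4509, 4314, 2727, 84, 2763],
      [14, 20, 75, 82]),
    ([2726, 4262, 2631, 2715],
      [70110100, 70113100, 30110000]),
    ([2844, 4380, 2797, 2653],
      [70214000, 70212000, 30210000]),
    ([5271, 97, 3709, 109, 121, 3722],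
      [91311003, 91311004, 91311002, 41300000]),
    ([2676, 2629, 4212, 2653],
      [70071000, 70072000, 30070000]),
    ([96, 85, 169],
      [10010220, 10011002]),
    ([2724, 2701, 4260, 2629],
      [70113000, 70111000, 30110000]),
    ([108, 253, 85],
      [10011003, 10010330]),
    ([5271, 109, 97, 121, 3722],
      [101000000, 81311000, 87]),
    ([2900, 2805, 4436, 2889],
      [70250400, 70253400, 30250000]),
    ([3661, 5202, 3468, 3655],
      [51250300, 81254000, 71250300, 31250000]),
    ([252, 2714, 2730],
      [20001000, 20003000, 70103100, 30100000, 33, 40100000, 70110300, 11, 30090000, 70090300, 60,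
       10031330, 10033113]),
    ([5277, 193, 3722, 265, 337],
      [101000000, 81314000, 91314004, 91314003, 91314002, 41300000]),
    ([192, 169, 337],
      [10020440, 10022004]),
    ([4405, 4507, 2858],
      [30, 28, 70313400, 70230400, 70230200, 40220000]),
    ([4507, 2844, 2820, 4412, 2858],
      [100000000, 80313000, 98, 80232000, 80231000, 30230000]),
    ([4985, 3445, 169, 3437],
      [91072002, 81072000])]

/-- Part 2 of the certificate for 5 alternatives. -/
def cert5_2 : List (List ℕ × List ℕ) := [
    ([5079, 3533, 3541, 97],
      [81151000, 91151002]),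
    ([3533, 5082, 3544, 3541, 97, 169],
      [71150200, 101, 31150000, 81152000, 91152002]),
    ([3589, 5126, 3396],
      [62, 81194000, 31190000]),
    ([110, 3469, 3494, 3396],
      [21000000, 21001000, 41030000, 71113100, 71031000, 31030000, 38, 10011013, 10011331,
      91111031, 7, 31110000, 31100000, 71110100, 71103100]),
    ([686, 111, 3469, 3494, 3399],
      [21001000, 71113100, 7, 10013113, 31100000, 91111031, 71103100, 31110000, 71110100]),
    ([4477, 2941],
      [50290200, 50290300, 50290400, 70290200, 70290400, 70290300, 40280000]),
    ([265, 336, 252],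
      [10034004, 10030430]),
    ([5269],
      [47, 71310100, 58]),
    ([3565, 168, 3605, 3612],
      [21002000, 21000000, 91050220, 31050000, 51, 71214000, 71212000, 91210220, 31210000]),
    ([2741, 174, 4290, 2755, 2752],
      [70130200, 30130000, 80132300, 90132302]),
    ([175, 1121, 168],
      [10022320, 10022332]),
    ([2752, 174, 2741, 2748, 2657],
      [40130000, 70133200, 110]),
    ([5253, 3701, 3709, 193],
      [81294000, 91294002]),
    ([3657, 3668, 3564],
      [21000000, 20003000, 20004000, 41170000, 71253400, 71174000, 31170000, 37, 60244000,
      71250400, 24, 31250000, 30240000, 91254004, 90244334, 41090000, 91254334]),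
    ([2741, 2748, 2752, 168],
      [20002000, 29, 30050000, 70050200, 60122000, 112, 5, 111, 31120000, 26]),
    ([4341, 336],
      [20000000, 20004000, 90174004]),
    ([4508, 4504, 4506, 4502],
      [61, 30310000]),
    ([5275, 3645],
      [48, 71313400]),
    ([4935, 85],
      [21001000, 21000000, 91031001]),
    ([5275, 3641],
      [49, 71313200]),
    ([5011, 253],
      [21003000, 21000000, 91093003]),
    ([4425, 1638],
      [20004000, 20003000, 90244334]),
    ([4961, 169],
      [21002000, 21000000, 91052002]),
    ([5273, 3684],
      [101000000, 81312000]),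
    ([4505, 2919],
      [9, 70312100]),
    ([5270, 5272, 5276, 5274],
      [108, 31310000]),
    ([4189, 169],
      [20000000, 20002000, 90050220]),
    ([4255, 2714],
      [20001000, 70103100]),
    ([4503, 2945],
      [16, 70311200]),
    ([5019, 3486],
      [21003000, 71101300]),
    ([5273, 3693],
      [48, 71312400]),
    ([4373, 2840],
      [20004000, 70202400]),
    ([4165, 2630],
      [20001000, 70030100]),
    ([4507, 2868],
      [100000000, 80313000]),
    ([5273, 3691],
      [46, 71312300]),
    ([4957, 168],
      [21002000, 21000000, 91050220]),
    ([4167, 84],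
      [20001000, 2]),
    ([5023, 687],
      [21003000, 21001000, 91103113]),
    ([4503, 2940],
      [100000000, 80311000]),
    ([4957, 3424],
      [21002000, 71050200]),
    ([5121, 3578],
      [21001000, 71184100]),
    ([4505, 2923],
      [8, 70312300]),
    ([4189, 2656],
      [20002000, 70050200]),
    ([4933, 3398],
      [21001000, 71030100]),
    ([5275, 3636],
      [101000000, 81313000]),
    ([4505, 2916],
      [100000000, 80312000]),
    ([4237, 253],
      [20003000, 6]),
    ([4243, 252],
      [20003000, 11]),
    ([4505, 2925],
      [30, 70312400]),
    ([5277, 3547],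
      [46, 71314300])]

/-- Part 3 of the certificate for 5 alternatives. -/
def cert5_3 : List (List ℕ × List ℕ) := [
    ([4377, 1204],
      [20002000, 15]),
    ([4425, 2886],
      [20003000, 70244300]),
    ([4507, 2877],
      [30, 70313400]),
    ([5277, 3540],
      [101000000, 81314000]),
    ([4165, 85],
      [20001000, 19]),
    ([5005, 252],
      [21000000, 22]),
    ([5277, 3543],
      [47, 71314100]),
    ([5011, 3468],
      [21000000, 71093000]),
    ([5273, 3687],
      [47, 71312100]),
    ([4423, 1639],
      [20003000, 25]),
    ([5271, 3717],
      [48, 71311400]),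
    ([4237, 2706],
      [20003000, 70090300]),
    ([5271, 3708],
      [101000000, 81311000]),
    ([4935, 3396],
      [21000000, 71031000]),
    ([4193, 168],
      [20002000, 29]),
    ([5109, 3564],
      [21000000, 71174000]),
    ([5271, 3713],
      [49, 71311200]),
    ([4251, 687],
      [20003000, 33]),
    ([4277, 1121],
      [20002000, 35]),
    ([4279, 2740],
      [20002000, 70123200]),
    ([5277, 3545],
      [49, 71314200]),
    ([5275, 3639],
      [47, 71313100]),
    ([2752, 2741, 168],
      [165, 30050000, 143, 70133200, 70130200, 115, 30130000, 90132002, 80132000]),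
    ([256, 253, 1121],
      [10033023, 10032332]),
    ([4309, 4509],
      [42, 39, 14, 70150200, 70150300, 70150100, 40140000]),
    ([113, 1120, 84],
      [10013223, 10012310]),
    ([2718, 2726, 84, 2631],
      [40100000, 79, 85]),
    ([2731, 4314, 4308, 2778, 2773, 112],
      [70152300, 30150000, 90151023, 80151000]),
    ([2906, 4460, 108, 4458, 2924, 2917, 2922, 120],
      [53, 30270000, 80271000, 90271003, 90271004, 40260000]),
    ([4267, 108, 4505, 84, 120, 2628, 2820],
      [146, 80273000, 149, 142, 125, 40030000, 80113000, 70113100, 70274100, 179, 80, 77]),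
    ([108, 4262, 4505, 2719, 84, 120, 2628, 2820],
      [146, 80273000, 149, 142, 180, 30110000, 70110300, 50110300, 70274300, 179, 80, 77]),
    ([4505, 2719, 108, 84, 120, 2628, 2820],
      [142, 146, 149, 80273000, 181, 90111003, 80111000, 80274000, 179, 80, 77]),
    ([4503, 108, 96, 84, 120],
      [139, 90311004, 76, 90311002, 90311003, 40300000]),
    ([108, 4508, 96, 84, 120, 2628, 4506, 2820],
      [40030000, 183, 117, 125, 142, 146, 149, 182, 180, 80273000, 40100000, 177, 78, 70274100,
      179]),
    ([3522, 3520, 5058, 3475],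
      [71132300, 31130000, 71130300, 71130200, 41120000]),
    ([5059, 181, 3421, 253],
      [91133003, 91133002, 41120000]),
    ([5077, 5277],
      [171, 157, 150, 71150100, 71150200, 71150300, 41140000]),
    ([5083, 3445, 109, 181, 253],
      [91153003, 91153002, 91153001, 41140000]),
    ([5079, 5058, 3475, 5277],
      [171, 150, 71151300, 71151200, 185]),
    ([3498, 3475, 5034, 3487],
      [71110300, 71111300, 31110000]),
    ([3668, 260, 3660, 3475, 3657],
      [114, 71250400, 91254330, 71253000, 31250000]),
    ([4311, 2773, 108, 2762, 96],
      [80151000, 90151002, 90151003, 40140000]),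
    ([3517, 5058, 3475],
      [51130200, 51130300, 185]),
    ([2727, 4314, 4509, 108, 96, 84],
      [175, 20, 14, 84, 70152100, 192, 30150000]),
    ([3675, 5228, 5222, 3686, 109, 3589],
      [91273001, 71270100, 31270000]),
    ([5221, 3674, 3690, 3692],
      [71270300, 71270400, 41260000]),
    ([180, 253, 169],
      [10020330, 10022003]),
    ([4509, 2957, 192],
      [20, 90314002]),
    ([3661, 3468, 3564],
      [51250400, 81253000, 114, 94, 41240000]),
    ([5273, 3660, 3492, 3588],
      [124, 131, 135, 159, 81273000, 81274000, 81271000, 31270000, 71270100, 196])]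

/-- Part 4 of the certificate for 5 alternatives. -/
def cert5_4 : List (List ℕ × List ℕ) := [
    ([5245, 3709],
      [51290200, 51290400, 51290300, 71290300, 71290400, 71290200, 41280000]),
    ([3498, 5034, 687, 91],
      [73, 119, 31030000, 144, 138, 31100000, 130, 71110300, 190, 31110000, 41090000, 91111031]),
    ([5273, 5226, 5222, 3492],
      [124, 131, 135, 159, 81274000, 31270000, 71270100, 196]),
    ([5277, 3499, 5078, 3444],
      [150, 154, 187, 71152300, 81153000, 31150000]),
    ([3435, 3445, 85],
      [155, 30030000, 1, 60030000, 81072000, 51070100, 71070100, 31070000, 91071001, 81071000]),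
    ([4459, 2917, 108, 2907],
      [80273000, 90273001]),
    ([2893, 2796, 2700],
      [40170000, 50250400, 50250300, 80253000, 80254000, 93, 30250000, 40240000, 70250300]),
    ([4483, 180, 2941, 264, 252],
      [80293000, 90293004, 90293003, 90293002, 40280000]),
    ([2741, 4288, 2749, 180],
      [50130200, 70130200, 30130000, 80133000, 90133002]),
    ([4507, 180, 264, 108, 252],
      [134, 55, 90313002]),
    ([3421, 5056, 3516, 252],
      [59, 71133000, 31130000]),
    ([338, 337, 771],
      [10041441, 10044014]),
    ([3516, 3421, 252, 3469],
      [71132000, 211]),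
    ([2941, 2892, 264, 2748, 180, 252],
      [106, 80292000, 80294000, 208, 30290000]),
    ([4507, 4406, 4408, 2676],
      [134, 31, 80234000, 30230000, 70230100, 98]),
    ([4505, 2917, 2956, 192, 180, 96],
      [90312001, 90312004, 90312003, 40300000]),
    ([2893, 4436, 2889, 264, 2700],
      [50250400, 207, 70250400, 90253004, 30250000]),
    ([5277, 3444, 5078, 3492],
      [154, 187, 81152000, 81153000, 31150000]),
    ([3541, 3444, 5078, 3492],
      [51150100, 51150200, 51150300, 81152000, 81153000, 31150000, 71150100, 71150200, 71150300,
      41140000]),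
    ([2749, 180, 252, 3469],
      [60090000, 60130000, 50130300, 80132000, 213, 209, 41050000, 40120000, 60052000, 70130300,
      40050000, 30130000, 90133003]),
    ([180, 2941, 264, 2892, 252, 3469],
      [220, 214]),
    ([4485, 2941, 192, 336, 264],
      [80294000, 90294003, 90294004, 90294002, 40280000]),
    ([2941, 2844, 192, 336, 264, 2892],
      [106, 80292000, 222, 80293000, 30290000]),
    ([4213, 2653, 97, 85],
      [90070210, 90070110, 40060000]),
    ([5249, 193, 169, 181, 3661],
      [91292002, 91292004, 91292003, 41280000]),
    ([4217, 168, 96, 2629],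
      [90072002, 90072001, 40060000]),
    ([2677, 4216, 2652],
      [50070200, 50070100, 80071000, 30070000, 70070200, 70070100, 40060000]),
    ([4485, 2944, 2748, 2946],
      [70294200, 70294300, 40130000]),
    ([5253, 265, 193, 3517, 337, 3709],
      [91294004, 113, 91294003, 41280000]),
    ([165, 168, 771],
      [10021420, 10021441]),
    ([5251, 5156, 3564, 3712, 3709, 3716],
      [81293000, 71293200, 71293400, 81212000, 31210000, 71210200, 71210400, 41200000]),
    ([120, 337, 85],
      [10011004, 10010440]),
    ([4509, 4314, 112, 2731],
      [20, 42, 175, 178]),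
    ([4505, 2917, 192, 96, 168, 180],
      [216, 90312002]),
    ([4509, 2676, 2748, 2724],
      [20, 175, 80152000, 80151000, 80153000, 30150000]),
    ([4509, 264, 192, 120, 336],
      [56, 198]),
    ([1639, 4434, 3668, 264, 3660, 2805, 3475],
      [60093000, 40090000, 4, 160, 31240000, 30240000, 3, 152, 191, 90254003, 90250334,
      30250000]),
    ([3655, 3661, 3565, 3468],
      [158, 31090000, 156, 91253003, 94]),
    ([256, 180, 5058, 3421, 3468],
      [158, 31090000, 156, 41090000, 91132330, 174, 31130000, 26, 91130230, 31120000, 5]),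
    ([4313, 180, 168, 96, 2725],
      [90152001, 90152003, 90152002, 40140000]),
    ([5277, 5058, 3421, 109, 3468, 3499],
      [158, 31090000, 156, 41090000, 150, 187, 189, 71152300, 204, 31150000, 91153023, 188, 239]),
    ([3666, 3660, 264, 3565, 3475],
      [71253000, 41250000, 71254300, 31250000, 91250430, 81250400]),
    ([2893, 3668, 264, 3660, 336, 2796, 3475],
      [40170000, 60093000, 40090000, 50250400, 80253000, 237, 122, 30240000, 24, 90254004, 93]),
    ([4381, 2852, 2848],
      [70210200, 70210400, 40200000]),
    ([2845, 340, 2848, 2796],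
      [40170000, 50210400, 80212000, 244, 30210000, 80214000, 90214024]),
    ([2749, 2754, 4288, 2652, 180],
      [80133000, 209, 30130000, 40120000, 70130300]),
    ([4481, 2893, 168, 180, 192],
      [90292003, 90292004, 90292002, 40280000]),
    ([5271, 97, 109, 121, 85],
      [163, 92, 91311001]),
    ([4505, 192, 180, 168, 96],
      [146, 234]),
    ([4509, 2676, 4312, 2748],
      [20, 175, 80153000, 80151000, 30150000])]

/-- Part 5 of the certificate for 5 alternatives. -/
def cert5_5 : List (List ℕ × List ℕ) := [
    ([4509, 180, 2676, 168, 96, 2748],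
      [235, 250, 240]),
    ([180, 2844, 2676, 192, 168, 96, 4506, 2748],
      [249, 251, 117, 129, 139, 40, 228, 106, 80293000, 30290000, 80292000, 247]),
    ([168, 181, 3517],
      [136, 10020320, 31050000, 10023003, 51, 121, 186, 31090000, 193, 45]),
    ([3445, 3448, 97, 85, 3421],
      [155, 30030000, 1, 60030000, 81072000, 205, 41060000, 71070200, 91071002, 31070000]),
    ([2749, 2701, 168, 180],
      [136, 31050000, 51, 60050000, 50130200, 50130300, 173, 246, 40120000, 90132003]),
    ([3445, 97, 85, 3421],
      [51070200, 254]),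
    ([2845, 4384, 2652],
      [50210200, 50210400, 80214000, 244, 30210000]),
    ([2848, 2844, 4384, 341, 2657],
      [70214200, 40210000, 30210000, 90210442, 80210400]),
    ([5277, 337, 265, 121, 193],
      [154, 91314001, 96]),
    ([3589, 121, 85],
      [155, 30030000, 1, 60030000, 103, 81191000, 63]),
    ([3565, 2676, 152, 96, 4506, 2748, 168, 180],
      [136, 31050000, 51, 60050000, 51170400, 60170000, 18, 31170000, 34, 10024004, 252, 257,
      80212000]),
    ([2677, 2628, 2652],
      [80072000, 227]),
    ([2676, 2844, 180, 96, 168, 192, 2748],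
      [252, 134, 80231000, 215, 80232000, 90232004, 90232001, 90232002, 40220000]),
    ([109, 120, 84, 2748, 168, 180],
      [136, 31050000, 51, 60050000, 137, 30030000, 133, 50030100, 262, 10010310, 10013002,
      10012003, 10010240, 263, 257, 80212000, 90212002, 90212004, 40200000]),
    ([771, 2822, 76, 2797, 2631, 168],
      [44, 230, 30180000, 10011402, 50, 90191041, 81]),
    ([2821, 2845, 120, 2631, 168],
      [136, 31050000, 51, 60050000, 257, 80212000, 90212002, 40200000, 90212004, 10010240,
      50030100, 50190100, 50190400, 80194000, 265, 41, 30180000, 21, 90191004, 70190400,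
      30190000]),
    ([4407, 2845, 96, 120, 84],
      [90231001, 90231004, 90231002, 40220000]),
    ([2845, 4508, 96, 108, 120, 84, 168],
      [136, 31050000, 51, 60050000, 137, 30030000, 133, 50030100, 262, 266, 267, 184, 215, 134,
      80232000]),
    ([4507, 2797, 76, 2844, 120, 2631, 168],
      [136, 31050000, 51, 60050000, 50030100, 262, 134, 153, 31, 80231000, 215, 70232100,
      70232400, 70194100, 265, 41, 30180000, 21, 90191004, 70190400, 30190000]),
    ([120, 84, 2748, 150, 168, 180],
      [136, 31050000, 51, 60050000, 137, 30030000, 133, 50030100, 262, 264, 10012030, 251, 268,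
      263, 10020420, 10010240, 10024004, 32, 30170000, 13, 269, 184, 50190100, 50190400, 80194000,
       265, 41, 30180000, 21, 90191004, 70190400, 30190000]),
    ([3674, 3493, 5226, 5222, 5273, 265, 337],
      [135, 131, 196, 31270000, 91274003, 91274004, 41260000]),
    ([3597, 3660, 5273, 265, 337, 121],
      [124, 81271000, 159, 131, 51190400, 71273400, 200, 271, 71270100, 91274001, 31270000]),
    ([3660, 5132, 5273, 265, 337, 121],
      [159, 124, 34, 31170000, 18, 81271000, 272, 71191400, 31190000, 62, 200, 81273000, 271,
      71270100, 91274001, 31270000]),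
    ([3661, 265, 2797],
      [60170000, 50170400, 51250300, 199, 81253000, 70, 41240000, 71250300, 91254003, 31250000]),
    ([5273, 265, 337, 121],
      [32, 30170000, 13, 274, 34, 31170000, 18, 124, 159, 81271000, 272, 273, 71191400, 72, 103,
      200, 81273000, 271, 71270100, 91274001, 31270000]),
    ([5271, 265, 5156, 337, 193],
      [32, 30170000, 13, 274, 60170000, 161, 163, 167, 201, 81292000, 231, 31290000, 81294000,
      229]),
    ([5275, 5177, 337, 121],
      [34, 31170000, 18, 118, 145, 71232400, 81232000, 71191400, 62, 103, 31190000, 72]),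
    ([2726, 4262, 2715, 108],
      [70110100, 85, 30110000, 40030000, 90113001]),
    ([4453, 2917],
      [50270300, 50270100, 50270400, 70270100, 53]),
    ([2917, 2724, 4454, 252, 108, 264],
      [80274000, 279, 30270000, 80273000, 90273003, 206, 90273004, 40260000]),
    ([2893, 252, 264, 2797],
      [156, 31090000, 158, 60090000, 50250300, 80254000, 217, 40240000, 90253003, 70250300,
      30250000]),
    ([2725, 252, 108],
      [156, 31090000, 158, 60090000, 50110100, 50110300, 80111000, 95, 278]),
    ([5277, 337, 80, 193, 180, 121],
      [32, 30170000, 13, 10024030, 154, 259, 60150000, 10013004, 10033004, 20, 210, 156, 31090000,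
       158, 220, 281, 214, 139, 117, 146, 282, 80271000, 280]),
    ([2677, 96, 168],
      [136, 31050000, 51, 60050000, 227, 262, 226]),
    ([264, 252, 4508, 2748, 2724, 2797, 80, 180],
      [10013004, 281, 210, 214, 139, 117, 146, 80271000, 280]),
    ([3627, 3445, 5176, 3638, 3637, 85, 121],
      [71230100, 91234001, 31230000, 81231000, 91231001]),
    ([3613, 3616, 5156, 3564],
      [51210400, 81212000, 31210000, 71210400, 71210200, 41200000]),
    ([3629, 3445, 5174, 5176, 3640, 193],
      [71230200, 91234002, 31230000]),
    ([3445, 5174, 5176, 3638, 3637, 3640, 3644, 85, 337, 193, 121],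
      [286, 288, 41220000, 71230400, 91234004, 31230000]),
    ([5174, 5176, 121, 3638, 3637, 3640, 3644, 85, 337, 193],
      [289, 81234000, 31230000, 71230200, 71230400, 71230100, 41220000]),
    ([5275, 85, 3612, 337, 193, 121],
      [118, 120, 145, 172, 277, 81231000, 290]),
    ([264, 4508, 2748, 2724, 2797, 80, 224, 180],
      [10033004, 285]),
    ([3444, 3397, 96, 3421],
      [71071000, 71072000, 64, 31070000, 41060000, 91070120]),
    ([5173, 3628, 3638, 3644],
      [71230400, 71230100, 41220000]),
    ([5275, 3621, 3612, 193, 96, 3421, 121],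
      [10014020, 10024004, 118, 120, 172, 277, 291, 71231400, 38, 31030000, 164, 293, 288, 294,
      31230000, 91234001, 91234004, 41220000]),
    ([5181, 3628, 3445, 337, 121],
      [91234001, 91234004, 41220000]),
    ([264, 2724, 2797, 80, 224, 180, 96, 168],
      [284, 10033004, 156, 31090000, 158, 220, 251, 292]),
    ([265, 5274, 5276, 5156, 337, 193, 121],
      [275, 276, 126]),
    ([193, 341, 180, 96, 2844, 168, 121],
      [10014020, 165, 30050000, 143, 136, 31050000, 51, 10024030, 10010420, 10024004, 32, 34,
      30170000, 31170000, 13, 18, 60170000, 70212000, 91214024, 258, 60212000, 283, 287, 41210000,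
       295, 298, 10013004, 10033004, 297, 282]),
    ([2749, 180, 168],
      [136, 31050000, 51, 60050000, 50130300, 255, 246, 80132000])]

/-- Part 6 of the certificate for 5 alternatives. -/
def cert5_6 : List (List ℕ × List ℕ) := [
    ([180, 96, 2844, 168, 121],
      [284, 10014020, 165, 30050000, 143, 300, 263, 10024004, 299, 32, 10044024, 10024024,
      30170000, 10042442, 13, 151, 70212000, 90214220, 30200000, 30210000, 132, 90210420]),
    ([340, 4384, 337, 193, 2657],
      [32, 30170000, 13, 10044024, 10024024, 10042442, 90214220, 151, 30210000, 30200000,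
      90210420, 132]),
    ([193, 96, 2844, 168, 121],
      [10014020, 301, 10023004, 165, 30050000, 143, 136, 31050000, 51, 10024004, 259, 32, 34,
      30170000, 31170000, 13, 18, 60170000, 70212000, 302, 91214024, 258, 298, 60212000, 287,
      41210000, 295]),
    ([5275, 109, 253, 265, 181],
      [145, 91313002, 91313004, 91313003, 91313001, 41300000]),
    ([3709, 3612, 3660, 3516],
      [201, 81293000, 81292000, 81294000, 31290000]),
    ([3492, 5078, 5076, 3541, 109, 253, 181],
      [81152000, 219, 31150000, 188]),
    ([2629, 2724, 109, 253],
      [147, 30090000, 23, 90, 90110130, 90110330, 40100000]),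
    ([3483, 3397, 3494, 5030, 109],
      [71110100, 91113001, 31110000]),
    ([5277, 109, 253, 5058, 181, 3421],
      [121, 31090000, 45, 51090300, 154, 187, 241, 189, 71111300, 306, 60110000, 51110100, 307,
      40030000, 60031000, 41030000, 308, 41100000, 190, 91113003]),
    ([337, 5276, 5274, 253, 265, 3516, 181, 121],
      [32, 275, 30170000, 13, 274, 126, 163, 201, 81292000, 81294000, 305, 31290000, 91293004,
      91293003, 91293002, 41280000]),
    ([5251, 3613, 253, 265, 181],
      [91293004, 91293003, 91293002, 41280000]),
    ([5249, 5271, 3565, 3468, 265],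
      [163, 161, 81292000, 71292400, 81254000, 238, 41240000, 71250400, 91253004, 31250000]),
    ([5271, 3565, 253, 265, 3516, 181],
      [121, 31090000, 45, 51090300, 163, 201, 81294000, 312, 31290000, 81293000, 311]),
    ([96, 2844, 168, 121],
      [136, 31050000, 51, 10014020, 301, 253, 10020320, 10023004, 71133000, 10023003, 303,
      10014002, 10010230, 304, 309, 310, 37, 10014004, 31170000, 10010410, 166, 155, 260,
      30030000, 1, 307, 60110000, 313, 126, 124, 200, 81273000, 203, 91271001, 91271003, 91271004,
       41260000]),
    ([5273, 3492, 109, 85, 121],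
      [260, 124, 200, 81273000, 203, 91271001, 91271003, 91271004, 41260000]),
    ([3612, 5152, 336, 168],
      [37, 31170000, 166, 136, 31050000, 51, 71214000, 109, 31210000, 41200000, 91210440]),
    ([181, 97, 168, 121],
      [10012002, 10010210, 155, 30030000, 1, 136, 31050000, 51, 256, 260, 253, 10020320, 10010230,
       71133000, 10023003, 309, 248, 307, 60110000, 315, 126, 118, 120, 145, 172, 304, 81232000,
      81234000, 10023004, 10033004, 10030440, 37, 31170000, 166, 91212040, 316, 65, 294, 31230000,
       91231004, 91231001, 41220000]),
    ([5275, 3613, 3444, 85, 97, 121],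
      [260, 118, 120, 145, 172, 81232000, 81234000, 65, 294, 31230000, 91231004, 91231001,
      41220000]),
    ([3493, 109, 85],
      [155, 30030000, 1, 60030000, 119, 31030000, 144, 60110000, 51110300, 51110100, 81113000,
      307, 70113000, 156, 148, 31090000, 30090000, 158, 162, 104, 105, 168, 202, 30100000,
      10013013, 128, 90111330, 90110130, 30110000]),
    ([109, 5274, 3444, 85, 97, 121],
      [248, 319, 315, 126, 154, 218, 81151000, 91151003, 91151001, 101, 41140000]),
    ([2917, 2892, 252, 108, 264],
      [282, 80271000, 280]),
    ([4509, 252, 108, 2748, 180],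
      [282, 20, 175, 235, 80152000, 80151000, 30150000, 90153003, 90153002, 90153001, 40140000]),
    ([2893, 252, 264],
      [156, 31090000, 158, 60090000, 207, 281]),
    ([108, 264, 2748, 180, 85],
      [91, 210, 322, 323, 214, 321, 139, 146, 117]),
    ([5275, 3444, 85, 97, 121],
      [260, 118, 120, 145, 172, 318, 81232000, 81234000, 81231000, 31230000, 71230200, 294]),
    ([97, 168, 121],
      [136, 31050000, 51, 10012002, 10010210, 256, 317, 300, 325, 320, 10012030, 10014030, 324,
      10034004, 10020340, 259, 298, 91214004, 91214002, 41200000]),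
    ([108, 85, 168, 121],
      [136, 31050000, 51, 60050000, 326, 314, 257, 80212000, 90212002, 40200000, 90212004,
      50210400, 70212400, 27, 30170000, 116, 60210000, 291, 10011002, 10010420, 71214000, 91,
      10014030, 10010230, 282, 283, 297, 298]),
    ([85, 168, 121],
      [326, 136, 31050000, 51, 60050000, 314, 257, 80212000, 90212002, 40200000, 90212004,
      10010420, 50210400, 70212400, 27, 30170000, 116, 60210000, 71214000, 291, 327, 10013004,
      259, 298]),
    ([5275, 168, 121],
      [136, 31050000, 51, 326, 328, 38, 31030000, 164, 293, 60050000, 314, 257, 80212000,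
      90212002, 40200000, 60204000, 41200000, 60210000, 71214000, 60170000, 41170000, 165,
      30050000, 143, 90212042, 91212402, 31210000, 71210200, 50210400, 70212400, 27, 30170000,
      116, 90212004, 118, 120, 172, 277, 71231200, 288, 296, 294, 31230000]),
    ([265, 168, 121],
      [329, 326, 314, 50210400, 136, 31050000, 51, 60050000, 257, 70212400, 27, 30170000, 116,
      80212000, 90212002, 40200000, 90212004, 60210000, 71214000, 259, 298]),
    ([168, 121],
      [136, 31050000, 51, 60050000, 326, 10014020, 314, 50210400, 257, 80212000, 70212400,
      90212002, 27, 40200000, 30170000, 90212004, 116, 10010420, 330, 10023004, 10024003,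
      10030440, 10013004, 10020330, 297, 282]),
    ([3709, 3516, 3612, 181, 193, 169],
      [201, 81293000, 305, 81294000, 225, 31290000]),
    ([5273, 97, 181, 193, 169],
      [124, 91312002, 91312003, 91312001, 91312004, 41300000]),
    ([3509, 3517, 3469, 169],
      [123, 31050000, 140, 51050200, 81133000, 51130200, 91132002, 71130200, 31130000]),
    ([3517, 181, 3469, 169],
      [123, 31050000, 140, 51050200, 81133000, 334, 51130300, 41120000, 91132003, 71130300,
      31130000]),
    ([3612, 5276, 3444, 3516, 5272, 181, 337, 121],
      [331, 97, 332, 163, 126, 118, 120, 145, 172, 277, 81234000, 81231000, 31230000, 71230200,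
      294]),
    ([3613, 3564, 3420],
      [51210200, 81214000, 287]),
    ([5276, 3516, 5272, 181, 337, 121],
      [331, 97, 123, 31050000, 140, 51050200, 32, 30170000, 13, 60170000, 337, 332, 163, 336, 126,
       118, 120, 145, 172, 277, 81231000, 288, 296, 294, 31230000]),
    ([2844, 2852, 2797, 169],
      [127, 30050000, 10, 86, 40210000, 90210220, 80210200]),
    ([4981, 3445],
      [51070100, 51070200, 71070200, 71070100, 41060000]),
    ([3445, 97, 169],
      [123, 31050000, 140, 51050200, 81071000, 340, 31070000, 100, 81072000, 41060000, 91072001]),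
    ([181, 3469, 337, 79, 121],
      [331, 97, 10010320, 333, 335, 338, 154, 171, 187, 81151000, 341, 81153000, 218, 102,
      31150000, 91152003, 91152001, 41140000]),
    ([108, 180, 252, 264],
      [156, 31090000, 158, 323, 221, 139, 220, 321, 146, 210, 322, 117]),
    ([337, 264, 121],
      [10014003, 331, 123, 31050000, 140, 51050200, 32, 97, 10030440, 30170000, 10024003,
      10033004, 13, 156, 60170000, 31090000, 158, 337, 342, 343, 10010310, 10013020, 291, 341,
      320]),
    ([264, 121],
      [331, 123, 31050000, 140, 51050200, 344, 37, 10014004, 31170000, 10010410, 166, 89, 341,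
      325, 320, 91, 10014030, 343, 156, 10023040, 333, 31090000, 67, 158, 335, 332, 163, 126, 154,
       171, 187, 81151000, 81153000, 218, 102, 31150000, 91152003, 91152001, 41140000]),
    ([336, 181, 121],
      [345, 331, 10014004, 107, 10010410, 10010430, 304, 89, 320, 341]),
    ([181, 121],
      [345, 331, 123, 31050000, 140, 51050200, 346, 97, 275, 259, 338, 81133000, 335, 193,
      41090000]),
    ([3709, 3517, 121],
      [331, 123, 31050000, 140, 51050200, 345, 347, 197, 107, 32, 30170000, 13, 60170000, 337,
      274, 10022003, 10020340, 201, 81293000, 229, 81292000, 31290000]),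
    ([5173, 5275],
      [172, 120, 118, 71230200, 294]),
    ([5275, 121],
      [331, 123, 31050000, 140, 51050200, 345, 347, 197, 107, 32, 30170000, 13, 60170000, 337,
      10022003, 10020340, 145, 277, 81231000, 349, 31230000, 81234000, 91234002, 296])]

/-- Part 7 of the certificate for 5 alternatives. -/
def cert5_7 : List (List ℕ × List ℕ) := [
    ([121],
      [331, 123, 31050000, 140, 51050200, 345, 347, 197, 10022003, 107, 10020340, 32, 275, 259,
      30170000, 13, 60170000, 274, 337, 350, 126, 163, 305, 348]),
    ([265, 3612, 193, 337, 3709],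
      [81293000, 32, 30170000, 13, 201, 274, 305, 81292000, 229, 31290000]),
    ([3612, 193, 337, 3709],
      [351, 10010440, 352, 10030440, 10013004, 10024003, 10033004, 343, 156, 10020320, 332, 335,
      31090000, 158]),
    ([193, 337, 3709],
      [32, 30170000, 13, 60170000, 353, 51210200, 337, 287, 91214004, 91214002, 41200000]),
    ([338, 5132, 337],
      [351, 232, 38, 31030000, 164, 34, 31170000, 18, 212, 91191440, 43, 31190000, 31180000,
      91190140, 141]),
    ([5125, 3397, 336],
      [351, 91190140, 91190440, 41180000]),
    ([4461, 2917, 264, 336],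
      [351, 80274000, 90274003, 90274004, 90274001, 40260000]),
    ([264, 192, 2820, 4506, 336, 4502],
      [351, 116, 30170000, 27, 50170400, 37, 31170000, 166, 236, 117, 146, 279, 80273000, 357,
      30270000, 80271000, 60250000, 207, 60090000, 41090000, 243, 242, 51253400]),
    ([180, 265, 168, 96, 4506, 2676, 3565],
      [300, 10020430, 261]),
    ([265, 168, 253, 96, 4506, 2676, 3565, 5271],
      [359, 253, 313]),
    ([4357, 2828, 2822],
      [70190400, 70190100, 40180000]),
    ([2821, 336],
      [351, 116, 30170000, 27, 50170400, 50190100, 50190400, 80191000, 361, 30190000, 80194000,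
      90194001, 90194004, 40180000]),
    ([168, 2628, 3444],
      [40030000, 60031000, 41030000, 1, 30030000, 155, 136, 31050000, 51, 293, 10012002,
      10010210]),
    ([265, 153, 3420, 336, 5271],
      [37, 31170000, 166, 107, 10020430, 121, 313, 31090000, 51130200, 51130300, 81133000, 45,
      185]),
    ([253, 3612, 193, 169, 3709],
      [123, 31050000, 140, 51050200, 121, 197, 31090000, 332, 45, 81133000, 193]),
    ([176, 5152, 192, 169, 3565],
      [123, 31050000, 140, 10022024, 91214220, 10024224, 31210000, 36, 91210420, 31200000, 12]),
    ([180, 252, 264, 76],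
      [343, 10013002]),
    ([193, 336, 5271],
      [351, 37, 31170000, 166, 163, 10010240, 10024004, 10020420, 123, 31050000, 140, 51050200,
      67, 364, 365, 156, 31090000, 158, 367, 332, 335]),
    ([180, 76, 169, 264],
      [197, 343, 10013002]),
    ([3517, 181, 169],
      [123, 31050000, 140, 51050200, 51130200, 51130300, 81133000, 335, 185, 41090000]),
    ([4412, 2844, 4507, 2820],
      [134, 80231000, 80232000, 31, 99, 30230000, 70230100]),
    ([4413, 2677, 192, 336],
      [351, 90234001, 90234002, 90234004, 40220000]),
    ([169, 4507, 2629, 192, 336],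
      [50030100, 133, 30030000, 137, 362, 116, 30170000, 27, 50170400, 37, 31170000, 166, 127, 89,
       30050000, 10, 224, 88, 372, 371, 50210200, 60210000, 245, 71212000, 10022440, 366]),
    ([2845, 2652, 2796],
      [257, 80212000]),
    ([4507, 2629, 192, 336],
      [362, 116, 30170000, 27, 50170400, 134, 80232000, 373, 136, 31050000, 51, 60050000, 374,
      80231000, 371, 215, 372]),
    ([168, 2676, 253, 265, 4506, 3565, 5271],
      [351, 10010340, 360, 10012003, 253, 313]),
    ([169, 253, 150, 265, 3565, 5271],
      [10022003, 313, 370]),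
    ([4506, 336, 5271],
      [351, 368, 362, 37, 31170000, 166, 163, 60290000, 139, 358, 10010340, 10020340, 107, 377,
      376, 284, 10012003, 253, 313]),
    ([2845, 169, 192, 2796, 3565],
      [50210200, 60210000, 245, 71212000, 10022440, 366]),
    ([193, 5271],
      [163, 354, 368]),
    ([4385, 337, 192],
      [32, 30170000, 13, 97, 90212002, 90212004, 40200000]),
    ([264, 96, 152, 168, 337],
      [351, 32, 30170000, 13, 10010440, 10030440, 10013004, 10023004, 10033004, 297, 282]),
    ([336, 4507, 3444, 192],
      [134, 116, 37, 362, 375, 30170000, 31170000, 363, 27, 166, 50170400, 379, 371, 372,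
      80234000]),
    ([337, 3444, 192],
      [351, 232, 97, 137, 363, 30030000, 50030100, 133]),
    ([3444, 5271],
      [380, 384, 378, 383]),
    ([336, 4412, 4507, 192],
      [116, 37, 362, 30170000, 31170000, 371, 27, 166, 60210000, 50170400, 71212000, 379, 316]),
    ([4507, 5271],
      [351, 385, 60070000, 380, 134, 80234000, 386, 10010440, 97, 381, 10012004, 136, 31050000,
      51, 60050000, 257, 371, 80231000, 215, 90232004, 90232001, 90232002, 40220000]),
    ([2821, 337],
      [351, 232, 137, 30030000, 133, 50030100, 38, 31030000, 164, 32, 30170000, 13, 60190000,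
      50190100, 50190400, 80194000, 71194000, 361, 355, 30190000, 10011440, 90191041]),
    ([3517, 5271],
      [351, 380, 387, 378, 97, 10020440, 10010440, 10012004, 382, 10020340, 232, 60130000, 253,
      270]),
    ([180, 5271],
      [351, 380, 387, 378, 97, 10020440, 10010440, 10012004, 382, 10020340, 232, 300, 270]),
    ([5271],
      [351, 163, 201, 380, 387, 378, 32, 10010440, 97, 10020440, 30170000, 10012004, 13, 382, 274,
       10020340, 81292000, 389, 81294000, 305, 31290000, 390, 10023003, 311]),
    ([264, 4502, 150, 181, 2676],
      [10024003, 10023004, 10020440, 362, 358, 386, 134, 80234000]),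
    ([3661, 265, 3468],
      [51250400, 199, 81254000, 238, 41240000, 71250400, 91253004, 31250000]),
    ([4507, 2820, 2844, 2676],
      [134, 371, 80234000]),
    ([109, 4506, 4502, 265, 2748, 5058, 253, 181, 2676, 3421],
      [391, 121, 31090000, 45, 51090300, 393, 304, 309, 126, 124, 60270000, 81271000, 146, 117,
      235, 60110000, 200, 203, 91273001, 91273003, 91273004, 41260000]),
    ([2820, 4502, 265, 2844, 2748, 5058, 150, 181, 84, 3421],
      [351, 10023003, 147, 30090000, 23, 60050000, 137, 30030000, 133, 50030100, 262, 394, 395,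
      10012030, 184, 235, 50110100, 50110300, 80113000, 177, 70110300, 90111003, 30110000]),
    ([2821],
      [362, 388]),
    ([108, 112, 2701, 150, 4506, 2676, 84],
      [397, 351, 137, 30030000, 133, 50030100, 10012030, 184, 20, 80153000, 194, 233, 177,
      70113100, 70110300, 90111003, 30110000]),
    ([3499, 5273, 109, 253, 265],
      [121, 31090000, 45, 51090300, 393, 124, 81271000, 159, 135, 51110300, 71274300, 200, 203,
      195, 91273003, 91273004, 41260000]),
    ([3492, 3589, 5273, 109, 253, 265],
      [121, 31090000, 45, 51090300, 393, 124, 81271000, 159, 81274000, 203, 195, 91273003,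
      91273004, 41260000])]

/-- Part 8 of the certificate for 5 alternatives. -/
def cert5_8 : List (List ℕ × List ℕ) := [
    ([3487, 3498, 253, 3397],
      [121, 31090000, 45, 91113003, 190]),
    ([109, 5058, 253, 181, 265, 3397, 3421],
      [391, 121, 31090000, 45, 51090300, 393, 304, 309, 126, 399, 71111300, 401, 41100000, 308,
      51110100, 200, 400]),
    ([181, 265, 2844, 4506, 84, 168],
      [351, 397, 136, 31050000, 51, 60050000, 137, 30030000, 133, 50030100, 262, 38, 31030000,
      164, 10020320, 253, 10023003, 71133000, 147, 30090000, 23, 402, 10012030, 183, 398, 396,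
      176, 50130200, 169, 173, 30120000, 170]),
    ([265, 2844, 4506, 84, 168],
      [397, 351, 136, 31050000, 51, 60050000, 137, 30030000, 133, 50030100, 262, 10010340, 403,
      300, 10012003, 264, 251, 184]),
    ([180, 264, 84, 168],
      [351, 300, 270, 264, 10020330, 343]),
    ([2844, 4506, 84, 168],
      [136, 31050000, 51, 60050000, 137, 30030000, 133, 50030100, 262, 404, 405, 10020320,
      10023003, 10023004, 10024003, 392, 121, 10020440, 139, 31090000, 116, 37, 223, 45, 30170000,
       31170000, 60250000, 27, 166, 50170400, 242, 243, 51253400]),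
    ([181, 4506, 84, 168],
      [351, 406, 50210400, 136, 31050000, 51, 60050000, 257, 70212400, 27, 30170000, 116, 374,
      90212002, 40200000, 90212004, 10020420, 10010240, 10012002, 382, 137, 30030000, 133,
      50030100, 262, 38, 31030000, 164, 10020320, 253, 10023003, 71133000, 147, 402, 30090000,
      268, 23, 20, 398, 80153000, 176, 194, 169, 177, 70113100, 30120000, 90111003, 170, 30110000,
       173, 70110300, 50130200, 50110300, 235]),
    ([4506, 84, 168],
      [351, 136, 31050000, 51, 60050000, 137, 30030000, 133, 50030100, 262, 406, 257, 374,
      90212002, 40200000, 90212004, 10010240, 10012002, 407, 300, 10013002, 251, 268]),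
    ([84, 168],
      [397, 351, 136, 31050000, 51, 60050000, 137, 30030000, 133, 50030100, 262, 408, 134, 394,
      80232000, 215, 267, 10012002, 10010210]),
    ([180, 96, 2676, 84, 4506],
      [397, 351, 409, 10010220, 137, 30030000, 133, 50030100, 197, 10013002, 156, 282, 184,
      31090000, 235, 158, 220]),
    ([4311, 2773, 108, 96, 84],
      [82, 192]),
    ([108, 96, 2676, 84, 4506],
      [397, 351, 137, 30030000, 133, 50030100, 184, 20, 42, 175, 80153000, 194, 177, 70113100,
      411, 30150000, 80152000, 70152300, 70110300, 30110000, 90111003, 80111000]),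
    ([265, 3492, 5276, 253, 109, 181],
      [391, 121, 31090000, 45, 51090300, 304, 393, 126, 200, 400]),
    ([3493, 253, 109, 3397],
      [121, 31090000, 45, 51090300, 51110300, 51110100, 81111000, 401, 308, 41100000]),
    ([5277, 3492, 253, 109, 3516, 181],
      [154, 187, 81151000, 306]),
    ([96, 2676, 2844, 84, 4506],
      [351, 38, 31030000, 164, 409, 410, 370, 412, 71, 10013040, 10013020, 121, 31090000, 45, 414,
       415, 413, 10024003, 10030440, 392, 116, 37, 139, 30170000, 31170000, 223, 27, 166,
      60250000, 50170400, 242, 243, 51253400]),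
    ([2893, 336, 264, 3475],
      [116, 30170000, 27, 50170400, 37, 31170000, 166, 60250000, 243, 242, 51253400]),
    ([192, 2892, 336, 264, 2844, 4506],
      [397, 358, 223, 139]),
    ([109, 97, 2844, 84, 4506],
      [351, 391, 10010210, 409, 341, 123, 31050000, 140, 51050200, 38, 31030000, 164, 71,
      10013040, 10013002, 121, 414, 370, 31090000, 415, 45, 413, 10030440, 10013004, 37, 356,
      31170000, 166, 91191040, 31190000, 71194000, 417, 418, 333, 67, 126, 120, 145, 172, 349,
      81231000, 81234000, 31230000, 68, 69, 91232004, 41220000]),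
    ([5275, 3612, 193, 97, 169],
      [341, 145, 349, 81231000, 81234000, 31230000, 81232000, 91232004, 91232002, 91232001,
      41220000]),
    ([5277, 181, 97, 169],
      [370, 341, 154, 171, 187, 81151000, 81153000, 218, 31150000, 102, 91152003, 91152001,
      41140000]),
    ([193, 5275, 97, 169],
      [123, 31050000, 140, 51050200, 420, 337, 67]),
    ([192, 3475, 151, 2844, 169, 4506],
      [10020340, 97, 418, 417]),
    ([193, 181, 97, 169],
      [391, 421, 333, 422, 126]),
    ([192, 151, 2844, 169, 4506],
      [10020340, 97, 418, 423, 323, 45, 121, 31090000]),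
    ([97, 2844, 84, 4506],
      [351, 409, 10012040, 10010210, 419, 10012030, 425, 424, 369, 10020430]),
    ([180, 4509, 108, 169],
      [197, 156, 322, 31090000, 220, 158]),
    ([337, 2844, 169],
      [127, 30050000, 10, 32, 30170000, 13, 339, 86, 90210440, 80210400]),
    ([2667, 2678, 84],
      [409, 127, 30050000, 10, 137, 30030000, 133, 83, 90071001]),
    ([2844, 84, 4506],
      [409, 127, 30050000, 10, 137, 30030000, 133, 50030100, 426, 416, 50070200, 50070100,
      80072000, 429, 40060000, 90071002, 70070200, 30070000]),
    ([192, 2845, 169],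
      [97, 116, 37, 30170000, 31170000, 27, 166, 50170400, 379]),
    ([97, 193, 84],
      [351, 409, 10012040, 10010210, 424, 369, 10020430]),
    ([180, 84, 4506],
      [397, 351, 409, 430, 431, 10010240, 432, 137, 30030000, 133, 50030100, 10013002, 427, 184]),
    ([2677, 96, 84],
      [409, 127, 30050000, 10, 137, 30030000, 133, 50030100, 50070200, 50070100, 80072000, 429,
      40060000, 70070200, 90071002, 30070000]),
    ([84, 4506],
      [38, 409, 31030000, 164, 430, 431, 432, 10010420, 433, 370, 434, 412, 71, 10013004, 414,
      415, 413]),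
    ([181, 109, 96, 4506],
      [351, 10013020, 435, 319, 232, 116, 30170000, 27, 50170400, 89, 136, 31050000, 51, 60050000,
       374, 10011004, 10010420, 253, 10023003, 415, 121, 413, 31090000, 418, 45, 417]),
    ([180, 2844, 192, 168, 96],
      [284, 300, 263]),
    ([96, 4506],
      [351, 435, 232, 116, 30170000, 27, 50170400, 10011004, 89, 10011002, 10010420, 136,
      31050000, 51, 60050000, 374, 437, 10010230, 436]),
    ([181, 168, 192, 109, 4506],
      [351, 435, 232, 116, 30170000, 27, 50170400, 136, 31050000, 51, 60050000, 374, 319,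
      10020320, 253, 10023003, 415, 121, 413, 31090000, 418, 45, 417]),
    ([168, 192, 109, 4506],
      [351, 438, 10012040, 435, 232, 116, 30170000, 27, 50170400, 136, 31050000, 51, 60050000,
      374, 439, 10020430, 418, 417, 207, 41090000, 60090000]),
    ([192, 109, 4506],
      [351, 435, 319, 438, 232, 440, 431, 425, 10022003, 421, 10023003, 413, 121, 418, 31090000,
      417, 45]),
    ([109, 4506],
      [351, 438, 10012040, 10013040, 441, 10020420, 424, 10024030]),
    ([4506],
      [351, 435, 10011004, 438, 442, 91, 10012030, 10010430, 343, 10020320, 424, 431, 425]),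
    ([2868],
      [443, 134]),
    ([4409],
      [444, 397, 80232000]),
    ([169, 192],
      [443, 397, 431, 97, 394, 383, 60070000]),
    ([192],
      [351, 443, 446, 409, 155, 232, 30030000, 375, 1]),
    ([77],
      [447, 351, 10010240]),
    ([168],
      [448, 409, 10012002, 10011002]),
    ([96, 2677],
      [449, 89, 434])]

/-- Part 9 of the certificate for 5 alternatives. -/
def cert5_9 : List (List ℕ × List ℕ) := [
    ([2844],
      [443, 397, 447, 448, 449, 428, 394, 10024004, 450, 424, 369, 10020430]),
    ([97],
      [351, 447, 448, 449, 10012040, 424, 369, 10020430]),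
    ([85],
      [452, 449, 89]),
    ([2677],
      [452, 450]),
    ([4407],
      [452, 451, 351, 453, 267]),
    ([],
      [455, 454, 445, 443, 215])]

/-- The certificate for 5 alternatives. -/
def cert5 : List (List ℕ × List ℕ) :=
    cert5_0 ++
    (cert5_1 ++
    (cert5_2 ++
    (cert5_3 ++
    (cert5_4 ++
    (cert5_5 ++
    (cert5_6 ++
    (cert5_7 ++
    (cert5_8 ++
    (cert5_9)))))))))

theorem run5 : run 5 cert5 .nil 1 = true := by decide +kernel

/-- Part 0 of the certificate for 6 alternatives. -/
def cert6_0 : List (List ℕ × List ℕ) := [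
    ([4125],
      [101000000, 51630400]),
    ([4123],
      [101000000, 51630300]),
    ([4121],
      [101000000, 51630200]),
    ([4423, 1639],
      [20004000, 20003000, 90243443]),
    ([5663, 3741],
      [1, 71635400]),
    ([5653, 4109],
      [3, 71630200]),
    ([5657, 4068],
      [101000000, 81632000]),
    ([5655, 4101],
      [1, 71631400]),
    ([5653, 4111],
      [2, 71630300]),
    ([4425, 1638],
      [20004000, 20003000, 90244334]),
    ([4615, 1723],
      [20005000, 20003000, 90403553]),
    ([5659, 4025],
      [3, 71633200]),
    ([5655, 4097],
      [3, 71631200]),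
    ([5333, 3755, 1288],
      [21002000, 91362552]),
    ([5655, 4099],
      [2, 71631300]),
    ([5655, 4092],
      [101000000, 81631000]),
    ([4961, 3373, 169],
      [21002000, 91052002]),
    ([4237, 2706],
      [20003000, 70090300]),
    ([5657, 4077],
      [1, 71632400]),
    ([5661, 3929],
      [3, 71634200]),
    ([4243, 2700],
      [20000000, 70093000]),
    ([5307, 3755, 854],
      [21001000, 91341551]),
    ([4615, 3082],
      [20005000, 70403500]),
    ([5663, 3732],
      [101000000, 81635000]),
    ([4333, 2804],
      [20004000, 70170400]),
    ([4341, 2796],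
      [20000000, 70174000]),
    ([4425, 2886],
      [20003000, 70244300]),
    ([4713, 2157],
      [20005000, 20004000, 90484554]),
    ([5653, 4113],
      [1, 71630400]),
    ([4973, 3434],
      [21001000, 71062100]),
    ([4237, 253],
      [20003000, 20000000, 90090330]),
    ([4341, 336],
      [20004000, 20000000, 90174004]),
    ([4243, 252],
      [20003000, 20000000, 90093003]),
    ([4167, 2628],
      [20000000, 70031000]),
    ([4423, 2888],
      [20004000, 70243400]),
    ([4619, 1722],
      [20005000, 20003000, 90405335]),
    ([5663, 3739],
      [2, 71635300]),
    ([4957, 3373, 168],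
      [21002000, 91050220]),
    ([5023, 3463, 687],
      [21001000, 91103113]),
    ([5661, 3924],
      [101000000, 81634000]),
    ([4251, 2718],
      [20003000, 70101300]),
    ([4525, 421],
      [20005000, 20000000, 90330550]),
    ([5661, 3931],
      [2, 71634300]),
    ([4333, 337],
      [20004000, 20000000, 90170440]),
    ([4165, 2630],
      [20001000, 70030100]),
    ([5193, 3463, 1639],
      [21004000, 91244334]),
    ([5339, 3755, 1289],
      [21002000, 91365225]),
    ([4127],
      [101000000, 51630500]),
    ([5339, 3796],
      [21002000, 71365200]),
    ([5657, 4079],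
      [48, 71632500])]

/-- Part 1 of the certificate for 6 alternatives. -/
def cert6_1 : List (List ℕ × List ℕ) := [
    ([5659, 4029],
      [1, 71633400]),
    ([5483, 3944],
      [21004000, 71485400]),
    ([5303, 421],
      [21005000, 21000000, 91335005]),
    ([5121, 771],
      [21004000, 21001000, 91184114]),
    ([4255, 686],
      [20003000, 20001000, 90103113]),
    ([4119],
      [101000000, 51630100]),
    ([4535, 2988],
      [20000000, 70335000]),
    ([4619, 3078],
      [20003000, 70405300]),
    ([3353],
      [100000000, 50630200]),
    ([3351],
      [100000000, 50630100]),
    ([3359],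
      [100000000, 50630500]),
    ([3357],
      [100000000, 50630400]),
    ([3355],
      [100000000, 50630300]),
    ([4193, 2652],
      [20000000, 70052000]),
    ([5661, 3927],
      [56, 71634100]),
    ([4933, 84],
      [21001000, 21000000, 91030110]),
    ([5333, 3802],
      [21005000, 71362500]),
    ([4895, 2973],
      [62, 70635400]),
    ([4525, 2998],
      [20005000, 70330500]),
    ([3469, 2743, 2749],
      [21003000, 21000000, 50130300, 70130300, 51090300, 60090000, 71090300, 80132000, 31090000,
      30130000, 91093003, 80133000, 90133003]),
    ([4165, 2726, 2701, 2715],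
      [20001000, 20000000, 70110100, 90030110, 45, 90111001, 70113100, 30110000]),
    ([3446, 4982, 3399, 3435],
      [71070100, 71072100, 31070000]),
    ([3447, 4980, 3398],
      [51071200, 51070100, 81072100, 31070000, 71071200, 71071000, 41050000]),
    ([2749, 4288, 2652, 2741],
      [50130200, 80133000, 70130200, 30130000]),
    ([1639, 3668, 3475, 3573],
      [21003000, 21004000, 71253400, 46, 91254334, 31240000, 31250000, 71243400, 71250400]),
    ([4577, 204, 168, 2989],
      [90372002, 90372005, 40360000]),
    ([4069, 4058, 5605],
      [51590300, 51590500, 51590400, 71590300, 71590500, 71590400, 41580000]),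
    ([3014, 4550, 2631, 3003],
      [70355100, 70350100, 30350000]),
    ([3666, 3655, 5202, 3475],
      [71254300, 71250300, 31250000]),
    ([3847, 3858, 3475, 3767],
      [71415300, 60403000, 71410300, 58, 31410000, 30400000, 91413553, 11]),
    ([5485, 3958, 3956],
      [71490400, 71490500, 41480000]),
    ([5519, 3596, 3971, 3974, 421],
      [91515005, 71515100, 41190000]),
    ([5251, 3709, 3703, 253],
      [91293003, 81293000]),
    ([3612, 5148, 3421, 3565],
      [71212000, 71214000, 31210000]),
    ([3421, 3444, 3437, 3397],
      [20002000, 20000000, 71072000, 60050000, 71071000, 64, 31070000, 30050000, 91070220,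
      90050220]),
    ([3808, 5344, 3797, 3425],
      [71375200, 71370200, 31370000]),
    ([349, 336, 420],
      [10040540, 10045005]),
    ([3804, 3808, 3421, 204, 3757],
      [41370000, 71372000, 71375000, 31370000, 81370500, 91370520]),
    ([5581, 4045],
      [51570300, 51570400, 51570500, 71570400, 71570500, 71570300, 41560000]),
    ([3655, 3666, 3565, 253],
      [21000000, 21003000, 91093003, 31090000, 71090300, 91253003, 79]),
    ([4895, 3343, 276],
      [100000000, 90635003, 80635000]),
    ([5655, 121, 4113],
      [16, 91631004]),
    ([5605, 5657],
      [56, 7, 71632100, 77, 71590100]),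
    ([5031, 3483, 85],
      [21000000, 21001000, 21003000, 51101300, 71101300, 31100000, 39, 91031001, 31030000,
      71030100, 91111001, 91111331, 41090000]),
    ([3494, 5030, 3483, 3399],
      [71110100, 71113100, 31110000]),
    ([5413, 3882, 3878, 3886],
      [71430500, 71430100, 71430300, 41420000]),
    ([3605, 5156, 3613, 3616, 169],
      [71210200, 31210000, 81212000, 91212002]),
    ([4251, 687],
      [20003000, 20001000, 90101331]),
    ([4895, 2967],
      [60, 70635100]),
    ([4715, 3176],
      [20004000, 70485400])]

/-- Part 2 of the certificate for 6 alternatives. -/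
def cert6_2 : List (List ℕ × List ℕ) := [
    ([5659, 4020],
      [101000000, 81633000]),
    ([5663, 3737],
      [3, 71635200]),
    ([5383, 3850],
      [21005000, 71403500]),
    ([5005, 252],
      [21000000, 21003000, 91090330]),
    ([4535, 420],
      [20005000, 20000000, 90335005]),
    ([5011, 3468],
      [21000000, 71093000]),
    ([5101, 336],
      [21004000, 21000000, 91170440]),
    ([5661, 3935],
      [48, 71634500]),
    ([5293, 3766],
      [21005000, 71330500]),
    ([4885, 3345],
      [62, 70630400]),
    ([5387, 1723],
      [21005000, 21003000, 91405335]),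
    ([4971, 602],
      [21002000, 21001000, 91061221]),
    ([5657, 4071],
      [56, 71632100]),
    ([4193, 168],
      [20000000, 20002000, 90052002]),
    ([5141, 3608],
      [21004000, 71202400]),
    ([4957, 3424],
      [21002000, 71050200]),
    ([5315, 3770],
      [21001000, 71345100]),
    ([4255, 2714],
      [20001000, 70103100]),
    ([4895, 2971],
      [63, 70635300]),
    ([4973, 603],
      [21002000, 21001000, 91062112]),
    ([4935, 3396],
      [21000000, 71031000]),
    ([5659, 4023],
      [56, 71633100]),
    ([4961, 3420],
      [21000000, 71052000]),
    ([4885, 3339],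
      [60, 70630100]),
    ([4889, 3307],
      [63, 70632300]),
    ([5293, 420],
      [21000000, 21005000, 91330550]),
    ([4971, 3436],
      [21002000, 71061200]),
    ([4893, 3159],
      [60, 70634100]),
    ([5659, 4031],
      [48, 71633500]),
    ([5145, 1205],
      [21002000, 21004000, 91204224]),
    ([4167, 84],
      [20000000, 20001000, 90031001]),
    ([4895, 2969],
      [59, 70635200]),
    ([4887, 3329],
      [59, 70631200]),
    ([4893, 3163],
      [63, 70634300]),
    ([4885, 3343],
      [63, 70630300]),
    ([4189, 2656],
      [20002000, 70050200]),
    ([4189, 169],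
      [20000000, 20002000, 90050220]),
    ([5333, 1288],
      [21005000, 14]),
    ([4889, 3300],
      [100000000, 80632000]),
    ([4165, 85],
      [20000000, 20001000, 90030110]),
    ([4887, 3324],
      [100000000, 80631000]),
    ([4885, 3347],
      [61, 70630500]),
    ([5011, 253],
      [21000000, 21003000, 91093003]),
    ([4961, 169],
      [21000000, 17]),
    ([4893, 3156],
      [100000000, 80634000]),
    ([4935, 85],
      [21001000, 21000000, 91031001]),
    ([4891, 3263],
      [61, 70633500]),
    ([5109, 337],
      [21004000, 21000000, 91174004]),
    ([4933, 3398],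
      [21001000, 71030100]),
    ([5303, 3756],
      [21000000, 71335000])]

/-- Part 3 of the certificate for 6 alternatives. -/
def cert6_3 : List (List ℕ × List ℕ) := [
    ([5307, 854],
      [21005000, 22]),
    ([4885, 3341],
      [59, 70630200]),
    ([4887, 3331],
      [63, 70631300]),
    ([5109, 3564],
      [21000000, 71174000]),
    ([5653, 4107],
      [56, 71630100]),
    ([4895, 2964],
      [100000000, 80635000]),
    ([5101, 3572],
      [21004000, 71170400]),
    ([4891, 3261],
      [62, 70633400]),
    ([4891, 3252],
      [100000000, 80633000]),
    ([4893, 3161],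
      [59, 70634200]),
    ([5655, 4103],
      [48, 71631500]),
    ([5481, 2156],
      [21004000, 21005000, 91484554]),
    ([5115, 3584],
      [21004000, 71181400]),
    ([4891, 3257],
      [59, 70633200]),
    ([4891, 3255],
      [60, 70633100]),
    ([4887, 3335],
      [61, 70631500]),
    ([4957, 168],
      [21000000, 38]),
    ([5005, 3474],
      [21003000, 71090300]),
    ([5663, 3735],
      [56, 71635100]),
    ([4893, 3167],
      [61, 70634500]),
    ([5653, 4115],
      [48, 71630500]),
    ([5339, 1289],
      [21005000, 47]),
    ([4887, 3333],
      [62, 70631400]),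
    ([3804, 5344, 3757, 204, 168, 3421],
      [71375000, 88, 31370000, 91370220, 81370200]),
    ([5341, 155, 168],
      [167, 31050000, 123, 10020520, 10020550, 126, 31330000, 150, 91372050, 174, 51370500,
      91370220, 71370500, 41360000]),
    ([5415, 109, 3853, 133, 85],
      [91431001, 91431005, 91431003, 41420000]),
    ([3498, 5034, 3475, 3487],
      [71110300, 71111300, 31110000]),
    ([5389, 3853],
      [51410500, 51410300, 71410500, 71410300, 41400000]),
    ([5653],
      [9, 171, 155, 6, 41620000, 29]),
    ([4885],
      [110, 124, 135, 142, 152, 40620000]),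
    ([3779, 5326, 3790, 133, 3757],
      [91351005, 71350500, 31350000]),
    ([5365, 3830, 3832, 3838],
      [71390200, 71390100, 71390500, 41380000]),
    ([5367, 97, 133, 85, 3805],
      [91391002, 91391005, 91391001, 41380000]),
    ([3877, 3492, 5414, 3780],
      [51430500, 51430300, 51430100, 81433000, 81435000, 96, 31430000]),
    ([5461, 5661],
      [65, 43, 20, 108, 71470500, 71470300, 71470200, 71470100, 41460000]),
    ([5463, 97, 133, 109, 3925, 85],
      [81471000, 91471001, 91471003, 91471002, 91471005, 41460000]),
    ([3493, 253, 3396],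
      [31, 30090000, 21, 60090000, 143, 31090000, 168, 41030000, 51110100, 51110300, 81111000,
      81113000, 95, 177, 41100000]),
    ([5079, 3541, 97, 109, 85],
      [81151000, 91151002, 91151001, 91151003, 41140000]),
    ([3541, 5078, 3492, 3444],
      [51150300, 51150200, 51150100, 81153000, 81152000, 31150000, 71150300, 71150200, 71150100,
      41140000]),
    ([3781, 133, 3396, 3757],
      [121, 31030000, 66, 51350500, 51350100, 81355000, 181, 41340000, 91351001, 71350100,
      31350000]),
    ([5467, 277, 253, 109, 181, 3925],
      [81473000, 91473003, 91473001, 91473002, 91473005, 41460000]),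
    ([5395, 277, 253, 3757],
      [91413003, 91413005, 41400000]),
    ([3899, 5440, 5446, 3910, 277, 3805],
      [71450500, 91453005, 31450000]),
    ([3853, 5394, 3468],
      [178, 81415000, 31410000]),
    ([3895, 5446, 5440, 3906, 253, 3805],
      [71450300, 91453003, 31450000]),
    ([5446, 5440, 3904, 3906, 3910, 277, 253, 181, 3805],
      [193, 195, 41440000, 71450200, 91453002, 31450000]),
    ([3509, 5056, 3520, 181, 3421],
      [91133002, 71130200, 31130000]),
    ([4895, 276, 132, 348, 420, 204],
      [156, 90635002, 90635005, 90635004, 91, 90635001, 40620000]),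
    ([3040, 4576, 3029, 2657],
      [70375200, 70370200, 30370000]),
    ([3782, 3771, 5318, 3399],
      [71355100, 71350100, 31350000])]

/-- Part 4 of the certificate for 6 alternatives. -/
def cert6_4 : List (List ℕ × List ℕ) := [
    ([3756, 429, 3949],
      [51490400, 51490500, 81, 41330000, 81494000, 31490000, 91495045, 81495000]),
    ([5125, 3589],
      [51190400, 51190100, 71190400, 71190100, 41180000]),
    ([4891, 180, 264, 276, 108, 252, 3253],
      [90633003, 90633005, 90633002, 90633004, 90633001, 40620000]),
    ([169, 3808, 3757, 3797],
      [144, 91372002, 31050000, 86, 116]),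
    ([4741, 3212, 3214, 3206],
      [70510100, 70510400, 70510500, 40500000]),
    ([4749, 3194, 3013, 348, 336],
      [90514004, 90514005, 40500000]),
    ([2817, 4358, 2828, 2629, 336],
      [90194004, 70190400, 30190000]),
    ([5053, 3522, 3520],
      [71130300, 71130200, 41120000]),
    ([2965, 2959, 4506, 2772, 2940, 180],
      [50310300, 80311000, 80314000, 70310300, 30310000, 80312000, 90312003]),
    ([2805, 2900, 2707, 1638],
      [10, 30240000, 35, 70250400, 70253400, 90254334, 30250000]),
    ([3852, 5388, 3757, 3469],
      [71415000, 71413000, 31410000]),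
    ([3781, 5326, 3756, 3779],
      [51350500, 81351000, 71350500, 31350000]),
    ([4695, 3147, 3157, 84],
      [80471000, 90471001]),
    ([4699, 3147, 3157, 108],
      [80473000, 90473001]),
    ([4839, 3291, 3301, 84],
      [90591001, 80591000]),
    ([3151, 4694, 4696, 4702, 3157, 3162, 252],
      [70470300, 30470000, 80473000, 90473003]),
    ([263, 1723, 252],
      [10033530, 10033553]),
    ([3445, 3420, 4984, 3437],
      [51070200, 81071000, 71070200, 31070000]),
    ([3448, 3444, 3437, 3398],
      [41070000, 71070200, 73]),
    ([4453, 2917, 2922],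
      [50270400, 50270100, 70270400, 70270300, 70270100, 40260000]),
    ([4837, 3301],
      [50590500, 50590400, 50590100, 50590300, 70590500, 70590100, 70590300, 70590400, 40580000]),
    ([4645, 3102, 3109],
      [50430500, 50430100, 70430100, 70430500, 40420000]),
    ([4645, 3109],
      [50430300, 70430300, 222]),
    ([3094, 2999, 4630, 3083],
      [70410500, 70413500, 30410000]),
    ([2889, 2900, 4436, 2893, 264],
      [70250400, 30250000, 80253000, 90253004]),
    ([4823, 264, 3282, 3277, 3284, 2707],
      [50090300, 21, 30090000, 31, 70575300, 80575000, 70254300, 70575400, 225, 40240000,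
      70250300, 30250000, 90253003, 80253000]),
    ([2828, 2817, 2796, 2629],
      [26, 30170000, 44, 40170000, 70191400, 207]),
    ([3767, 423, 3781, 5318, 3397, 3782],
      [51330500, 91355015, 212, 31350000, 41340000, 71350100]),
    ([3487, 3498, 253, 3397],
      [143, 31090000, 168, 91113003, 177]),
    ([3493, 253, 109, 3397],
      [31, 30090000, 21, 60090000, 51110100, 51110300, 81111000, 229, 41100000, 91113001,
      71110100, 31110000]),
    ([5221, 3685],
      [51270400, 51270300, 51270100, 71270400, 71270300, 71270100, 41260000]),
    ([5227, 3675, 109, 3685],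
      [91273001, 81273000]),
    ([5269, 5663],
      [169, 37, 5, 102, 71310300, 71310200, 71310400, 71310100, 41300000]),
    ([3277, 4820, 3180, 2892, 3286],
      [50570300, 50570400, 80573000, 80575000, 30570000, 70570300, 70570400, 70570500, 40560000]),
    ([3229, 3220, 4772, 2844, 3180],
      [50530500, 50530400, 80532000, 80535000, 30530000, 70530500, 70530400, 40520000]),
    ([2724, 2629, 4260, 2701],
      [70111000, 70113000, 30110000]),
    ([2669, 4214, 2680, 2629, 168],
      [90072002, 70070200, 30070000]),
    ([2741, 2752, 168, 2701],
      [114, 30050000, 136, 70133200, 90132002, 70130200, 30130000]),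
    ([5657, 4115, 205],
      [7, 91632005]),
    ([132, 85, 421],
      [10011005, 10010550]),
    ([5655, 133, 4115],
      [16, 91631005]),
    ([5661, 4115, 349],
      [40, 91634005]),
    ([5663, 4115, 421],
      [24, 91635005]),
    ([5655, 5636, 5634, 5638, 4091, 4044],
      [16, 161, 81612000, 71610500, 31610000]),
    ([5663, 4106, 349, 421, 277, 205],
      [24, 91635002, 243, 91635003, 91635004, 41620000]),
    ([5639, 421, 4093, 4091],
      [91615005, 81615000]),
    ([5636, 5638, 5634, 205, 5655, 4091],
      [161, 71610500, 244, 31610000, 91612005]),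
    ([3620, 5156, 3609, 3573],
      [71210400, 71212400, 31210000]),
    ([5537, 3995, 3997, 205],
      [81532000, 91532005]),
    ([5543, 3573, 169, 4004, 3997, 4000],
      [144, 31050000, 116, 71535400, 71535200, 81535000, 71214200, 97, 248, 41200000])]

/-- Part 5 of the certificate for 6 alternatives. -/
def cert6_5 : List (List ℕ × List ℕ) := [
    ([3995, 5542, 349, 4006, 3997, 205],
      [71530500, 249, 31530000, 91534005, 81534000]),
    ([5541, 3994, 193, 337, 3997],
      [81534000, 91534002, 91534004, 41520000]),
    ([5537, 3994, 169, 193, 3997],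
      [81532000, 91532002, 91532004, 41520000]),
    ([420, 349, 4006, 4004, 3997, 4000, 205],
      [87, 10045005, 10025005, 148, 10025040, 10020520, 31170000, 157, 250, 251, 252, 253,
      31530000, 71530200, 71530400, 41520000]),
    ([5533, 3994, 4004, 4000],
      [71530200, 71530400, 41520000]),
    ([3425, 5344, 3808, 3814],
      [86, 71375200, 41360000, 31370000, 71370500]),
    ([3803, 3421, 3814, 421],
      [53, 31330000, 109, 71372500, 71370500, 91375005, 31370000]),
    ([5541, 421, 4006, 4000, 205],
      [53, 31330000, 109, 71534500, 71534200, 71372500, 256, 41050000, 257, 41360000, 71370200,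
      91375002, 31370000]),
    ([5537, 421, 349, 4006, 4004, 3997],
      [42, 30330000, 57, 60330000, 81532000, 71532500, 71532400, 81494000, 81, 31490000, 81495000,
       91495005, 91495004, 41480000]),
    ([5542, 349, 4006, 4004, 3997, 4000, 205],
      [254, 259, 258, 251, 31530000, 255]),
    ([349, 4006, 205, 4004, 3997, 4000],
      [254, 260, 81535000, 91535005, 91535002, 91535004, 41520000]),
    ([3899, 5440, 5442, 3901, 421],
      [51450500, 71450500, 31450000, 81455000, 91455005]),
    ([4893, 3343, 264],
      [145, 90634003]),
    ([4509, 2965, 2957, 192],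
      [90314002, 80314000]),
    ([4893, 3338, 192, 336, 264, 348],
      [145, 90634002, 90634004, 90634005, 263, 40620000]),
    ([2828, 4364, 2817, 2805],
      [70191400, 70190400, 30190000]),
    ([3109, 4654, 4646, 3103, 252],
      [223, 30430000, 80433000, 90433003]),
    ([2955, 4502, 4506, 4504, 2965, 2966, 120],
      [70310100, 30310000, 80314000, 90314001]),
    ([422, 855, 421],
      [10051551, 10055015]),
    ([4021, 3828, 5560, 5556, 5566, 3996],
      [81551000, 81554000, 31550000]),
    ([3814, 5350, 3803, 3767],
      [71372500, 71370500, 31370000]),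
    ([4894, 4886, 4890, 4892, 4888],
      [180, 30630000]),
    ([5660, 5658, 5662, 5656, 5654],
      [179, 31630000]),
    ([3814, 1289, 3756],
      [172, 31360000, 67, 150, 31330000, 126, 41330000, 257, 271, 41050000, 91375225]),
    ([3517, 3420, 5056, 3522],
      [51130200, 81133000, 208, 31130000]),
    ([3448, 3437, 4984, 3425],
      [71071200, 71070200, 31070000]),
    ([3449, 4980, 3424, 3399],
      [51071200, 81071200, 71072100, 31070000]),
    ([3565, 3605, 3612, 3424],
      [116, 31050000, 144, 41050000, 91210220, 84]),
    ([427, 3475, 5394, 3862, 420],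
      [10053550, 10055335, 111, 31400000, 103, 71410500, 91415305, 31410000]),
    ([5659, 4021, 253, 109, 265, 181, 277],
      [91633003, 91633001, 91633002, 91633004, 91633005, 41620000]),
    ([4045, 5586, 3660, 3852],
      [89, 81574000, 81575000, 31570000]),
    ([3444, 3448, 84, 96],
      [131, 30030000, 45, 60031000, 66, 31030000, 121, 219, 41070000, 41060000, 73, 91070120]),
    ([3469, 3863, 3757],
      [51410500, 60330000, 57, 30330000, 42, 211, 81410500, 91410550]),
    ([5317, 132, 3397, 420],
      [91350550, 91350150, 41340000]),
    ([3780, 5316, 3397, 3757],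
      [71351000, 71355000, 31350000]),
    ([109, 252, 84],
      [10013003, 10010310]),
    ([337, 3956, 3945, 3757],
      [71490400, 148, 91494004, 31170000, 31490000, 157, 71495400]),
    ([2917, 2922, 2820, 4454, 2724],
      [220, 80274000, 80273000, 30270000]),
    ([337, 3589, 3585],
      [202, 51190400, 148, 31170000, 157, 71191400, 31190000, 91194004, 81194000]),
    ([3483, 3396, 3494],
      [121, 31030000, 66, 41030000, 95, 94]),
    ([2701, 2715, 85, 2629, 2724],
      [236, 90110110]),
    ([3660, 5196, 3469, 3565],
      [71253000, 71254000, 31250000]),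
    ([3469, 3667, 3660, 3565],
      [51090300, 292, 168, 81250300, 31090000, 91250330, 143]),
    ([4789, 4891],
      [165, 164, 158, 147, 70550400, 70550200, 70550500, 70550100, 40540000]),
    ([4601, 204, 3013, 168, 96],
      [90392001, 90392002, 90392005, 40380000]),
    ([3444, 4982, 3421, 96, 3397],
      [51030100, 149, 31030000, 146, 71072000, 282, 85, 31070000, 81070200]),
    ([3037, 4576, 168],
      [167, 31050000, 123, 60050000, 114, 30050000, 136, 50370200, 50370500, 80375000, 199,
      30370000, 40360000, 70370500]),
    ([3425, 3808, 3805, 3814, 3797],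
      [60052000, 256, 136, 81372000, 91372002, 30050000, 114]),
    ([3805, 3797, 205],
      [51370500, 51370200, 71370200, 298, 116, 41050000, 31050000, 91375002, 144, 31370000,
      10020520, 71372500, 10025005, 109, 53, 31330000]),
    ([5375, 3821, 3829, 205],
      [91395002, 81395000])]

/-- Part 6 of the certificate for 6 alternatives. -/
def cert6_6 : List (List ℕ × List ℕ) := [
    ([3396, 5318, 3781, 3756, 3782],
      [41030000, 81355000, 200, 212, 41340000]),
    ([3612, 3565, 192, 3421],
      [51050200, 84, 278, 91210420, 41200000]),
    ([3564, 3620, 3609, 3421],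
      [41170000, 154, 248, 31170000, 91214004, 107]),
    ([3781, 423, 3756, 3782],
      [41330000, 81351000, 301, 228]),
    ([422, 5326, 3397, 3767, 421, 3782],
      [91351550, 269, 31350000, 151, 71350100, 31340000, 117]),
    ([4887, 120, 108, 96, 84, 132],
      [141, 90631003, 90631004, 90631002, 90631005, 90631001, 40620000]),
    ([265, 336, 252],
      [10034004, 10030430]),
    ([3205, 3180, 2820, 3012],
      [50510400, 50510100, 50510500, 80514000, 80511000, 80515000, 205, 30510000]),
    ([3660, 3469, 336],
      [107, 31170000, 154, 293, 292, 41250000, 91250440, 81250400]),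
    ([3493, 5030, 3396],
      [51110100, 51110300, 81113000, 290, 31110000, 41100000, 71110300]),
    ([5227, 5126, 3399, 3685],
      [51270100, 71273100, 81273000, 71194100, 202, 31190000]),
    ([2999, 4716, 3190, 2156, 2805],
      [70494500, 90495445, 30490000]),
    ([4893, 348, 120, 192, 264, 336],
      [145, 90634001, 265]),
    ([4889, 192, 168, 180, 204, 96],
      [139, 90632003, 90632004, 90632005, 90632002, 90632001, 40620000]),
    ([3046, 4582, 2999, 3035],
      [70372500, 70370500, 30370000]),
    ([3180, 3229, 4764, 4772, 3227, 3220, 420],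
      [80532000, 235, 30530000, 90535005]),
    ([4839, 2892, 3084, 3180, 3301],
      [50590500, 80591000, 70591500, 80574000, 234]),
    ([4861, 4887],
      [173, 166, 153, 133, 70610500, 70610200, 70610400, 70610300, 40600000]),
    ([4865, 192, 168, 204, 180, 3325],
      [80612000, 90612003, 90612002, 90612004, 40600000, 90612005]),
    ([4477, 2948, 2944, 2946],
      [70290200, 70290300, 70290400, 40280000]),
    ([4631, 420, 2999, 1722],
      [36, 30400000, 23, 90415335, 90415005, 40090000]),
    ([3229, 4768, 3221, 4772, 2844],
      [50530200, 80535000, 70530200, 30530000]),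
    ([3177, 348, 4724, 3181],
      [50490400, 70490400, 30490000, 80495000, 90495004]),
    ([3176, 3181, 420],
      [105, 30330000, 69, 50330500, 80494000, 50490500, 100, 40480000, 30480000, 70490500, 28,
      312, 30490000, 40170000, 90495005]),
    ([2678, 2667, 4214, 2631],
      [70072100, 70070100, 30070000]),
    ([4813, 3286, 3284, 3282],
      [70570500, 70570300, 70570400, 40560000]),
    ([2805, 2828, 2817, 2631],
      [60184000, 163, 31180000, 54, 90194114, 266]),
    ([3847, 3475, 3863, 3858],
      [71415300, 71410300, 80, 31410000, 81413500]),
    ([3493, 109, 253],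
      [187, 230]),
    ([3875, 5422, 3878, 277, 5414, 3886],
      [71430500, 31430000, 91433005, 71433100, 71433500, 41350000]),
    ([3997, 205, 349],
      [51530500, 51530400, 51530200, 261]),
    ([176, 5152, 192, 3420, 3565],
      [123, 31050000, 167, 41050000, 10022024, 91214220, 10024224, 31210000, 130, 91210420,
      31200000, 115]),
    ([5663, 277, 133, 205, 349, 421],
      [24, 91635001, 245]),
    ([5655, 5636, 4091, 3996, 205, 421],
      [16, 81613000, 246, 247]),
    ([5639, 4089, 4093, 349],
      [91615004, 81615000]),
    ([169, 3397, 3448, 3437],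
      [144, 91072002, 31050000, 276, 116]),
    ([276, 421, 253],
      [10033005, 10030550]),
    ([3947, 3958, 3565, 421],
      [53, 31330000, 109, 71494500, 91495005, 71490500, 31490000]),
    ([5447, 277, 3517, 421, 205],
      [91455002, 91455005, 91455003, 41440000]),
    ([5443, 3901, 3756, 205],
      [51450500, 71453500, 81453000, 274, 299, 138, 49, 31360000]),
    ([5437, 3898, 3904, 3906],
      [71450300, 71450200, 41440000]),
    ([5149, 3620, 3616],
      [71210200, 71210400, 41200000]),
    ([3474, 3499, 5034, 3397],
      [168, 81111300, 31090000, 31110000, 143, 81110300, 91110330]),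
    ([3475, 5202, 3668, 3666],
      [71254300, 79, 31250000, 41240000, 71250400]),
    ([3492, 3474, 3398],
      [41090000, 149, 31030000, 146, 41030000, 71113000, 343, 71111000, 41110000, 31110000,
      91110110, 81110100]),
    ([3657, 337, 5202, 3668, 3469],
      [91254004, 71250400, 31250000]),
    ([3819, 3830, 5366, 5368, 133, 3445],
      [91395001, 71390100, 31390000]),
    ([169, 3437, 3445],
      [51070200, 144, 336, 31050000, 81072000, 116, 276]),
    ([348, 337, 421],
      [10040550, 10044005]),
    ([3396, 3446, 3421, 3435],
      [41030000, 121, 72, 31030000, 91071001, 66])]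

/-- Part 7 of the certificate for 6 alternatives. -/
def cert6_7 : List (List ℕ × List ℕ) := [
    ([3421, 96, 3444, 3397],
      [71071000, 296]),
    ([5557, 5659],
      [51, 12, 129, 122, 71550400, 71550200, 71550100, 71550500, 41540000]),
    ([5557, 4021],
      [51550200, 51550500, 51550400, 51550100, 71550400, 71550200, 71550100, 71550500, 41540000]),
    ([5509, 3970, 3980, 3974],
      [71510100, 71510400, 41500000]),
    ([5509, 3980, 3974, 3982],
      [71510500, 354]),
    ([3109, 4654, 4646, 3012],
      [223, 80433000, 30430000]),
    ([3147, 4698, 132, 4696, 3157, 3158, 84],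
      [70470100, 213, 30470000, 90475001, 80475000]),
    ([4695, 96, 3157, 3149],
      [80471000, 90471002]),
    ([2726, 4165, 687],
      [45, 98, 30100000, 118, 71, 70113100, 70110100, 40090000, 30110000, 90111331]),
    ([4819, 3181, 264, 276, 252],
      [90573005, 90573003, 90573004, 40560000]),
    ([5639, 5244, 5248, 5655, 3565, 193, 3516, 169],
      [16, 13, 8, 144, 31050000, 116, 51050200, 81615000, 71615200, 71615400, 81294000, 31290000,
      71293400, 81293000, 71293200, 342, 81214000, 97, 31210000, 41200000, 91212004]),
    ([4087, 4045, 5638, 5636, 5634, 4098, 181],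
      [71610300, 91612003, 31610000]),
    ([4089, 5638, 5636, 5634, 4093, 4100, 193],
      [71610400, 31610000, 81612000, 91612004]),
    ([4087, 5638, 5636, 5634, 4093, 4098, 181],
      [71610300, 362, 31610000, 81612000]),
    ([5638, 4090, 5636, 5634, 4093, 4098, 4096, 4100, 193, 181, 169],
      [363, 364, 41600000, 71610200, 31610000, 81612000, 91612002]),
    ([5245, 3716, 3712, 3714],
      [71290200, 71290300, 71290400, 41280000]),
    ([5249, 3661, 193, 181, 169],
      [91292003, 91292002, 91292004, 41280000]),
    ([5655, 5248, 3565, 3996, 193, 181, 3516, 205, 3900, 169, 421],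
      [8, 13, 15, 16, 81613000, 81614000, 334, 365, 71615300, 71615200, 71615400, 361, 366]),
    ([89, 3446, 4984, 84, 3425],
      [10011210, 10011221, 112, 31060000, 30, 71070100, 91071201, 31070000]),
    ([4982, 3435, 3449],
      [51071200, 71070100, 51070200, 31070000, 72, 71072000, 41030000]),
    ([5077, 3544, 3546, 3542],
      [71150300, 71150100, 71150200, 41140000]),
    ([180, 253, 169],
      [10020330, 10022003]),
    ([1288, 3425, 3808, 3767],
      [138, 91372552, 31360000, 86, 49]),
    ([3808, 1288, 3425],
      [138, 31360000, 49, 51050200, 123, 31050000, 167, 373, 41330000, 204]),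
    ([3757, 3469, 252, 3859, 3852],
      [211, 91410330, 81410300]),
    ([4891, 3060, 3204, 2868, 3228],
      [159, 294, 80552000, 80555000, 80554000, 80551000, 30550000]),
    ([420, 3780, 132, 3397],
      [126, 284, 31330000, 285, 150]),
    ([4550, 3013, 2631],
      [50030100, 80355000, 50350500, 50350100, 78, 30350000, 40340000, 70350500]),
    ([4551, 421, 132],
      [42, 30330000, 57, 240, 90351001, 90351005, 40340000]),
    ([3205, 3012, 2820, 120, 84, 132],
      [50510400, 50510100, 50510500, 80515000, 308, 80514000, 205, 30510000, 90511001, 90511005,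
      90511004, 40500000]),
    ([3177, 3181, 421, 348],
      [42, 30330000, 57, 349, 323, 90494004]),
    ([3181, 421, 348],
      [349, 32, 30170000, 25, 50170400, 42, 30330000, 57, 50490500, 80495000, 381, 40480000,
      90494005, 70490500, 30490000]),
    ([2961, 4502, 4504, 4506, 2972, 2965, 336],
      [70310400, 30310000, 80314000, 90314004]),
    ([5533, 3997],
      [51530200, 51530400, 51530500, 71530500, 255]),
    ([5657, 5612, 5610, 4044, 3684],
      [7, 93, 81591000, 81595000, 31590000]),
    ([3589, 121, 85],
      [140, 30030000, 34, 60030000, 202, 81194000, 31190000, 81191000, 91191004, 91191001,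
      41180000]),
    ([3877, 3852, 3780, 3492],
      [81431000, 184]),
    ([5607, 4045, 4066, 121, 109, 85],
      [91591003, 91591001, 91591004, 41580000]),
    ([3685, 5126, 121, 3492, 109, 85],
      [146, 31030000, 149, 231, 81274000, 311, 31270000, 81271000, 91271001, 91271003, 91271004,
      41260000]),
    ([3633, 5180, 5176, 3644, 3613, 121],
      [91231004, 71230400, 31230000]),
    ([3629, 5176, 5180, 3640, 3613, 97],
      [91231002, 71230200, 31230000]),
    ([5560, 5566, 5659, 3828, 121, 133, 85, 97],
      [101, 81554000, 352, 31550000, 270, 91551001, 91551002, 91551005, 91551004, 41540000]),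
    ([5561, 3948, 5659, 3588, 3780, 4030],
      [51, 122, 101, 81552000, 71552500, 71552100, 71552400, 81514000, 81515000, 81511000, 355,
      31510000]),
    ([5655, 121, 133, 109, 85, 97],
      [16, 241, 92, 91631001, 91631002, 91631003, 41620000]),
    ([5561, 5659, 121, 3780, 133, 4030, 85],
      [51, 122, 101, 386, 81552000, 71552500, 71552100, 71552400, 393, 81514000, 81515000, 355,
      31510000, 91511004, 91511001, 91511005, 41500000]),
    ([3613, 3632, 5180, 5176, 3638, 3640, 85, 97],
      [391, 41220000, 91231001, 71230100, 31230000]),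
    ([193, 336, 168],
      [10024004, 10020420]),
    ([3829, 3444, 3780, 133, 85, 97],
      [51390200, 51390100, 51390500, 81392000, 81395000, 182, 31390000, 183, 81391000]),
    ([3445, 3396, 3421, 97],
      [51070100, 51070200, 81072000, 350, 41060000, 91071002, 71070200, 31070000]),
    ([4845, 3301, 264, 348, 336, 120],
      [80594000, 90594001, 90594005, 90594004, 90594003, 40580000])]

/-- Part 8 of the certificate for 6 alternatives. -/
def cert6_8 : List (List ℕ × List ℕ) := [
    ([2892, 336, 3180, 3286, 4839, 264, 3301, 348],
      [80591000, 317, 234, 90574003, 90574005, 90574004, 40560000]),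
    ([2889, 2893, 336, 264],
      [50250400, 32, 30170000, 25, 50243400, 27, 30240000, 4, 210, 225, 40090000, 90254004]),
    ([336, 3180, 3286, 4839, 264, 3301, 348],
      [32, 30170000, 25, 50170400, 401, 60250000, 50250300, 80253000, 309, 41090000, 402,
      60093000, 40240000, 40090000, 90254003, 70250300, 30250000]),
    ([3180, 3282, 3286, 3284, 4839, 264, 3301, 348],
      [326, 80591000, 80573000, 403, 349, 10030440, 126, 10033004, 31330000, 33, 104, 150,
      30090000, 31090000, 18, 106, 226, 283, 30570000, 80574000, 60410000, 375, 41410000]),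
    ([3181, 348],
      [50490500, 382, 105, 324, 30330000, 323, 69, 70494500]),
    ([4839, 264, 3301, 348],
      [50590500, 50590400, 50590300, 405, 70591400, 70591500, 70591300, 404]),
    ([252, 3757, 4818, 3277, 4812, 3284, 3282, 264],
      [33, 104, 30090000, 31090000, 18, 106, 226, 283, 30570000, 80574000, 60410000, 375,
      41410000]),
    ([4821, 3085, 336, 264, 348],
      [90574003, 90574005, 90574004, 40560000]),
    ([2893, 253, 264],
      [10033004, 10030440, 32, 30170000, 25, 50170400, 31, 30090000, 21, 50250300, 80253000, 402,
      40240000, 90254003, 70250300, 30250000]),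
    ([253, 3277, 3286, 264, 348],
      [405, 10033004, 10030440, 409, 234, 80574000, 408]),
    ([3284, 3282, 3286, 264, 348],
      [405, 326, 40570000, 80573000, 410, 33, 407, 30090000, 150, 18, 31330000, 226, 126,
      30570000, 349, 80574000, 408]),
    ([5327, 133, 3397, 421],
      [91355005, 91355001, 41340000]),
    ([5615, 133, 3685, 277, 421, 349],
      [91595005, 91595001, 91595003, 91595004, 41580000]),
    ([5519, 133, 3589, 3596, 421, 349],
      [51190100, 81515100, 91515004, 91515001, 82, 41500000]),
    ([3901, 5436, 5442, 277, 3852, 205, 421],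
      [81452000, 31450000, 339, 81455000]),
    ([3901, 3898, 277, 3852, 205, 421],
      [42, 30330000, 57, 60330000, 51450300, 51450200, 340, 415, 341]),
    ([263, 4626, 277, 3469, 2989],
      [51090300, 168, 31090000, 143, 60090000, 40090000, 217, 90415330, 36, 30410000, 30400000,
      90410530, 23]),
    ([2820, 4844, 3301, 3306, 4838, 2724, 3012, 120, 84, 132, 2892],
      [221, 380, 80593000, 30590000, 80595000, 70595300, 80271000, 288]),
    ([4459, 2821, 108, 264, 252],
      [90273003, 90273004, 90273001, 40260000]),
    ([4505, 4895, 2724, 108, 2892, 264, 252],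
      [156, 119, 80312000, 70312300, 80271000, 80274000, 288, 220, 419, 30270000]),
    ([4891, 180, 276, 108, 264, 252],
      [159, 203]),
    ([2652, 3037, 3029],
      [50370200, 40050000, 64, 199, 30050000, 80372000, 90372002, 137]),
    ([5461, 3925],
      [51470200, 51470500, 51470100, 51470300, 71470300, 71470100, 71470200, 71470500, 41460000]),
    ([3421, 96, 3449, 3444],
      [51050200, 71071000, 351, 370, 41030000, 41060000, 277, 91070210]),
    ([2848, 2837, 4384, 2657],
      [70214200, 70210200, 30210000]),
    ([5629, 5655],
      [161, 15, 13, 8, 71610400, 71610300, 71610500, 71610200, 41600000]),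
    ([252, 2893, 2887],
      [50250300, 70250300, 33, 30090000, 18, 70254300, 30250000, 90253003, 80253000]),
    ([5637, 337, 4089, 4093],
      [81614000, 91614004]),
    ([3853, 3468, 3756],
      [194, 81413000]),
    ([4045, 3852, 3660, 3948],
      [81573000, 281]),
    ([337, 3668, 3657],
      [60244000, 35, 30240000, 10, 148, 31170000, 157, 75, 71253400, 41090000, 346]),
    ([3901, 3852, 277, 421, 3899],
      [81452000, 262, 81453000, 91453005]),
    ([4895, 4506, 4504, 2961, 2940, 336],
      [156, 68, 80311000, 383]),
    ([4509, 2968, 2970, 2966, 2772],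
      [70314100, 70314300, 70314200, 40150000]),
    ([4693, 3150, 4893],
      [170, 160, 128, 70470500, 70470200, 70470100, 40460000]),
    ([4697, 3157, 96, 180, 168, 204],
      [80472000, 90472003, 90472005, 90472002, 90472001, 40460000]),
    ([4601, 3061, 96, 168, 204],
      [80392000, 295]),
    ([3061, 2676, 96, 3036, 168, 204],
      [50390100, 50390500, 50390200, 80391000, 80395000, 437, 30390000, 70390500, 70390100,
      70390200, 40380000]),
    ([2957, 4506, 4502, 4508, 2965, 2968, 168],
      [70310200, 30310000, 80312000, 90312002]),
    ([2828, 2817, 2805],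
      [50170400, 327, 227, 40030000]),
    ([88, 602, 85],
      [10011012, 10012112]),
    ([88, 4982, 3448, 85, 3399, 3421],
      [91072110, 441, 31070000, 120, 71070200, 31060000, 127]),
    ([2680, 2669, 2629, 168],
      [114, 30050000, 136, 70071200, 237]),
    ([2677, 96, 168],
      [167, 31050000, 123, 60050000, 114, 30050000, 136, 50070200, 60070000, 80071000, 71071000,
      424, 351, 282, 41030000, 442, 60031000, 10011220, 40030000, 90072012, 443, 30070000,
      40060000, 90070112]),
    ([3853, 277, 3469, 3756],
      [41330000, 60335000, 40330000, 60410000, 178, 81413000, 70413000, 31410000, 417, 91415035,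
      10035035]),
    ([4045, 3852, 5590, 5580, 3948],
      [81573000, 81574000, 31570000]),
    ([204, 169, 421],
      [10020550, 10022005]),
    ([2869, 2676, 2820, 2844],
      [50230400, 50230100, 50230200, 80231000, 80234000, 80232000, 30230000, 70230100, 70230200,
      70230400, 40220000]),
    ([2821, 120, 2805],
      [50170400, 50190400, 50190100, 80191000, 440, 40180000, 70190100, 30190000, 80194000,
      90194001]),
    ([4506, 4504, 4508, 4502, 4895, 2940, 120, 336],
      [156, 132, 119, 99, 268, 433, 30310000, 70310300, 70310200, 40300000])]

/-- Part 9 of the certificate for 6 alternatives. -/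
def cert6_9 : List (List ℕ × List ℕ) := [
    ([4405, 2864, 2869],
      [50230200, 50230100, 70230100, 70230200, 40220000]),
    ([2864, 2677, 4408, 4406, 2869, 120, 192],
      [451, 30230000, 90234002, 90234001, 40220000]),
    ([2869, 2844, 120, 192, 336],
      [32, 30170000, 25, 449, 50230400, 80231000, 80232000, 448, 452, 90234004, 70230400,
      30230000]),
    ([4504, 4506, 2773, 4502, 4895, 2940, 120, 192, 264, 336],
      [156, 99, 268, 433, 450, 264, 90314003, 40300000]),
    ([4797, 3061, 120, 192, 336, 348],
      [90554002, 90554004, 90554005, 90554001, 40540000]),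
    ([4891, 4796, 2868, 3204, 3228],
      [159, 294, 80551000, 80552000, 80555000, 30550000]),
    ([4504, 4506, 4502, 4895, 192, 2940, 120, 264, 336],
      [132, 119, 99, 454, 450, 434]),
    ([4891, 2868, 192, 3204, 120, 3228, 336, 348],
      [376, 456, 455]),
    ([121, 153, 225, 298, 336, 5655],
      [10014004, 10014020, 10014030, 10014050, 10010410, 394]),
    ([4461, 2725, 120, 264, 336],
      [90274003, 90274004, 90274001, 40260000]),
    ([3221, 2844, 4768, 3229, 192],
      [322, 80534000, 90534002]),
    ([2844, 348, 336, 3229, 192],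
      [405, 80532000, 461, 235, 80534000, 90534004, 90534005, 40520000]),
    ([3565, 3229, 420, 192],
      [60170000, 40170000, 26, 30170000, 44, 87, 462, 50210400, 60210000, 50210200, 80212000,
      71212000, 302, 332, 41050000, 10022440, 60052000, 40050000, 90214024, 30210000, 70210200,
      70210400, 40200000]),
    ([2841, 4388, 2852, 2797, 192],
      [90212004, 70210400, 30210000]),
    ([2845, 3564, 192],
      [154, 31170000, 107, 10020440, 10022004, 167, 31050000, 123, 60050000, 114, 30050000, 136,
      41170000, 60174000, 40170000, 50210400, 50210200, 80214000, 464, 40200000, 425, 90212002]),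
    ([3037, 168, 2988],
      [297, 80372000]),
    ([3180, 4772, 2844, 3229, 192],
      [80532000, 235, 461]),
    ([3221, 3181, 4772, 2844, 168, 3229],
      [322, 90532002]),
    ([4769, 3220, 204, 3181, 192],
      [90532005, 90532004, 40520000]),
    ([3229, 420, 192],
      [105, 30330000, 69, 50330500, 50530500, 50530400, 463, 154, 31170000, 107, 10020440,
      10022004, 465, 80535000, 466, 80534000, 467, 405, 10020540, 10025005, 468, 469, 30530000,
      70530500, 70530400, 40520000]),
    ([2725, 4165, 108],
      [45, 50030100, 60031000, 60110000, 50110300, 50110100, 80113000, 345, 359, 60093000, 55,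
      40090000, 30100000, 41, 90111003, 70110300, 30110000]),
    ([4693, 4893],
      [134, 70470300, 435]),
    ([2811, 2821, 84, 2797],
      [131, 30030000, 45, 50030100, 80194000, 50190100, 90191001, 70190100, 30190000]),
    ([2821, 84, 120, 2797],
      [131, 30030000, 45, 50030100, 50190400, 80194000, 473, 40180000, 90191004, 70190400,
      30190000]),
    ([4455, 2893, 84, 108, 120],
      [90271003, 90271004, 90271001, 40260000]),
    ([2917, 4454, 2820, 2724],
      [50270300, 288]),
    ([2773, 2748, 2724, 2676],
      [50150300, 50150200, 50150100, 80152000, 80153000, 80151000, 30150000, 70150100, 70150200,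
      70150300, 40140000]),
    ([4501, 2956, 2958, 4895],
      [68, 99, 70310400, 70310100, 40300000]),
    ([2772, 4506, 4895, 2917, 96, 180, 2940, 168, 192],
      [156, 80311000, 132, 119, 99, 434, 209, 439, 478, 30310000, 90312004, 90312001, 40300000]),
    ([4895, 2917, 2772, 2868, 96, 180, 2940, 168, 192],
      [156, 479, 80313000]),
    ([4501, 2956, 2958, 2966, 2972],
      [70310400, 70310100, 40300000]),
    ([2715, 2725, 108],
      [50110300, 471, 30030000, 131, 10011003, 10010330, 33, 30090000, 18, 70111300, 34, 50110100,
       70110100, 90113001, 30110000]),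
    ([2725, 108],
      [50110300, 471, 30030000, 131, 34, 10011003, 10010330, 33, 30090000, 18, 70111300, 482,
      40100000, 90113003, 70110300, 30110000]),
    ([2864, 2821, 4406, 2869, 96, 168],
      [444, 80234000, 451, 30230000, 90232002, 90232001, 40220000]),
    ([2869, 96, 168, 2844, 192],
      [444, 50230400, 80231000, 448, 80234000, 484, 70230400, 90232004, 30230000]),
    ([4895, 2772, 2868, 96, 180, 2940, 168, 192],
      [99, 119, 132, 156, 68, 480, 434, 80311000, 80313000, 80312000, 209, 439, 30310000, 481]),
    ([2763, 4310, 2725, 4314, 2774, 96],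
      [90152001, 70150100, 30150000]),
    ([3858, 3852, 276, 3757],
      [71413000, 41410000, 283, 41090000, 71415300, 328, 31410000, 41400000, 91410530]),
    ([4309, 2762, 2778, 2776],
      [70150200, 70150300, 40140000]),
    ([4313, 2725, 2762, 180, 168],
      [90152003, 90152002, 40140000]),
    ([5659, 5566, 3828, 3780, 85, 133, 97, 121],
      [129, 395, 392]),
    ([3877, 3492, 3780, 85, 133, 109],
      [387, 184, 176]),
    ([5659, 3636, 3828, 3780, 85, 133, 97, 121],
      [101, 491, 81555000]),
    ([5611, 5657, 3780, 3588, 3948],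
      [50, 19, 7, 113, 71593100, 81593000, 71593400, 71593500, 355, 81511000, 81514000, 81515000,
      31510000]),
    ([3493, 3396, 109],
      [51110100, 310, 290, 81111000, 41100000, 91111003]),
    ([3685, 3492, 3588, 3660],
      [231, 81271000, 81273000, 81274000, 31270000]),
    ([5271, 85, 97, 109, 121, 3709],
      [91311003, 91311001, 91311004, 91311002, 41300000]),
    ([3636, 5275, 5660, 5656, 3828, 3780, 5654, 85, 133, 97, 121],
      [493, 81313000, 273, 24]),
    ([3637, 3444, 3588, 3612],
      [51230100, 51230200, 51230400, 81231000, 81234000, 81232000, 31230000, 71230200, 71230400,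
      71230100, 41220000]),
    ([5660, 3540, 5656, 3636, 5270, 3684, 3828, 3780, 5654, 85, 133, 97, 121],
      [493, 498, 273, 24, 81314000, 233, 31310000, 81312000])]

/-- Part 10 of the certificate for 6 alternatives. -/
def cert6_10 : List (List ℕ × List ℕ) := [
    ([3540, 5656, 3636, 5270, 3684, 3828, 3780, 85, 133, 97, 109, 121],
      [140, 30030000, 34, 60030000, 495, 492, 394, 500, 40, 185, 81475000, 81472000, 81473000,
      186, 31470000]),
    ([3541, 3444, 85, 97, 109],
      [140, 30030000, 34, 60030000, 495, 189, 188]),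
    ([3684, 5612, 109, 5610, 5657, 133, 85, 121],
      [93, 7, 81595000, 385, 31590000, 388, 91591005]),
    ([109, 5610, 5657, 3780, 133, 85, 121],
      [7, 140, 30030000, 34, 60030000, 386, 495, 492, 81594000, 503, 231, 81273000, 81274000, 496,
       31270000, 91271001, 91271004, 91271003, 41260000]),
    ([3109, 3084, 108, 252, 276],
      [483, 223, 80435000, 80431000, 356, 267, 30430000, 90433005, 90433001, 40420000]),
    ([3852, 252, 276, 3757],
      [104, 31090000, 106, 488, 375]),
    ([1722, 3094, 420],
      [105, 30330000, 69, 36, 321, 30400000, 224, 23]),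
    ([4309, 2778, 2776, 2774],
      [70150100, 489]),
    ([4703, 2748, 180, 3157, 108, 252],
      [50470300, 50470200, 50470100, 483, 70475100, 80475000, 70475200, 70475300, 80151000, 477,
      80152000, 508, 30150000, 90153001, 90153003, 90153002, 40140000]),
    ([4669, 3138, 3142, 3136],
      [70450500, 70450300, 70450200, 40440000]),
    ([4675, 3133, 180, 252, 276],
      [80453000, 90453003, 90453005, 90453002, 40440000]),
    ([4693, 3150, 3157],
      [50470200, 50470100, 50470500, 70470500, 70470200, 70470100, 40460000]),
    ([4702, 4694, 180, 4696, 3157, 108, 252, 276],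
      [50470300, 216, 512, 30470000, 214, 80473000, 90473002, 90473005, 40460000]),
    ([3709, 3612, 193, 181, 3516, 169],
      [51290400, 51290200, 51290300, 81294000, 366, 81293000, 31290000, 81292000, 367]),
    ([3661, 337, 265, 3469],
      [148, 31170000, 157, 51170400, 51250300, 51250400, 81253000, 431, 41240000, 91254003,
      71250300, 31250000]),
    ([5656, 5654, 3684, 3708, 3636, 121, 3828, 3780, 85, 97, 133, 3540, 5660],
      [493, 500, 273, 81311000, 24]),
    ([5657, 193, 97, 181, 169, 205],
      [7, 91632001, 91632002, 239, 91632003, 91632004, 41620000]),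
    ([5537, 3997, 193, 169, 205],
      [81532000, 91532005, 253]),
    ([121, 3684, 5654, 3708, 5656, 3828, 3444, 3780, 85, 97, 133, 3540, 5660],
      [386, 516, 51230100, 51230200, 51230400, 81234000, 81232000, 499, 390, 396]),
    ([3613, 3565, 193, 169],
      [144, 31050000, 116, 51050200, 51210400, 51210200, 81214000, 342, 97, 31210000, 41200000,
      91212004]),
    ([3997, 5540, 5536, 3612],
      [384, 81535000, 31530000]),
    ([4093, 3996, 3708, 193, 3900, 181, 169, 205],
      [51610400, 51610200, 51610300, 51610500, 81614000, 81615000, 81613000, 365, 71610500,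
      31610000, 81612000, 91612005]),
    ([5663, 5276, 5270, 3636, 3684],
      [24, 233, 81313000, 81312000, 31310000]),
    ([5663, 5270, 3636, 3684, 3540],
      [24, 523, 81314000]),
    ([3997, 3612, 193, 3804, 169, 205],
      [81534000, 518, 521]),
    ([5659, 3996, 3636, 193, 3828, 97, 169, 205],
      [101, 352, 81555000, 270, 81552000, 91552005, 91552002, 91552001, 91552004, 41540000]),
    ([5273, 3685, 193, 97, 181, 169],
      [91312001, 91312002, 91312004, 91312003, 41300000]),
    ([3613, 193, 169],
      [144, 31050000, 116, 51050200, 51210400, 51210200, 81214000, 520, 342, 81212000, 31210000]),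
    ([3997, 5536, 3612, 3804],
      [81534000, 521]),
    ([3709, 5248, 3612, 3516],
      [51290400, 51290200, 51290300, 81294000, 81293000, 366, 31290000]),
    ([2917, 2820, 2724, 2892],
      [476, 80271000]),
    ([3301, 3204, 2916, 120, 264, 336, 348],
      [221, 406, 400, 80593000, 80595000, 30590000]),
    ([2941, 4484, 2892, 2844],
      [50290400, 50290200, 50290300, 80293000, 80292000, 320, 30290000]),
    ([4887, 2940, 264, 336, 192, 3276, 348, 3228],
      [141, 318, 80612000, 80615000, 80613000, 30610000, 80614000, 90614002, 90614005, 90614004,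
      90614003, 40600000]),
    ([3205, 2820, 120, 336, 348],
      [405, 50510400, 50510100, 50510500, 308, 80511000, 80515000, 205, 30510000, 90514001, 206]),
    ([2917, 264, 2820, 120, 2892, 336],
      [50270300, 220, 80273000, 80271000, 531, 30270000, 460]),
    ([264, 2940, 2820, 2868, 120, 2892, 336, 192, 3276, 348, 3228],
      [535, 458, 313, 534, 536, 532, 139, 272, 156, 80311000, 80312000, 80313000, 457]),
    ([265, 3661, 3565, 336],
      [51250400, 51250300, 307, 143, 90, 31090000, 41240000, 168, 91253004, 344]),
    ([4485, 264, 2749, 336, 192],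
      [90294004, 90294002, 90294003, 40280000]),
    ([120, 2940, 264, 2892, 2805, 336, 192, 2844, 3276, 348, 3228],
      [453, 449, 537]),
    ([3781, 3396, 133],
      [51350100, 190, 81351000, 301]),
    ([109, 5654, 5126, 85, 121, 97, 133, 5660, 5656, 3540, 3636, 3828],
      [140, 30030000, 34, 60030000, 541, 495, 389, 500, 516, 497]),
    ([225, 5126, 85, 121, 336, 298, 97, 133, 153, 5660, 5656, 3540, 3636, 3828],
      [459, 542, 10014030]),
    ([121, 225, 3565, 336, 298, 81, 97, 133, 153, 5660, 5656, 3540, 3636, 3828],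
      [10010410, 386, 543, 71191000]),
    ([3589, 5126, 3396],
      [202, 81194000, 31190000]),
    ([264, 120, 253, 2749, 2805, 336, 192, 2844, 3276, 348, 3228],
      [539, 409, 540, 533]),
    ([5659, 109, 277, 265, 181, 253],
      [101, 280]),
    ([3468, 2748, 169],
      [137, 30050000, 64, 70133000, 106, 41090000, 31090000, 60093000, 104, 40090000, 372,
      70132000, 30130000, 90130330, 90130230, 40120000]),
    ([2941, 2892, 2748, 2844],
      [80294000, 533]),
    ([3805, 205, 3425],
      [51370500, 51370200, 299, 374, 256, 41360000, 274, 91372005])]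

/-- Part 11 of the certificate for 6 alternatives. -/
def cert6_11 : List (List ℕ × List ℕ) := [
    ([264, 253, 3228, 120, 2805, 336, 192, 2844, 2749, 348],
      [546, 50570500, 410]),
    ([5663, 3708, 3684, 3540, 3636],
      [24, 524, 81311000]),
    ([5635, 277, 265, 253, 181, 3997],
      [91613003, 91613002, 91613004, 91613005, 41600000]),
    ([3277, 348, 264],
      [50570300, 50570500, 50570400, 411]),
    ([3013, 4558, 3003, 2988],
      [50350100, 80351000, 70350100, 30350000]),
    ([4703, 3157, 204, 420, 276, 132],
      [80475000, 90475002, 90475005, 90475003, 90475001, 40460000]),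
    ([3029, 4576, 3040, 204, 2653],
      [90375002, 70370200, 30370000]),
    ([3037, 204, 420, 2653],
      [105, 30330000, 69, 50330500, 50370200, 50370500, 80372000, 557, 40360000, 90375005, 315]),
    ([3133, 3084, 276, 2748, 180, 252],
      [50450500, 50450300, 50450200, 80452000, 511, 80455000, 510, 30450000]),
    ([2941, 2844, 2892, 264, 336, 192],
      [533, 549, 539]),
    ([2749, 4288, 2652],
      [50130300, 80133000, 74, 30130000, 40120000, 70130300]),
    ([5629, 4093],
      [51610500, 51610300, 51610200, 51610400, 71610400, 71610300, 71610500, 71610200, 41600000]),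
    ([3901, 3852, 205, 277, 421],
      [416, 432]),
    ([5639, 4093, 277, 205, 421, 349],
      [81615000, 335, 91615002, 246, 91615003, 41600000]),
    ([5591, 3661, 277, 421, 349],
      [91575005, 91575004, 91575003, 41560000]),
    ([3949, 421, 349, 3565],
      [42, 30330000, 57, 60330000, 51490500, 51490400, 81494000, 338, 81, 41480000, 31490000,
      91495004]),
    ([3637, 3444, 3613, 97, 121, 85],
      [386, 51230100, 51230200, 51230400, 81234000, 81232000, 396, 390]),
    ([5657, 121, 85, 133, 109, 3948],
      [140, 30030000, 34, 60030000, 541, 386, 504, 494]),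
    ([3445, 97, 85],
      [140, 30030000, 34, 60030000, 146, 31030000, 149, 51070100, 81072000, 399, 218, 81071000,
      41060000, 72]),
    ([3828, 3636, 97, 5656, 3876, 5126, 121, 85, 133, 109],
      [569, 502, 394, 542, 40, 185, 81475000, 81472000, 81473000, 186, 31470000]),
    ([97, 5656, 3876, 5126, 121, 85, 133, 109],
      [140, 30030000, 34, 60030000, 541, 386, 569, 398, 570, 499, 567]),
    ([83, 84, 421],
      [10010550, 10010510]),
    ([3925, 3540, 5462, 3828, 3876],
      [423, 81475000, 81473000, 81472000, 31470000]),
    ([2773, 96, 2676, 180, 168, 2748],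
      [50150300, 50150200, 50150100, 80151000, 477, 80153000, 508, 487, 30150000, 490]),
    ([5661, 121, 349, 193, 265, 337],
      [40, 91634003, 91634004, 242, 91634001, 91634002, 41620000]),
    ([3637, 3612, 3588, 337, 3633],
      [51230400, 81232000, 499, 81231000, 71230400, 91234004, 31230000]),
    ([5663, 5270, 3684, 121, 3636, 193, 265, 337, 3708],
      [552, 523, 91314001, 91314003, 91314004, 91314002, 41300000]),
    ([3685, 121, 3660, 265, 3588, 337],
      [231, 496, 81271000, 81273000, 31270000, 91274001, 91274004, 91274003, 41260000]),
    ([5613, 4069, 121, 349, 265, 337],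
      [81594000, 91594004, 91594005, 91594003, 91594001, 41580000]),
    ([3301, 3108, 4838, 3204, 2916],
      [221, 80595000, 80593000, 80594000, 30590000]),
    ([5637, 4093, 193, 337, 265, 3901, 4090],
      [91614003, 91614002, 428, 41600000]),
    ([5253, 193, 337, 265, 3517],
      [91294002, 91294004, 91294003, 41280000]),
    ([3708, 5663, 193, 3684, 3636, 337, 265, 121],
      [24, 577, 81311000]),
    ([5657, 3972, 3684, 4044, 349, 265, 337, 121],
      [7, 93, 81591000, 579, 81593000, 81595000, 31590000]),
    ([3629, 5174, 3445, 5176, 3640, 193],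
      [91234002, 71230200, 31230000]),
    ([3637, 3612, 193, 3588, 337, 121],
      [51230100, 51230200, 81232000, 499, 81231000, 576, 585, 41220000, 91234001, 71230100,
      31230000]),
    ([4021, 4019, 3996, 349, 3972, 3636],
      [353, 81551000, 81555000, 81552000, 31550000, 270, 91554005]),
    ([5589, 3853, 265, 337, 349],
      [91574004, 91574005, 91574003, 41560000]),
    ([5659, 121, 3972, 3636, 3996, 337, 349, 193],
      [101, 352, 81551000, 81555000, 81552000, 587, 270, 31550000, 91554001, 91554002, 91554004,
      41540000]),
    ([3661, 265, 337],
      [148, 31170000, 157, 51170400, 51250300, 51250400, 515, 81253000, 344, 41090000]),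
    ([3589, 121, 337],
      [148, 31170000, 157, 51170400, 202, 81191000, 289, 31190000, 545, 41180000, 91194001]),
    ([3613, 3609, 3573],
      [51170400, 51210400, 303, 248, 81214000]),
    ([4044, 5658, 3972, 5662, 3708, 3996, 349, 265, 121, 337, 193],
      [575, 591, 590, 578, 584, 273, 16, 426, 81613000, 81615000, 81612000, 31610000, 81614000,
      91614005, 581]),
    ([4045, 3948, 349, 265, 337],
      [590, 89, 81573000, 430, 81575000, 588, 31570000]),
    ([3972, 3708, 4044, 3996, 349, 265, 3636, 121, 337, 193],
      [591, 590, 578, 583, 589, 593]),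
    ([3973, 3948, 349, 121, 337],
      [591, 51510400, 51510100, 51510500, 81515000, 81511000, 355, 31510000, 81514000, 91514005,
      91514001, 91514004, 41500000]),
    ([3709, 265, 3612, 337, 193],
      [590, 51290400, 51290200, 51290300, 81292000, 81293000, 366, 530, 31290000, 582]),
    ([3613, 3573, 193],
      [51170400, 51210400, 51210200, 81212000, 592, 342, 41200000, 31210000, 81214000, 91214002]),
    ([3949, 349, 337],
      [148, 31170000, 157, 51170400, 51490500, 51490400, 81495000, 81, 31490000, 81494000, 287,
      91494005, 41480000]),
    ([3997, 349, 337, 193],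
      [599, 148, 31170000, 157, 598, 81532000, 521, 529, 91534005, 252])]

/-- Part 12 of the certificate for 6 alternatives. -/
def cert6_12 : List (List ℕ × List ℕ) := [
    ([349, 265, 121, 337, 193],
      [148, 31170000, 157, 598, 597, 591, 586, 599, 594, 600, 596, 595]),
    ([3421, 5344, 3804, 155],
      [60050000, 71375000, 64, 31370000, 30050000, 175, 137]),
    ([3517, 181, 3420],
      [123, 31050000, 167, 51130300, 60130000, 275, 548, 91132002, 91132003, 41120000]),
    ([3901, 5442, 5440, 3516],
      [51450300, 51450200, 51450500, 81455000, 31450000, 71450500, 341]),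
    ([3828, 5470, 3540, 5462, 5460, 3925, 97, 181, 205, 169],
      [81473000, 573, 31470000, 91472005, 91472001, 91472003, 91472002, 41460000]),
    ([3829, 5368, 3444, 3804],
      [51390200, 51390100, 51390500, 81391000, 81395000, 182, 31390000]),
    ([3540, 3828, 5462, 3925, 97, 205, 169, 181],
      [423, 81475000, 605]),
    ([5081, 3493, 97, 169, 181],
      [91152002, 91152003, 91152001, 41140000]),
    ([5369, 3781, 97, 205, 169],
      [91392002, 91392001, 91392005, 41380000]),
    ([3445, 3397, 97, 169],
      [144, 31050000, 116, 51050200, 51070100, 81071000, 348, 41060000, 91072001, 71070100,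
      31070000]),
    ([3444, 5368, 5462, 3925, 97, 205, 169, 181],
      [144, 31050000, 116, 550, 51050200, 603, 606, 607, 51150300, 51150200, 51150100, 81153000,
      371, 81151000, 189, 31150000, 608]),
    ([3445, 97, 169],
      [569, 610, 66, 121, 31030000]),
    ([3541, 97, 169, 181],
      [612, 144, 31050000, 116, 51050200, 603, 51150300, 51150200, 51150100, 81151000, 81153000,
      189, 371, 31150000, 608]),
    ([5462, 3925, 97, 205, 169, 181],
      [613, 612, 611, 607, 609, 81392000]),
    ([3901, 205, 169, 181],
      [144, 31050000, 116, 550, 51050200, 603, 81453000, 604, 81452000, 91452002, 91452003,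
      91452005, 41440000]),
    ([3925, 97, 205, 169, 181],
      [615, 614, 81471000]),
    ([3829, 97, 205, 169],
      [612, 144, 31050000, 116, 550, 606, 81392000, 609]),
    ([5173, 3637, 3626],
      [51230400, 51230200, 71230200, 71230400, 41220000]),
    ([253, 348, 192, 2844, 264, 2805, 336, 120, 2820],
      [554, 462, 453, 551, 409, 549, 537]),
    ([2844, 3228, 192, 348, 264, 2805, 336, 120, 2820],
      [554, 453, 619, 104, 31090000, 106, 309, 60250000, 537, 560]),
    ([3637, 5176, 3612, 3444],
      [51230100, 81234000, 81231000, 31230000, 71230100, 618]),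
    ([2845, 4388, 2848, 2796],
      [50210400, 80212000, 30210000, 70210200, 70210400, 40200000]),
    ([348, 2844, 192, 264, 336, 120, 2820],
      [32, 30170000, 25, 462, 620]),
    ([5567, 205, 133, 421, 349, 4021],
      [81555000, 91555005, 91555002, 91555001, 91555004, 41540000]),
    ([3973, 3780, 3948, 5518],
      [51510400, 51510100, 51510500, 81511000, 81514000, 355, 31510000]),
    ([181, 252, 168],
      [10023003, 10020320]),
    ([4045, 5590, 3852, 3948],
      [89, 446]),
    ([4093, 4044, 3900, 277, 205, 349, 421],
      [331, 562, 81613000, 564, 81614000, 81612000, 31610000]),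
    ([5657, 3876, 4044, 277, 3972, 133, 349, 421],
      [7, 93, 81594000, 81593000, 81591000, 31590000, 385, 413]),
    ([3876, 5462, 5460, 3925, 277, 3828, 205, 133, 421],
      [81473000, 573, 81472000, 31470000, 91475001, 91475005, 91475003, 91475002, 41460000]),
    ([3877, 3852, 277, 3780, 133, 421],
      [51430500, 51430300, 51430100, 387, 81431000, 81433000, 96, 31430000, 91435005, 91435001,
      91435003, 41420000]),
    ([277, 3661, 3469, 3972, 3828, 3780, 205, 3948, 133, 349, 421, 5658],
      [42, 30330000, 57, 60330000, 445, 565, 333, 563, 627, 628, 16, 631, 629, 273, 40, 185,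
      81471000, 630]),
    ([3469, 277, 3972, 3828, 3780, 205, 3948, 133, 349, 421, 5658, 336],
      [309, 632]),
    ([4621, 3090, 3094],
      [70410500, 70410300, 40400000]),
    ([4627, 252, 276, 2989],
      [90413003, 90413005, 40400000]),
    ([3085, 2700, 4626],
      [50410500, 50410300, 80415000, 634, 30410000]),
    ([4717, 3188, 2989, 349],
      [90490540, 70490400, 40480000]),
    ([428, 3956, 5494, 421, 3565],
      [53, 31330000, 109, 10055045, 91494550, 10054554, 31490000, 162, 71490400, 31480000, 52]),
    ([3157, 3132, 3108, 2748, 108, 252, 180, 276],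
      [509, 80471000, 80472000, 513]),
    ([4867, 252, 180, 276, 3229, 264],
      [90613005, 90613003, 90613004, 90613002, 40600000]),
    ([108, 253, 85],
      [10011003, 10010330]),
    ([3301, 3108, 3276, 2916, 3204],
      [580, 80591000]),
    ([4891, 4790, 3060, 3204, 2868],
      [159, 294, 80555000, 80554000, 80552000, 30550000]),
    ([2724, 3468, 85],
      [106, 31090000, 104, 641, 41090000, 60093000, 40090000, 140, 30030000, 34, 291, 236,
      40100000, 90110310]),
    ([4044, 5660, 3876, 3900, 277, 3972, 5658, 133, 205, 421, 349],
      [333, 629, 628, 273, 16]),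
    ([428, 4724, 349, 336],
      [87, 42, 30330000, 57, 107, 31170000, 154, 566, 71495000, 32, 30170000, 25, 10045045, 638,
      90495440, 60494000, 30490000, 637]),
    ([3612, 176, 3565, 192],
      [302, 71212000, 332]),
    ([96, 169, 85],
      [10011002, 10010220]),
    ([5661, 3876, 3900, 277, 3828, 133, 205, 421],
      [40, 185, 81471000, 630]),
    ([277, 3828, 5658, 3972, 3780, 133, 205, 349, 336],
      [87, 42, 30330000, 57, 60330000, 107, 31170000, 154, 566, 633, 429, 563, 631, 649, 645, 430,
       627, 565])]

/-- Part 13 of the certificate for 6 alternatives. -/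
def cert6_13 : List (List ℕ × List ℕ) := [
    ([4843, 3205, 108, 252, 276, 264],
      [90593005, 90593001, 90593003, 90593004, 40580000]),
    ([3277, 3084, 2707, 4818, 264],
      [50570300, 50570500, 50570400, 226, 80574000, 326, 30570000]),
    ([2772, 4506, 4504, 4895, 2940, 180],
      [156, 80311000, 132, 119, 99, 434, 209, 30310000, 478, 70310200]),
    ([2773, 108, 2748, 252, 180],
      [483, 50150300, 50150200, 50150100, 80151000, 477, 80152000, 508, 30150000, 90153001,
      90153002, 90153003, 40140000]),
    ([4895, 2772, 108, 2892, 2940, 264, 252, 180],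
      [483, 156, 420, 653, 80313000, 90313004, 90313002, 90313001, 90313003, 40300000]),
    ([4847, 4458, 3301, 3306, 2724, 2892],
      [80595000, 70595300, 220, 80271000, 80274000, 30270000]),
    ([204, 3037, 154, 2989],
      [10022005, 76, 297]),
    ([3781, 5326, 3397, 421],
      [42, 30330000, 57, 60330000, 53, 31330000, 109, 51350100, 304, 305]),
    ([3828, 3972, 3780, 133, 205, 277, 349, 336, 421],
      [331, 650, 352, 101, 81554000, 624, 81551000, 81552000, 31550000]),
    ([3301, 3108, 2916, 108, 3204, 120, 132, 84],
      [642, 580, 90591003, 90591004, 215, 90591005, 40580000]),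
    ([4695, 3146, 3157, 108, 96, 132],
      [80471000, 90471003, 90471005, 358, 40460000]),
    ([3060, 4891, 3204, 2868, 120, 96, 132, 84],
      [376, 643, 90551004, 90551002, 90551001, 90551005, 40540000]),
    ([3053, 4606, 4600, 3064, 96, 3037],
      [70390200, 90391002, 30390000]),
    ([4599, 3052, 132, 84, 3037],
      [90391001, 90391005, 40380000]),
    ([4606, 4600, 3064, 3070, 3062, 96, 132, 84, 3037],
      [663, 664, 30390000, 70390500, 70390100, 40380000]),
    ([3061, 3012, 96, 132, 84, 3037],
      [66, 31030000, 121, 131, 30030000, 45, 50390100, 50390500, 50390200, 80392000, 665,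
      70395100, 80395000, 70395200, 70072100, 60070000, 444, 351, 282, 71072000, 137, 41050000,
      51071200, 369, 30050000, 64, 90071021, 30070000, 325, 70070200, 40060000]),
    ([2676, 4308, 2773, 108, 96, 84],
      [483, 80152000, 477, 80153000, 30150000, 90151001, 90151003, 90151002, 40140000]),
    ([2677, 96, 84],
      [131, 30030000, 45, 50030100, 66, 31030000, 121, 50070100, 50070200, 60070000, 444,
      80072000, 351, 282, 71072000, 137, 41050000, 51071200, 369, 30050000, 64, 90071021, 325,
      30070000, 40060000, 70070200]),
    ([2773, 108, 96, 84],
      [668, 50150300, 50150200, 50150100, 667, 508]),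
    ([3157, 3108, 108, 3060, 96, 132, 84],
      [669, 50470100, 50470300, 80472000, 80473000, 357, 80475000, 661, 30470000, 70470300, 512]),
    ([4501, 4895],
      [132, 119, 70310300, 70310200, 478]),
    ([3733, 5276, 5274, 3708, 5268, 3684],
      [81312000, 81311000, 31310000]),
    ([3878, 5422, 5414, 3781, 3882, 3886, 253, 109, 277],
      [330, 96, 31430000, 91433003, 91433001, 41420000]),
    ([3709, 5248, 3703, 265, 253],
      [51290300, 83, 71290300, 31290000, 81294000, 91294003]),
    ([5661, 3540, 3900, 3852, 181, 253, 109, 277],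
      [329, 108, 40, 43, 65, 185, 191, 81471000, 81475000, 31470000, 81472000, 71472500, 71472300,
       71472100, 387, 81431000, 81435000, 673]),
    ([5635, 4093, 277, 181, 265, 253],
      [81613000, 553]),
    ([5275, 3637, 265, 181, 109, 253],
      [91313002, 91313003, 91313001, 91313004, 41300000]),
    ([265, 151, 252, 3709, 169],
      [307, 10020340, 597, 528]),
    ([133, 420, 84],
      [10010510, 10015005]),
    ([2749, 180, 252],
      [33, 30090000, 18, 50090300, 104, 31090000, 106, 50130200, 80132000, 70, 561, 40120000,
      90133002, 70130200, 30130000]),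
    ([5663, 5272, 3636, 3540, 3708],
      [24, 233, 81314000, 81313000, 81311000, 31310000]),
    ([2844, 4772, 3229, 3180],
      [80532000, 235, 322]),
    ([4673, 420, 276, 3133],
      [105, 30330000, 69, 50330500, 50450300, 50450500, 80452000, 70452300, 70452500, 80413000,
      507, 634, 636, 11, 30410000, 30400000, 90415003, 58]),
    ([3636, 97, 3708, 181, 205, 169, 193, 3996, 5654],
      [616, 40, 613, 517, 617, 526, 273, 552, 681, 527]),
    ([97, 3708, 181, 205, 169, 193, 3996, 5654],
      [528, 612, 684, 499, 621, 91232001, 91232002, 91232004, 41220000]),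
    ([3037, 193, 227, 276, 3996, 348, 4887, 5654],
      [10030550, 105, 30330000, 69, 50330500, 126, 31330000, 150, 10024005, 60370000, 466,
      71372000, 137, 528, 602, 30050000, 64, 558, 10025003, 10025030, 10025004, 603, 514, 685,
      648, 10013020, 10014020, 10015020, 306]),
    ([181, 97, 205, 169, 193, 3996, 5654],
      [144, 31050000, 116, 51050200, 528, 603, 685, 514]),
    ([180, 3084, 252, 276, 3133],
      [680, 559]),
    ([96, 153, 151, 155, 169, 4887],
      [648, 10013020, 10014020, 10015020, 306]),
    ([192, 3421, 3229, 348],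
      [470, 349, 462, 60210000, 465, 302]),
    ([3225, 4772, 3229, 348],
      [405, 682, 80532000, 50530400, 90535004, 70530400, 30530000]),
    ([3220, 3224, 4772, 420, 3229, 3180],
      [50530500, 40520000, 316, 70530500]),
    ([168, 3229, 348],
      [405, 80532000, 50530200, 167, 31050000, 123, 690, 10024005, 397, 10020520, 349, 105,
      30330000, 69, 50330500, 466, 80534000, 682, 691, 692, 90535002, 70530200, 30530000]),
    ([3540, 5274, 5656, 3684, 3852, 5658, 109, 277, 181, 3708, 253, 3900, 5654],
      [675, 273, 24, 233, 81314000, 672]),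
    ([3540, 3636, 5656, 3684, 3852, 5658, 109, 277, 181, 3708, 253, 3900, 5654],
      [675, 552, 273]),
    ([3684, 5656, 3540, 3852, 109, 277, 181, 3708, 253, 265, 3900, 5654],
      [547, 695, 694, 677]),
    ([5611, 4069, 109, 277, 253, 265],
      [81593000, 91593003, 91593004, 91593005, 91593001, 41580000]),
    ([5587, 3949, 277, 253, 265],
      [91573005, 91573004, 91573003, 41560000]),
    ([3685, 3660, 3589, 265, 253, 109],
      [329, 231, 81271000, 81274000, 31270000, 232, 91273003, 91273004, 41260000]),
    ([3853, 3468, 277, 253],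
      [429, 194, 192])]

/-- Part 14 of the certificate for 6 alternatives. -/
def cert6_14 : List (List ℕ × List ℕ) := [
    ([3660, 4045, 253, 265, 277],
      [31, 30090000, 21, 60090000, 700, 430, 281, 698]),
    ([3661, 3475, 265],
      [51250300, 51250400, 590, 344, 538, 81253000]),
    ([192, 3229, 348],
      [693, 137, 30050000, 64, 10022004, 10020440, 32, 462, 30170000, 60210000, 50210200, 465, 25,
       647, 60170000, 10022440, 622, 90214024]),
    ([2893, 252, 264],
      [33, 30090000, 18, 50090300, 50250400, 427, 80254000, 40240000, 225]),
    ([2845, 4483, 180, 252, 264],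
      [90293003, 90293002, 90293004, 40280000]),
    ([4871, 252, 180, 264, 3325],
      [680, 704, 50610200, 50610400, 50610300, 80615000, 70615300, 70615400, 70615200, 80294000,
      320, 80292000, 549, 30290000, 705]),
    ([252, 180, 264, 276, 4866, 4864, 4860, 3325],
      [33, 30090000, 18, 50090300, 706, 30610000, 80614000, 688, 636, 80413000, 635]),
    ([180, 264, 276, 3228, 348, 3276, 4887, 3325],
      [80613000, 80612000, 318, 707, 10033004, 372, 409, 10024030, 10030440, 167, 107, 534,
      31050000, 31170000, 560, 123, 154, 60210000, 302]),
    ([3037, 169, 193, 2653, 3612, 253, 276, 348, 4887, 5654],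
      [10033005, 337, 60370000, 558, 686, 525]),
    ([205, 97, 169, 193, 3425, 3612, 181, 5654],
      [550, 687, 525]),
    ([4679, 204, 2749, 420, 276],
      [90455003, 90455005, 90455002, 40440000]),
    ([4871, 2941, 204, 420, 276, 348],
      [90615004, 90615003, 90615005, 90615002, 40600000]),
    ([4869, 4678, 3036, 420, 276, 3325],
      [50610500, 50610200, 50610300, 70614500, 80614000, 70614200, 70614300, 683, 80453000,
      30450000, 510]),
    ([2845, 253, 181, 264, 276, 4866, 348, 4864, 4887, 3325],
      [10033004, 10030440, 32, 30170000, 25, 50170400, 31, 30090000, 21, 60090000, 337, 10023004,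
      10023005, 318, 60610000, 16, 60210000, 50210200, 622, 70214200, 80214000, 90214004, 136,
      60050000, 40200000, 30050000, 41050000, 90214002, 114, 10024003, 548, 689, 709, 710, 711,
      713, 30610000, 80615000, 712]),
    ([4871, 204, 420, 276, 348, 3325],
      [80615000, 712]),
    ([204, 253, 153, 264, 276, 4866, 348, 4864, 4860, 3325],
      [31, 30090000, 21, 60090000, 10033004, 10030440, 337, 715, 30610000, 80614000, 90614005,
      90614003, 90614004, 40600000, 90614002, 10020420, 137, 548, 30050000, 711, 64, 713, 558]),
    ([193, 169, 5654, 205, 97, 3425, 181],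
      [710, 528]),
    ([253, 264, 276, 3228, 348, 3276, 4887, 3325],
      [708, 10023004, 10023005, 80613000, 80612000, 318, 60610000, 16, 10033004, 409, 10030440,
      714, 716, 10020520, 10025003, 144, 689, 31050000, 116, 717, 534, 560]),
    ([192, 2653, 2892, 153, 264, 3228, 348, 3276, 4887],
      [10020440, 534, 32, 560, 30170000, 60210000, 50210200, 465, 25, 647, 60170000, 10022440,
      622, 90214024]),
    ([264, 276, 3228, 348, 3276, 4887, 3325],
      [80613000, 80612000, 318, 60610000, 16, 708, 10023005, 10023004, 718, 626, 10023003, 704,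
      144, 137, 689, 31050000, 30050000, 116, 64, 719, 717, 447, 715, 558, 30610000, 713,
      80614000, 80455000, 711]),
    ([4679, 3133, 204, 420, 276],
      [80455000, 711]),
    ([204, 420, 276, 4866, 348, 4864, 4860, 3325],
      [105, 30330000, 69, 50330500, 715, 30610000, 80614000, 721, 713, 466, 558, 137, 64,
      30050000]),
    ([276, 3228, 348, 3276, 4887, 3325],
      [80613000, 80612000, 318, 60610000, 16, 720, 10034005, 10034050, 10030550, 722, 10025004,
      10025003, 10025030, 10025005, 10025040, 10020320, 144, 689, 31050000, 717, 116]),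
    ([3709, 265, 3516, 181, 253],
      [143, 31090000, 168, 702, 51290400, 51290200, 51290300, 81294000, 81292000, 366, 674, 530,
      31290000, 91293002, 91293004, 41280000]),
    ([3685, 109, 265, 253],
      [329, 143, 31090000, 168, 702, 496, 699]),
    ([2845, 336, 192],
      [32, 30170000, 25, 50170400, 107, 31170000, 154, 60210000, 50210200, 647, 622, 10022440,
      80214000, 90214024]),
    ([3516, 3901, 181, 253, 277],
      [31, 30090000, 21, 60090000, 700, 81452000, 51450500, 51450200, 51450300, 81455000, 604,
      196, 81453000]),
    ([4481, 180, 168, 2893, 192],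
      [90292002, 90292003, 90292004, 40280000]),
    ([2749, 180, 168, 2701],
      [167, 31050000, 123, 60050000, 50130200, 561, 238, 90132003, 40120000]),
    ([4673, 3126, 3133, 168, 204],
      [80452000, 90452002, 90452005, 40440000]),
    ([3037, 154, 168, 204],
      [466, 657]),
    ([4869, 3036, 2748, 180, 168, 204, 3325],
      [50610500, 50610200, 50610300, 70614500, 80614000, 70614200, 70614300, 510, 80455000,
      80453000, 30450000, 80452000, 90452003, 730]),
    ([3829, 3780, 3804, 205, 421, 133],
      [51390200, 51390100, 51390500, 81391000, 81392000, 182, 606, 31390000, 347, 91395005, 300,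
      41380000]),
    ([336, 4724, 3828, 3780, 205, 421, 133, 277, 349],
      [42, 30330000, 57, 60330000, 646, 659, 201, 51510400, 625, 81515000, 71515400, 414]),
    ([3229, 3180, 3036, 2844],
      [682, 80534000]),
    ([4871, 2748, 168, 180, 2844, 192, 3325],
      [50610200, 50610400, 50610300, 80615000, 70615300, 70615400, 70615200, 80294000, 80293000,
      549, 320, 30290000, 728]),
    ([204, 3238, 3236, 3229, 168, 2844, 154, 192],
      [80535000, 731, 80534000, 735, 468, 469, 30530000, 70530400, 70530500, 40520000]),
    ([3805, 205, 3421, 421],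
      [51370500, 299, 257, 41360000]),
    ([3781, 133, 421],
      [541, 658, 412]),
    ([3229, 2844, 192, 168, 154, 204],
      [50530500, 50530400, 737]),
    ([2748, 4866, 2844, 192, 3036, 168, 180, 204, 4864, 4860, 3325],
      [732, 736, 30610000]),
    ([2749, 168, 180],
      [167, 31050000, 123, 60050000, 561, 729, 80132000]),
    ([192, 168, 180, 154, 204, 3564, 4864, 4860, 3325],
      [742, 731, 465, 740, 741, 80613000]),
    ([3972, 3852, 3828, 421, 133, 205, 4044, 277, 349],
      [563, 739, 631, 649, 331, 645, 101, 352, 624, 81552000, 270]),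
    ([3973, 421, 133, 3948, 349],
      [739, 51510400, 625, 81515000, 71515400, 414]),
    ([3853, 3756, 277],
      [429, 445]),
    ([3829, 133, 3780, 205, 421],
      [733, 550, 738, 41050000]),
    ([3949, 133, 205, 421, 277, 349],
      [739, 747, 42, 30330000, 57, 60490000, 599, 70494000, 734]),
    ([133, 205, 421, 277, 349],
      [42, 30330000, 57, 60330000, 746, 739, 747, 748, 745, 744, 430, 627, 565]),
    ([180, 264, 3325, 276, 252, 4864, 4860],
      [707, 80613000, 640])]

/-- Part 15 of the certificate for 6 alternatives. -/
def cert6_15 : List (List ℕ × List ℕ) := [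
    ([298, 204, 276, 349, 4864, 4860, 3325],
      [10030450, 10045005, 10030504, 10034050, 337, 10023050, 750]),
    ([264, 152, 224, 276, 4864, 4860, 3325],
      [10033004, 10023004, 750]),
    ([120, 337, 299, 152, 224, 4887],
      [10013040, 10010440, 10011004, 10012040, 10015040, 306]),
    ([204, 276, 349, 4864, 4887, 3325],
      [10030450, 318, 10020450, 751, 10040540, 148, 31170000, 157, 51170400, 752, 753, 601,
      10020540, 10022004, 743, 10023040]),
    ([265, 205, 276, 349, 4887, 5654],
      [331, 10025003, 10030450, 10034050, 10034004, 10020340, 601, 10013040, 10010440, 10011004,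
      10015040, 753, 306, 10020430, 10020420, 687]),
    ([3084, 264, 276, 3277],
      [554, 10030450, 10033004, 33, 30090000, 18, 704, 50570500, 80574000, 652, 234, 360]),
    ([264, 276, 3277],
      [554, 10030450, 10033004, 33, 30090000, 18, 50090300, 756, 636, 80413000, 635]),
    ([349, 252, 265, 276, 4887, 3325],
      [10030430, 307, 10034050, 60610000, 16, 755, 10020450, 754, 753, 601, 10023040, 10022004,
      319]),
    ([4627, 348, 252, 276, 3277],
      [405, 80573000, 50570300, 50570500, 50570400, 326, 635, 57, 80413000, 30330000, 80574000,
      42, 234, 30570000, 90575004, 90575005, 90575003, 40560000]),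
    ([252, 276, 3277, 4887, 3325],
      [757, 10034050, 50570300, 50570500, 50570400, 326, 33, 30090000, 18, 50090300, 758, 405,
      80573000, 759, 10040550, 636, 80574000, 234, 30570000, 90575004, 90575005, 90575003,
      40560000]),
    ([4820, 348, 420, 276, 3277],
      [405, 80573000, 50570300, 50570500, 50570400, 326, 234, 30570000, 90575004, 90575005,
      90575003, 40560000]),
    ([4821, 3475, 2701, 420, 276, 3277],
      [105, 30330000, 69, 50330500, 126, 31330000, 150, 50570500, 50570300, 80574000, 70574500,
      70574300, 60410000, 634, 488, 71413000, 51413500, 279, 90415035, 80413000, 30410000]),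
    ([276, 3277, 4887, 3325],
      [60610000, 16, 757, 10034050, 760, 31, 143, 337, 30090000, 31090000, 21, 168, 762, 761,
      10030450, 755, 10040540, 10020450, 754, 753, 601, 10023040, 10022004, 319]),
    ([180, 168, 3325, 154, 204, 3564, 192, 4860],
      [743, 319]),
    ([192, 2748, 3036, 168, 154, 180, 204, 4860, 3325],
      [167, 31050000, 123, 764, 319, 302, 60210000, 740, 741, 80613000]),
    ([2917, 2820, 120, 108, 84],
      [483, 531, 476, 475]),
    ([2941, 2844, 2748, 168, 180, 192],
      [50290400, 50290200, 50290300, 80294000, 80293000, 549, 320, 728, 30290000]),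
    ([3061, 3012, 2676, 84, 96, 132],
      [50390100, 50390500, 50390200, 80392000, 666, 80395000, 80391000, 30390000, 70390200,
      70390500, 70390100, 40380000]),
    ([2845, 3421, 192],
      [60210000, 465, 302]),
    ([4861, 3325],
      [50610500, 50610200, 50610400, 50610300, 70610200, 70610300, 70610400, 70610500, 40600000]),
    ([276, 180, 264, 252, 3325],
      [770, 757, 750, 80612000]),
    ([348, 4870, 336, 264, 192, 3325],
      [770, 554, 703, 80612000, 80613000, 30610000, 80614000, 90614005, 90614003, 90614002,
      90614004, 40600000]),
    ([3109, 3012, 84, 108, 132],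
      [483, 80435000, 356, 80431000, 90431001, 90431003, 90431005, 40420000]),
    ([108, 265, 133, 277, 205],
      [10010430, 10015030, 10015004, 10035005, 749]),
    ([3085, 276, 253],
      [337, 105, 30330000, 69, 50330500, 126, 31330000, 150, 143, 31090000, 168, 31, 30090000, 21,
       50410500, 50410300, 60410000, 80413000, 634, 488, 71413000, 30410000, 51413500, 90415035,
      279]),
    ([4407, 2845, 120, 84, 96],
      [90231001, 90231004, 90231002, 40220000]),
    ([2869, 2820, 120, 84, 96],
      [668, 50230400, 448, 80232000, 80234000, 776, 30230000, 70230400, 451]),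
    ([3013, 132, 84],
      [66, 31030000, 121, 131, 30030000, 45, 60350000, 378, 377, 379]),
    ([2820, 120, 108, 132, 96, 84, 4886],
      [668, 778, 768, 773, 670, 145, 669, 766, 777, 380, 660, 662, 139, 272, 99, 119, 132, 156,
      671, 434, 80313000, 80312000, 30310000, 80311000, 90311004, 90311003, 90311002, 90311001,
      40300000]),
    ([120, 108, 4886, 132, 96, 84],
      [779, 449, 474, 40170000]),
    ([121, 82, 80, 265, 193],
      [10014004, 10014005, 601]),
    ([181, 79, 252, 193, 205, 5654],
      [626, 10010320, 144, 717, 31050000, 116]),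
    ([265, 226, 79, 252, 193],
      [307, 10010340, 10034005, 601]),
    ([79, 252, 193, 205, 3325],
      [60610000, 16, 782, 10025030, 10024030, 783, 771, 10035005, 10010350, 10035004, 749]),
    ([264, 3036, 276, 420, 227, 204, 3325],
      [770, 50610200, 10030540, 757, 405, 80612000, 722, 80613000, 70613200, 735, 80534000,
      80532000, 691, 692, 70530200, 90535002, 30530000]),
    ([3229, 2845, 348, 169, 204],
      [405, 447, 137, 30050000, 64, 558, 50530200, 80534000, 80532000, 691, 692, 70530200,
      90535002, 30530000]),
    ([3277, 348, 3084, 276, 420],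
      [761, 80574000]),
    ([348, 3084, 276, 169, 204, 3325],
      [447, 137, 30050000, 64, 558, 770, 405, 787, 80612000, 722, 80613000, 735, 786]),
    ([120, 132, 152, 108, 84, 4886],
      [10012040, 780]),
    ([264, 180, 299, 252, 3325],
      [771, 10035040]),
    ([120, 152, 299, 108, 84, 4886],
      [10015040, 789]),
    ([265, 348, 192, 252, 204, 3325],
      [703, 80613000, 770, 307, 10030430, 10020340, 349, 10023040, 10035004, 10022003, 722, 319]),
    ([337, 264, 348, 192, 3325],
      [554, 80612000, 770, 10030440, 10020440, 10035004, 752]),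
    ([348, 192, 3325, 252, 204],
      [792, 704, 793, 726, 772, 560, 80615000]),
    ([192, 252, 204, 3325],
      [770, 794, 10020450, 10020540, 10022004, 731, 626, 765, 680]),
    ([265, 337, 349, 79, 193],
      [601, 10010340]),
    ([349, 79, 252, 204, 3325],
      [795, 10024050, 10020450, 10040540, 796, 10023004, 790]),
    ([276, 348, 252, 204, 3325],
      [795, 10024050, 10040550, 126, 31330000, 150, 770, 506, 60410000, 788, 787, 693, 80612000,
      80613000, 722]),
    ([276, 348, 253, 204, 3325],
      [770, 337, 775, 788, 787, 693, 80612000, 80613000, 722]),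
    ([192, 3564, 224, 349, 204, 3325],
      [10020450, 770, 10020540, 10022004, 764, 10023040])]

/-- Part 16 of the certificate for 6 alternatives. -/
def cert6_16 : List (List ℕ × List ℕ) := [
    ([193, 299, 265, 224, 152, 349, 4886],
      [10034004, 601, 796, 10013040, 10011003, 791]),
    ([120, 299, 265, 224, 152, 4886],
      [10010340, 10013040, 10011003, 791]),
    ([4891, 3060, 2868, 96, 3228, 168, 192, 204],
      [159, 294, 376, 80555000, 80554000, 80551000, 30550000, 90552001, 90552004, 90552002,
      90552005, 40540000]),
    ([252, 4668, 3133, 180, 168, 276, 204],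
      [742, 80455000, 688, 511, 30450000, 90452003, 730]),
    ([96, 3228, 3036, 2844, 180, 168, 192, 276, 204, 4886],
      [742, 767, 444, 314, 485, 438, 574, 486, 803, 272, 134, 145, 160, 170, 472, 436, 80475000,
      80473000, 30470000, 80471000, 70471200, 70471500, 70471300, 80455000, 510, 804, 80453000,
      30450000, 775, 80452000]),
    ([3637, 85, 97, 3588, 121],
      [569, 499, 567]),
    ([265, 276, 5030, 204, 349, 4886],
      [10030450, 10020450, 10034004, 590, 10034050, 148, 599, 31170000, 594, 157, 51170400, 801,
      10020540, 10022004, 10023040, 10020340, 465, 731, 740, 802, 10014002, 591, 596, 578, 584,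
      805, 10010210, 569, 10012030, 10012050, 140, 502, 394, 30030000, 34, 60030000, 310, 541,
      492, 398, 806, 501, 497, 519, 40, 573, 186]),
    ([3925, 97, 3876, 133, 85, 109],
      [569, 502, 140, 30030000, 34, 60030000, 541, 398, 573, 186]),
    ([3684, 5656, 5660, 97, 133, 121, 85, 109],
      [569, 502, 140, 30030000, 34, 60030000, 541, 398, 394, 386, 806, 501, 519, 497]),
    ([3685, 3492, 121, 85, 109],
      [386, 231, 496, 81274000, 81273000, 31270000, 91271001, 91271004, 91271003, 41260000]),
    ([3949, 349],
      [599, 107, 87, 31170000, 566, 154]),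
    ([336, 3876, 133, 85, 109, 180, 276, 204, 349, 4886],
      [10030450, 10013040, 811, 568, 386, 10020450, 107, 10024004, 726, 31170000, 10020540,
      10022004, 740, 154, 731, 805, 71191000, 571]),
    ([97, 5656, 3684, 3876, 133, 121, 85, 109],
      [808, 809, 40]),
    ([109, 276, 5030, 204, 349, 4886],
      [10020450, 807, 10023004, 10030540, 10030450, 10033004, 811, 286, 10013040, 10013002,
      10013004, 10013050, 140, 30030000, 34, 60030000, 310, 541, 492, 810, 568, 812, 148,
      31170000, 157, 51170400, 813, 10010220, 10010420, 10015020, 465, 731, 740, 805]),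
    ([192, 3564, 154, 168, 96, 180, 276, 204, 4886],
      [731, 465, 740, 805]),
    ([3085, 252, 276],
      [33, 30090000, 18, 50090300, 636, 635, 80413000]),
    ([2941, 180, 252, 264],
      [680, 704, 50290400, 50290200, 50290300, 549, 80294000, 80292000, 320, 705, 30290000]),
    ([4843, 3301, 108, 252, 264, 276],
      [80593000, 651]),
    ([4889, 108, 252, 264, 276],
      [816, 505, 483, 757, 704, 125, 139, 221, 80591000, 80594000, 818, 30590000, 80595000, 656,
      531, 419]),
    ([276, 5030, 204, 349, 4886],
      [10020450, 10030450, 807, 10033004, 704, 10023004, 680, 814, 421, 654, 816, 688, 505, 817,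
      655, 819, 639, 272, 145]),
    ([96, 3228, 3036, 168, 192, 180, 204, 4886],
      [742, 167, 31050000, 123, 769, 767, 314, 444, 438, 485, 574, 803, 486, 272, 134, 145, 160,
      170, 472, 436, 80475000, 80473000, 30470000, 80471000, 70471200, 70471500, 70471300,
      80455000, 80453000, 510, 30450000, 80452000, 90452003, 730]),
    ([264, 277, 204, 349, 4886],
      [10020350, 10020450, 811, 10030540, 10023004, 10024003, 10035005, 10020503, 10022003, 42,
      731, 167, 30330000, 31050000, 57, 123, 60330000, 769, 746, 740, 821, 10012005, 10012030,
      10012050, 10012040, 572, 739, 631, 568, 140, 813, 30030000, 810, 34, 495, 60030000]),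
    ([193, 180, 265, 204, 349, 4886],
      [10020450, 10024050, 10024030, 801]),
    ([192, 168, 3229, 204, 154],
      [740, 167, 769, 31050000, 123]),
    ([192, 3229, 204, 349],
      [10020450, 10020540, 10022004, 824]),
    ([3517, 3421, 253, 181],
      [31, 30090000, 21, 60090000, 51130200, 51130300, 81132000, 208, 197, 31130000, 41120000,
      91133003]),
    ([277, 96, 180, 204, 349, 4886],
      [10020350, 822, 10020530, 10022003, 823, 731, 824, 821]),
    ([108, 252, 276, 264, 180, 4886],
      [816, 688, 817, 704, 680, 654, 819, 421, 655, 505, 272, 639, 145]),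
    ([277, 108, 264, 181, 205, 349, 4886],
      [10010230, 10030540, 331, 10035040, 10035005, 10010530, 749, 10011005, 10010450, 10014050,
      780, 10012002, 10012050, 10012004, 615, 687, 16, 426, 628, 81613000, 522, 564, 81614000,
      91612050, 31610000]),
    ([108, 264, 181, 205, 349, 4886],
      [10030540, 331, 829, 10025003, 10030450, 10033005, 10020320, 10023040, 144, 528, 615,
      31050000, 116, 51050200, 603, 514, 522, 16, 782, 687, 10011003, 10015003, 10014003, 780]),
    ([276, 109, 226, 181, 205, 349],
      [10013050, 10025003, 10030450, 10033005, 10015003, 10013020, 10023040, 10013040, 286, 782,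
      394]),
    ([264, 181, 205, 349, 4886],
      [10030540, 830, 10013050, 831, 10035005, 749]),
    ([109, 226, 181, 205, 349],
      [10013050, 831, 10035005, 749]),
    ([121, 82, 80, 76, 265],
      [781, 10014002]),
    ([277, 226, 181, 205, 349, 4886],
      [832, 833, 10010430, 10010230, 331, 10035005, 10010530, 774, 42, 10011005, 30330000, 57,
      60330000, 746, 563, 834, 780, 10012002, 10012050, 10012004, 687, 16, 426, 628, 81613000,
      522, 564, 81614000, 91612050, 31610000]),
    ([226, 181, 205, 349, 4886],
      [832, 331, 833, 835, 10025003, 10030450, 10033005, 10020340, 10020320, 10034004, 678, 783,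
      615, 601, 522, 10011003, 10015003, 780, 16, 687]),
    ([3517, 253, 181],
      [603, 826]),
    ([5655, 277, 253, 265, 181],
      [837, 724, 727, 143, 31090000, 168, 702, 701, 16, 426, 81612000, 676, 81614000, 81615000,
      31610000]),
    ([253, 225, 298, 192, 264, 153, 348],
      [10020440, 32, 30170000, 25, 726, 703, 554, 409, 560, 540, 10014050, 10014004, 10010410,
      10014030, 10014020, 140, 386, 329, 30030000, 810, 34, 60030000, 541, 492, 813, 113, 7, 19,
      50, 568, 504, 81593000, 71593400, 71593100, 71593500, 81514000, 81515000, 355, 31510000,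
      91511001, 91511004, 91511005, 41500000]),
    ([192, 264, 181, 205, 348],
      [554, 10025004, 10025040, 703, 10023040, 10020440, 32, 107, 726, 30170000, 31170000, 25,
      154, 839, 704, 626, 560, 540, 10014050, 10014004, 10010410, 10014030, 10014020, 140, 386,
      617, 613, 616, 30030000, 806, 40, 34, 544, 60030000, 113, 7, 19, 50, 568, 541, 504,
      81593000, 71593400, 71593100, 71593500, 81514000, 81515000, 355, 31510000, 91511001,
      91511004, 91511005, 41500000]),
    ([121, 97, 85, 109, 133],
      [140, 30030000, 34, 60030000, 495, 541, 492, 808, 40, 386, 810, 809, 113, 7, 19, 50, 568,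
      504, 81593000, 71593400, 71593100, 71593500, 81514000, 81515000, 355, 31510000, 91511001,
      91511004, 91511005, 41500000]),
    ([120, 336, 192, 264, 348],
      [32, 30170000, 25, 726, 623, 449]),
    ([3061, 4606, 3036, 3012],
      [50390100, 50390500, 50390200, 80391000, 80392000, 30390000, 70390200, 70390500, 70390100,
      40380000]),
    ([3061, 3036, 3012, 420, 132, 204],
      [843, 80395000, 90395001, 90395002, 90395005, 40380000]),
    ([3037, 420, 204],
      [105, 30330000, 69, 50370500, 558, 422, 80375000, 315, 40360000]),
    ([3011, 3013, 2629, 420],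
      [105, 30330000, 69, 50330500, 80351000, 50350500, 70350500, 90355005, 30350000]),
    ([3013, 2629, 420, 132],
      [105, 30330000, 69, 50330500, 846, 40340000, 90355001, 555]),
    ([4751, 2821, 420, 132, 348],
      [90515004, 90515005, 90515001, 40500000]),
    ([3109, 3084, 3012, 276, 420, 132],
      [223, 80431000, 80433000, 30430000, 80435000, 90435003, 90435005, 90435001, 40420000]),
    ([3205, 4750, 3012, 3180],
      [50510400, 50510100, 50510500, 80514000, 80511000, 205, 30510000])]

/-- Part 17 of the certificate for 6 alternatives. -/
def cert6_17 : List (List ℕ × List ℕ) := [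
    ([3205, 3012, 420, 132, 348],
      [405, 308, 850, 848]),
    ([3133, 276, 420, 204],
      [845, 50450500, 50450300, 50450200, 721, 80453000, 683, 510, 30450000]),
    ([3085, 276],
      [775, 816]),
    ([3013, 420, 132],
      [105, 30330000, 69, 50330500, 80351000, 847, 378, 40030000]),
    ([277, 180, 421, 133, 349, 192, 264],
      [10020540, 749, 447, 731, 822, 742, 141, 318, 765]),
    ([180, 421, 133, 349, 192, 264, 108],
      [10030540, 855, 10033005, 771, 828, 141]),
    ([81, 96, 120, 108],
      [10010430, 10010440, 10010420, 842, 10010450, 10030540, 87, 10020540, 856, 10023050,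
      10023005, 749]),
    ([132, 96, 108, 84, 120],
      [780, 306]),
    ([181, 421, 349, 133, 96, 108],
      [10010230, 10010320, 10015002, 10015003, 749]),
    ([264, 180, 421, 298, 349, 133, 108],
      [856, 10024050, 10024030, 749, 10033004, 771, 828, 141]),
    ([96, 120, 108],
      [857, 10011004, 858, 10015004, 10015040, 10015020, 679, 859, 860, 10034050, 774, 447, 731,
      827, 10024050, 742, 141, 318, 765]),
    ([80, 84, 298, 133, 97, 108],
      [10010210, 10015002, 679, 10015030, 10012004, 10015004, 749, 10015003, 10033005, 10034050,
      784, 860, 141, 836]),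
    ([349, 155, 252, 79, 181, 205, 226],
      [836, 10020540, 141, 784]),
    ([276, 181, 336, 264, 169, 205, 421, 226, 133, 97],
      [144, 31050000, 116, 51050200, 603, 615, 107, 31170000, 154, 550, 10015003, 10033005,
      10023005, 104, 31090000, 106, 309, 863, 840, 528, 525, 717, 367, 368]),
    ([181, 336, 264, 169, 205, 421, 226, 133, 97],
      [144, 31050000, 116, 550, 51050200, 615, 603, 864, 749, 840, 528, 525, 717, 514, 16, 522]),
    ([84, 133, 120, 108],
      [10015040, 10015030, 861, 10012030, 10010210, 679, 10015002, 10012002, 862, 10010430,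
      10010440, 865, 10012003, 860, 10020330, 842, 10024005, 784, 10020530, 141, 828]),
    ([276, 180, 264, 252, 108],
      [771, 828, 141]),
    ([180, 133, 120, 108],
      [866, 10011004, 10010440, 10011003, 10010340, 641, 10015030, 861, 10012030, 867, 10020350,
      10035005, 10020530, 749, 10024005, 842]),
    ([133, 120, 108],
      [861, 10012030, 483, 10015030, 10015040, 866, 10011003, 10011004, 644, 10010340, 10010440,
      309, 868, 10020320, 10023050, 615, 144, 865, 31050000, 10045005, 116, 840, 51050200, 550,
      528, 525, 717, 367, 603, 16, 530, 522]),
    ([205, 348, 264, 169, 181, 97],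
      [144, 31050000, 116, 51050200, 603, 615, 550, 840, 528, 525, 717, 514, 16, 522]),
    ([4799, 2869, 420, 204, 348, 132],
      [90555002, 90555005, 90555004, 90555001, 40540000]),
    ([4891, 3228, 3060, 420, 204, 348, 132],
      [854, 851, 159, 294, 376, 80552000, 80554000, 871, 80551000, 30550000]),
    ([4893, 3060, 276, 420, 204, 132],
      [853, 854, 849, 852, 145, 472, 556, 80471000, 80473000, 80472000, 30470000]),
    ([3229, 204, 348, 169],
      [137, 30050000, 64, 447, 558, 405, 786, 735]),
    ([336, 84, 2892, 3301, 3306, 3012, 348, 264, 132, 120, 2724],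
      [406, 32, 30170000, 25, 449, 400, 418]),
    ([348, 264, 181, 120, 108],
      [861, 10012030, 10020320, 137, 30050000, 64, 869, 483, 870, 10023050, 447, 10020350, 558,
      854, 198, 785, 844, 141, 873, 874, 872, 272, 125, 139, 819, 10033004, 409, 641, 875,
      10030440]),
    ([264, 181, 120, 108],
      [861, 10012030, 10020320, 869, 10012050, 10012040, 876, 10030540, 10020450, 331, 836,
      10020540, 687, 141, 16, 60610000]),
    ([349, 193, 169, 181, 153, 97],
      [144, 31050000, 116, 51050200, 603, 528, 514, 10020450, 331, 615, 717, 522, 16]),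
    ([205, 193, 169, 181, 97],
      [144, 31050000, 116, 51050200, 603, 528, 514, 615, 550, 717, 525, 16, 522]),
    ([181, 120, 108],
      [869, 861, 10012040, 10012030, 10020320, 137, 30050000, 64, 877, 10010340, 10020340,
      10011003, 778, 773, 878, 879, 447, 10020350, 558, 874, 198, 851, 853, 844, 872, 787, 788,
      873, 141, 272, 139, 221, 80591000, 80594000, 80593000, 642, 30590000, 90595004, 90595001,
      90595003, 90595005, 40580000]),
    ([120, 108],
      [861, 10012030, 10012040, 869, 10012050, 880, 10020430, 10020330, 867, 10020530]),
    ([180, 264, 108],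
      [881, 10014030, 10033004, 10014003, 867, 10010350, 10010530, 10035040, 10035004, 10015005,
      860]),
    ([264, 108],
      [881, 10014030, 10014003, 10033004, 882, 10010230, 10010320, 10023004, 626, 10023040, 878,
      879, 10035004, 10015002, 447, 874, 798, 819, 845, 854, 198, 141, 844, 873, 872, 272]),
    ([3301, 420, 132, 276, 348],
      [854, 853, 849, 787, 851, 221, 80591000, 80594000, 80593000, 642, 30590000, 90595004,
      90595001, 90595003, 90595005, 40580000]),
    ([204, 169, 252, 420, 132, 276, 348],
      [884, 139, 854, 874, 798, 845, 198, 141, 844, 873, 872, 272]),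
    ([252, 420, 132, 276, 348, 83, 193, 181],
      [626, 885, 10010520, 879]),
    ([97, 420, 132, 276, 348, 193, 76, 181],
      [884, 139, 854, 853, 10012002, 879, 874, 845, 198, 788, 844, 141, 873, 872, 272]),
    ([181, 108],
      [881, 10014030, 883, 10034004, 10010430, 10010230, 10023040, 834, 601, 10010530, 405,
      10015004, 349, 854, 884, 139, 886, 641, 887, 10010520, 668, 845, 198, 799, 768, 141, 873,
      272, 872, 693, 786, 735]),
    ([169, 204, 420, 348, 276, 132, 180],
      [885, 372]),
    ([348, 276, 132, 108],
      [853, 883, 888, 10020430, 881, 10014030, 10034004, 349, 10025004, 854, 884, 787, 845, 198,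
      139, 844, 873, 889, 693, 872, 272, 141, 723]),
    ([276, 132, 108],
      [881, 10014050, 883, 888, 10020430, 10014030, 10034004, 148, 31170000, 157, 51170400,
      10010430, 890, 601, 10020540, 10022004, 10012004, 10025040, 800, 815, 141]),
    ([132, 108],
      [888, 881, 10014030, 883, 10034004, 148, 31170000, 157, 51170400, 10010430, 891, 10010350,
      10010530, 10035004, 10012003, 834, 781, 10010250, 800, 827, 141]),
    ([277, 108],
      [883, 10010430, 881, 10014030, 10034004, 892, 10015004, 601, 10012004, 888, 148, 31170000,
      157, 51170400, 774, 827, 800, 141]),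
    ([121, 108],
      [10014030, 883, 10010430, 10034004, 148, 31170000, 157, 51170400, 888, 10020430, 892,
      10015030, 10015004, 601, 10020340, 10020540, 10022004, 10012004, 893, 10015003, 10033005,
      10025003, 815, 797, 141]),
    ([108],
      [881, 894]),
    ([4887, 3325, 204, 276, 349],
      [754, 763, 80612000]),
    ([4887, 204, 349, 276],
      [141, 896]),
    ([349, 276, 133],
      [895, 10015003, 10010310, 140, 30030000, 34, 60030000, 495, 541, 492, 10013005, 10010540,
      10030450, 841, 10010320, 10015020, 10010520, 648, 897, 812, 820, 148, 71111000, 31170000,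
      106, 157, 31090000, 51170400, 104, 815, 10033004, 823]),
    ([96, 4886, 204, 276, 133],
      [895, 898, 10015004, 10015003, 10010310, 10010320, 10015020, 648, 10010420, 731, 693, 821]),
    ([120, 77, 81, 348, 79],
      [10010340, 10010440, 10010240, 842])]

/-- Part 18 of the certificate for 6 alternatives. -/
def cert6_18 : List (List ℕ × List ℕ) := [
    ([3325, 204, 276, 348],
      [798, 799]),
    ([204, 276, 133],
      [895, 898, 10015004, 10015003, 10010310, 10015002, 900, 841, 899, 141, 901]),
    ([276, 133],
      [895, 10015003, 10013005, 10010310, 898, 10015004, 902, 10010520, 841, 10010340, 10010440,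
      900, 842, 10013002, 10012002, 879]),
    ([79, 97, 205, 348, 133],
      [895, 10015004, 10010310, 841, 10010340, 10010440, 900, 842, 10013002, 10012002, 879]),
    ([265, 3876, 3540, 181, 253, 277],
      [895, 31, 30090000, 21, 60090000, 700, 143, 31090000, 168, 837, 727, 702, 725, 838, 701,
      724, 696, 7, 93, 81595000, 81594000, 697, 81591000, 31590000]),
    ([85, 97, 205, 348, 133],
      [895, 904, 10013003, 329, 10012003, 10025004, 10015004, 903, 10035004, 140, 841, 569,
      30030000, 10015040, 10010440, 502, 34, 60030000, 541, 492, 905, 839, 870, 397]),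
    ([97, 205, 348, 133],
      [895, 903, 904, 10013003, 10012003, 31, 30090000, 21, 60090000, 700, 906, 10010210, 679,
      10012002, 739, 613, 870, 631, 905]),
    ([205, 348, 133],
      [895, 10015004, 903, 10025004, 907, 10015020, 10010420, 10014020, 10025005, 10020440, 842,
      42, 739, 307, 10020430, 30330000, 329, 837, 57, 60330000, 746, 631, 905, 51150300, 51150200,
       51150100, 81152000, 81151000, 371, 189, 31150000, 91153003, 91153001, 91153002, 41140000]),
    ([3541, 181, 253],
      [895, 837, 329, 51150300, 51150200, 51150100, 81152000, 81151000, 371, 189, 31150000,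
      91153003, 91153001, 91153002, 41140000]),
    ([3877, 253, 277],
      [895, 31, 30090000, 21, 60090000, 700, 329, 51430500, 51430300, 51430100, 387, 81431000,
      81435000, 673]),
    ([181, 253, 265, 277],
      [910, 909, 905]),
    ([180, 3228, 168, 192, 154, 96, 204],
      [731, 821, 742, 141, 318, 765]),
    ([96, 348, 133],
      [903, 908, 10020350, 10015002, 10015004, 10035004, 10015020, 10010420, 10010220, 703, 912,
      10010320, 10023003, 911, 10014003, 10030440, 842]),
    ([348, 133],
      [895, 903, 10015004, 908, 10015002, 913, 10010210, 841, 10010440, 900, 10010240, 842,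
      10013003, 10012003, 911]),
    ([181, 265, 133],
      [895, 914, 903, 911, 307, 10030430, 10013003, 796, 10023040]),
    ([252, 265, 133],
      [895, 903, 915, 10020530, 10020430, 914, 307, 10030430, 10013003, 286, 10030530, 796,
      10013040, 10035005, 10022004, 841, 749, 912, 825]),
    ([204, 96, 192, 168, 154, 180, 349],
      [825, 912]),
    ([205, 154, 133],
      [914, 903, 749, 10025005]),
    ([97, 265, 133],
      [895, 915, 10020430, 10013002, 10010210, 10012040, 841]),
    ([265, 133],
      [895, 914, 903, 915, 10013002, 10020430, 10020530, 916, 372, 918, 919, 917, 10010240,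
      10024004, 601]),
    ([133],
      [903, 914, 920, 10030540, 10035040, 10035005, 749, 10023050, 10024050, 855]),
    ([226],
      [921, 895, 10013050]),
    ([192, 349, 180],
      [921, 922, 10025030, 10020450, 10010450, 10020540, 10022004, 917, 10012004]),
    ([349, 180],
      [895, 922, 10025030, 10013002, 10030540, 10020450, 923, 10010240, 10024004, 601]),
    ([193, 180],
      [922, 921, 924, 10025030, 10024030, 10024005, 10035004, 10020550, 901, 854, 884, 198, 845,
      889, 141, 844, 139, 693, 873, 872, 272]),
    ([155, 180],
      [922, 921, 924, 925, 703, 10025030, 10020530, 10020550, 901, 854, 884, 198, 845, 141, 844,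
      139, 873, 872, 272]),
    ([180],
      [922, 921, 10025030, 924, 925, 703, 926, 10012050, 10022005, 912]),
    ([154, 348],
      [927, 922, 921, 10024005, 10012050, 10023005, 10023040, 10010320, 10030530, 911, 10014003,
      842, 10030440]),
    ([277, 204, 348],
      [921, 922, 927, 10010350, 10030530, 10020350, 10035004, 911, 10024003, 10014003, 842,
      10030440]),
    ([204, 348],
      [921, 928, 405, 10020550, 854, 845, 844, 929, 901, 884, 198, 873, 141, 139, 272, 872, 693,
      786, 735]),
    ([276, 348],
      [895, 927, 930, 928, 10020520, 10013005, 10025003, 10010520, 879, 870, 10020340]),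
    ([348],
      [922, 895, 927, 928, 930, 10020520, 931, 10030530, 911, 10013004, 840, 870, 10010420]),
    ([264],
      [932, 922, 10030540]),
    ([277],
      [922, 933, 927, 10030530, 911]),
    ([82],
      [934, 895, 10013005]),
    ([421],
      [934, 922, 10030550]),
    ([225],
      [934, 932, 10030450]),
    ([120],
      [935, 932, 10010540]),
    ([336],
      [936, 932, 87]),
    ([192],
      [937, 927, 10023040]),
    ([],
      [940, 939, 933, 938, 932, 601])]

/-- The certificate for 6 alternatives. -/
def cert6 : List (List ℕ × List ℕ) :=
    cert6_0 ++
    (cert6_1 ++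
    (cert6_2 ++
    (cert6_3 ++
    (cert6_4 ++
    (cert6_5 ++
    (cert6_6 ++
    (cert6_7 ++
    (cert6_8 ++
    (cert6_9 ++
    (cert6_10 ++
    (cert6_11 ++
    (cert6_12 ++
    (cert6_13 ++
    (cert6_14 ++
    (cert6_15 ++
    (cert6_16 ++
    (cert6_17 ++
    (cert6_18))))))))))))))))))

theorem run6 : run 6 cert6 .nil 1 = true := by decide +kernel

end SSVCert

/-! ## Basic facts on SSV winners -/

section SSVFacts

variable {X : Type} [DecidableEq X]

theorem isLinearOMM_mono {V S : Finset X} {succ : X × X → X × X → Prop}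
    (h : IsLinearOMM V succ) (hS : S ⊆ V) (hne : S.Nonempty) : IsLinearOMM S succ := by
  obtain ⟨⟨-, h1, h2, h3⟩, h4⟩ := h
  refine ⟨⟨hne, ?_, ?_, ?_⟩, ?_⟩
  · exact fun p q a b c d => h1 p q (hS a) (hS b) (hS c) (hS d)
  · exact fun p q r a b c d e f => h2 p q r (hS a) (hS b) (hS c) (hS d) (hS e) (hS f)
  · exact fun p q r s a b c d => h3 p q r s (hS a) (hS b) (hS c) (hS d)
  · exact fun p q r s a b c d => h4 p q r s (hS a) (hS b) (hS c) (hS d)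

theorem isLinearOMM_rev {V : Finset X} {succ : X × X → X × X → Prop}
    (h : IsLinearOMM V succ) :
    IsLinearOMM V (fun p q => succ (p.2, p.1) (q.2, q.1)) := by
  obtain ⟨⟨h0, h1, h2, h3⟩, h4⟩ := h
  refine ⟨⟨h0, ?_, ?_, ?_⟩, ?_⟩
  · exact fun p q a b c d => h1 _ _ b a d c
  · exact fun p q r a b c d e f => h2 _ _ _ b a d c f e
  · exact fun p q r s a b c d => h3 _ _ _ _ b a d c
  · intro p q r s a b c d hpq hrs hne
    refine h4 _ _ _ _ b a d c hpq.symm hrs.symm ?_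
    intro hh
    apply hne
    rw [Prod.mk.injEq] at hh ⊢
    exact ⟨hh.2, hh.1⟩

theorem linear_trans {V : Finset X} {succ : X × X → X × X → Prop} (h : IsLinearOMM V succ)
    {a b c d e f : X} (ha : a ∈ V) (hb : b ∈ V) (hc : c ∈ V) (hd : d ∈ V) (he : e ∈ V)
    (hf : f ∈ V) (hab : a ≠ b) (hef : e ≠ f) (hne : (a, b) ≠ (e, f))
    (h1 : succ (a, b) (c, d)) (h2 : succ (c, d) (e, f)) : succ (a, b) (e, f) := by
  obtain ⟨⟨-, as, nt, -⟩, con⟩ := h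
  rcases con a b e f ha hb he hf hab hef hne with h3 | h3
  · exact h3
  · exact absurd h3 (nt (e, f) (c, d) (a, b) he hf hc hd ha hb
      (as _ _ hc hd he hf h2) (as _ _ ha hb hc hd h1))

/-- A finite nonempty set of pairs of distinct alternatives has a maximum. -/
theorem linear_max {V : Finset X} {succ : X × X → X × X → Prop} (h : IsLinearOMM V succ)
    (A : Finset (X × X)) (hne : A.Nonempty)
    (hA : ∀ p ∈ A, p.1 ∈ V ∧ p.2 ∈ V ∧ p.1 ≠ p.2) :
    ∃ p ∈ A, ∀ q ∈ A, q ≠ p → succ p q := by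
  induction hne using Finset.Nonempty.cons_induction with
  | singleton a => exact ⟨a, by simp, fun q hq hqa => absurd (Finset.mem_singleton.1 hq) hqa⟩
  | cons a s ha hs ih =>
    obtain ⟨p, hp, hmax⟩ := ih fun p hp => hA p (Finset.mem_cons_of_mem hp)
    obtain ⟨ha1, ha2, ha3⟩ := hA a (Finset.mem_cons_self a s)
    obtain ⟨hp1, hp2, hp3⟩ := hA p (Finset.mem_cons_of_mem hp)
    have hap : a ≠ p := fun e => ha (e ▸ hp)
    rcases h.2 a.1 a.2 p.1 p.2 ha1 ha2 hp1 hp2 ha3 hp3 hap with h1 | h1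
    · refine ⟨a, Finset.mem_cons_self a s, fun q hq hqa => ?_⟩
      rcases Finset.mem_cons.1 hq with rfl | hq
      · exact absurd rfl hqa
      · obtain ⟨hq1, hq2, hq3⟩ := hA q (Finset.mem_cons_of_mem hq)
        by_cases hqp : q = p
        · rw [hqp]; exact h1
        · exact linear_trans h ha1 ha2 hp1 hp2 hq1 hq2 ha3 hq3 (fun e => hqa e.symm) h1
            (hmax q hq hqp)
    · refine ⟨p, Finset.mem_cons_of_mem hp, fun q hq hqp => ?_⟩
      rcases Finset.mem_cons.1 hq with rfl | hq
      · exact h1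
      · exact hmax q hq hqp

/-- The maximality condition in the definition of SSV. -/
def SSVmax (succ : X × X → X × X → Prop) (S : Finset X) (a b : X) : Prop :=
  b ∈ S ∧ a ∈ S.erase b ∧ SSVwin (S.erase b) succ a ∧
    ∀ c d : X, d ∈ S → c ∈ S.erase d → (c, d) ≠ (a, b) →
      SSVwin (S.erase d) succ c → succ (a, b) (c, d)

theorem ssvwin_iff (succ : X × X → X × X → Prop) (S : Finset X) (hS : 2 ≤ S.card) (a : X) :
    SSVwin S succ a ↔ ∃ b, SSVmax succ S a b := by
  obtain ⟨k, hk⟩ : ∃ k, S.card = k + 1 := ⟨S.card - 1, by omega⟩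
  have hcard : ∀ d ∈ S, (S.erase d).card = k := fun d hd => by
    rw [Finset.card_erase_of_mem hd, hk]; rfl
  unfold SSVwin SSVmax
  rw [hk]
  constructor
  · rintro (h | ⟨-, b, hb, hab, hw, hm⟩)
    · rw [h, Finset.card_singleton] at hS; omega
    · refine ⟨b, hb, hab, ?_, ?_⟩
      · unfold SSVwin; rw [hcard b hb]; exact hw
      · intro c d hd hc hne hw'
        unfold SSVwin at hw'
        rw [hcard d hd] at hw'
        exact hm c d hd hc hne hw'
  · rintro ⟨b, hb, hab, hw, hm⟩
    refine Or.inr ⟨by omega, b, hb, hab, ?_, ?_⟩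
    · unfold SSVwin at hw; rw [hcard b hb] at hw; exact hw
    · intro c d hd hc hne hw'
      apply hm c d hd hc hne
      unfold SSVwin; rw [hcard d hd]; exact hw'

theorem ssvwin_one (succ : X × X → X × X → Prop) (a : X) : SSVwin {a} succ a := by
  unfold SSVwin
  rw [Finset.card_singleton]
  exact Or.inl rfl

theorem ssvwin_mem {succ : X × X → X × X → Prop} {S : Finset X} {a : X}
    (h : SSVwin S succ a) : a ∈ S := by
  unfold SSVwin at h
  cases hk : S.card with
  | zero => rw [hk] at h; exact h.elim
  | succ k =>
    rw [hk] at h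
    rcases h with h | ⟨-, b, -, hab, -⟩
    · rw [h]; exact Finset.mem_singleton_self a
    · exact Finset.mem_of_mem_erase hab

theorem ssvwin_unique {V : Finset X} {succ : X × X → X × X → Prop} (h : IsLinearOMM V succ)
    {S : Finset X} (hSV : S ⊆ V) {a a' : X} (ha : SSVwin S succ a) (ha' : SSVwin S succ a') :
    a = a' := by
  have hm := ssvwin_mem ha
  have hm' := ssvwin_mem ha'
  by_cases hS : 2 ≤ S.card
  · obtain ⟨b, hb, hab, hw, hmx⟩ := (ssvwin_iff succ S hS a).1 ha
    obtain ⟨b', hb', hab', hw', hmx'⟩ := (ssvwin_iff succ S hS a').1 ha'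
    by_contra hne
    have hp : (a', b') ≠ (a, b) := fun e => hne (Prod.mk.inj e).1.symm
    exact h.1.2.1 (a, b) (a', b') (hSV hm) (hSV hb) (hSV hm') (hSV hb')
      (hmx a' b' hb' hab' hp hw') (hmx' a b hb hab hp.symm hw)
  · exact Finset.card_le_one.1 (by omega) a hm a' hm'

theorem ssvwin_exists {V : Finset X} {succ : X × X → X × X → Prop} (h : IsLinearOMM V succ)
    (k : ℕ) : ∀ S : Finset X, S ⊆ V → S.card = k + 1 → ∃ a, SSVwin S succ a := by
  classical
  induction k with
  | zero =>
    intro S _ hc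
    obtain ⟨a, rfl⟩ := Finset.card_eq_one.1 hc
    exact ⟨a, ssvwin_one succ a⟩
  | succ k ih =>
    intro S hSV hc
    have hcard : ∀ d ∈ S, (S.erase d).card = k + 1 := fun d hd => by
      rw [Finset.card_erase_of_mem hd, hc]; rfl
    have hsub : ∀ d, S.erase d ⊆ V := fun d => (Finset.erase_subset d S).trans hSV
    obtain ⟨d, hd⟩ : S.Nonempty := Finset.card_pos.1 (by omega)
    obtain ⟨c, hcw⟩ := ih (S.erase d) (hsub d) (hcard d hd)
    have hmemA : ∀ p : X × X,
        p ∈ (S ×ˢ S).filter (fun p => SSVwin (S.erase p.2) succ p.1) ↔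
          p.2 ∈ S ∧ p.1 ∈ S.erase p.2 ∧ SSVwin (S.erase p.2) succ p.1 := by
      intro p
      rw [Finset.mem_filter, Finset.mem_product]
      constructor
      · rintro ⟨⟨_, h2⟩, h3⟩
        exact ⟨h2, ssvwin_mem h3, h3⟩
      · rintro ⟨h1, h2, h3⟩
        exact ⟨⟨Finset.mem_of_mem_erase h2, h1⟩, h3⟩
    obtain ⟨p, hp, hmax⟩ := linear_max h
      ((S ×ˢ S).filter (fun p => SSVwin (S.erase p.2) succ p.1))
      ⟨(c, d), (hmemA (c, d)).2 ⟨hd, ssvwin_mem hcw, hcw⟩⟩ (by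
        intro p hp
        obtain ⟨h1, h2, -⟩ := (hmemA p).1 hp
        exact ⟨hsub _ h2, hSV h1, Finset.ne_of_mem_erase h2⟩)
    obtain ⟨h1, h2, h3⟩ := (hmemA p).1 hp
    refine ⟨p.1, (ssvwin_iff succ S (by omega) p.1).2 ⟨p.2, h1, h2, h3, ?_⟩⟩
    intro c' d' hd' hc' hne hw'
    exact hmax (c', d') ((hmemA (c', d')).2 ⟨hd', hc', hw'⟩) hne

end SSVFacts

/-! ## From a linear ordinal margin matrix to a model -/

section Build

variable {X : Type} [DecidableEq X]

open SSVCert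

/-- The set of alternatives with a given mask. -/
def toS (e : ℕ → X) (S : ℕ) : Finset X := ((els S).map e).toFinset

/-- The original relation or the reversed one. -/
def rel (succ : X × X → X × X → Prop) (s : ℕ) : X × X → X × X → Prop :=
  if s = 0 then succ else fun p q => succ (p.2, p.1) (q.2, q.1)

theorem rel_linear {V : Finset X} {succ : X × X → X × X → Prop} (h : IsLinearOMM V succ)
    (s : ℕ) : IsLinearOMM V (rel succ s) := by
  unfold rel
  split_ifs
  · exact h
  · exact isLinearOMM_rev h

theorem mem_els_iff (S x : ℕ) : x ∈ els S ↔ x < 6 ∧ tb S x = true := by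
  unfold els
  rw [List.mem_filter]
  have : x ∈ [0, 1, 2, 3, 4, 5] ↔ x < 6 := by
    simp only [List.mem_cons, List.not_mem_nil, or_false]
    omega
  rw [this]

theorem tb_iff (S x : ℕ) : tb S x = true ↔ S.testBit x = true := by
  have h1 : tb S x = Nat.beq (S >>> x % 2) 1 := rfl
  rw [h1, Nat.beq_eq, Nat.testBit_eq_decide_div_mod_eq, Nat.shiftRight_eq_div_pow,
    decide_eq_true_eq]

theorem els_lt_of_lt {n S x : ℕ} (hS : S < 2 ^ n) (hx : x ∈ els S) : x < n := by
  by_contra hc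
  have h1 := (tb_iff S x).1 ((mem_els_iff S x).1 hx).2
  rw [Nat.testBit_lt_two_pow (lt_of_lt_of_le hS (Nat.pow_le_pow_right (by norm_num)
    (not_lt.1 hc)))] at h1
  exact absurd h1 (by simp)

theorem mem_els_del (S b x : ℕ) (hb : tb S b = true) : x ∈ els (del S b) ↔ x ∈ els S ∧ x ≠ b := by
  have h1 : del S b = S ^^^ 2 ^ b := rfl
  rw [mem_els_iff, mem_els_iff, tb_iff, tb_iff, h1, Nat.testBit_xor, Nat.testBit_two_pow]
  rw [tb_iff] at hb
  by_cases hxb : x = b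
  · subst hxb
    simp [hb]
  · have : ¬ b = x := fun e => hxb e.symm
    simp [this, hxb]

theorem els_nodup (S : ℕ) : (els S).Nodup := List.Nodup.filter _ (by decide)

variable {n : ℕ} {V : Finset X} {e : ℕ → X}

theorem mem_toS {S : ℕ} (hS : S < 2 ^ n) (hinj : ∀ i j, i < n → j < n → e i = e j → i = j)
    {x : ℕ} (hx : x < n) : e x ∈ toS e S ↔ x ∈ els S := by
  unfold toS
  rw [List.mem_toFinset, List.mem_map]
  constructor
  · rintro ⟨y, hy, hxy⟩
    rw [← hinj y x (els_lt_of_lt hS hy) hx hxy]; exact hy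
  · intro h
    exact ⟨x, h, rfl⟩

theorem toS_subset {S : ℕ} (hS : S < 2 ^ n) (hV : ∀ i, i < n → e i ∈ V) : toS e S ⊆ V := by
  intro x hx
  unfold toS at hx
  rw [List.mem_toFinset, List.mem_map] at hx
  obtain ⟨y, hy, rfl⟩ := hx
  exact hV y (els_lt_of_lt hS hy)

theorem toS_del {S b : ℕ} (hS : S < 2 ^ n)
    (hinj : ∀ i j, i < n → j < n → e i = e j → i = j) (hb : b < n) (hbS : tb S b = true) :
    toS e (del S b) = (toS e S).erase (e b) := by
  ext x
  unfold toS
  rw [Finset.mem_erase, List.mem_toFinset, List.mem_map, List.mem_toFinset, List.mem_map]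
  constructor
  · rintro ⟨y, hy, rfl⟩
    rw [mem_els_del S b y hbS] at hy
    exact ⟨fun hh => hy.2 (hinj y b (els_lt_of_lt hS hy.1) hb hh), y, hy.1, rfl⟩
  · rintro ⟨hne, y, hy, rfl⟩
    exact ⟨y, (mem_els_del S b y hbS).2 ⟨hy, fun hh => hne (by rw [hh])⟩, rfl⟩

theorem card_toS {S : ℕ} (hS : S < 2 ^ n)
    (hinj : ∀ i j, i < n → j < n → e i = e j → i = j) : (toS e S).card = (els S).length := by
  unfold toS
  rw [List.toFinset_card_of_nodup, List.length_map]
  refine List.Nodup.map_on ?_ (els_nodup S)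
  intro x hx y hy hxy
  exact hinj x y (els_lt_of_lt hS hx) (els_lt_of_lt hS hy) hxy

theorem toS_two_pow {x : ℕ} (hx : x < 6) : toS e (2 ^ x) = {e x} := by
  have : els (2 ^ x) = [x] := by
    interval_cases x <;> decide
  unfold toS
  rw [this]
  simp

theorem toS_full (hn : n ≤ 6) (hV : ∀ i, i < n → e i ∈ V)
    (hinj : ∀ i j, i < n → j < n → e i = e j → i = j) (hcard : V.card = n) :
    toS e (2 ^ n - 1) = V := by
  have hlt : 2 ^ n - 1 < 2 ^ n := by
    have : 0 < 2 ^ n := by positivity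
    omega
  apply Finset.eq_of_subset_of_card_le (toS_subset hlt hV)
  rw [card_toS hlt hinj, hcard]
  have : ∀ n, n ≤ 6 → n ≤ (els (2 ^ n - 1)).length := by
    intro n hn
    interval_cases n <;> decide
  exact this n hn

/-- A counterexample to reversal symmetry yields a model. -/
def buildModel {succ : X × X → X × X → Prop} (hlin : IsLinearOMM V succ) (hn1 : 1 ≤ n)
    (hn : n ≤ 6) (hcard : V.card = n) (hV : ∀ i, i < n → e i ∈ V)
    (hinj : ∀ i j, i < n → j < n → e i = e j → i = j)
    (hIH : ∀ S ⊆ V, 2 ≤ S.card → S.card < V.card → ∀ a, SSVwin S succ a →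
      ¬ SSVwin S (fun p q => succ (p.2, p.1) (q.2, q.1)) a)
    (h0 : SSVwin V succ (e 0))
    (h1 : SSVwin V (fun p q => succ (p.2, p.1) (q.2, q.1)) (e 0)) : Model n where
  g a b c d := succ (e a, e b) (e c, e d)
  W s S x := SSVwin (toS e S) (rel succ s) (e x)
  M s S b := ∃ a, SSVmax (rel succ s) (toS e S) a (e b)
  n6 := hn
  n1 := hn1
  skew a b c d ha hb hc hd := hlin.1.2.2.2 _ _ _ _ (hV a ha) (hV b hb) (hV c hc) (hV d hd)
  anti a b c d ha hb hc hd hab hcd hne := by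
    constructor
    · exact hlin.1.2.1 _ _ (hV a ha) (hV b hb) (hV c hc) (hV d hd)
    · intro hh
      refine (hlin.2 (e a) (e b) (e c) (e d) (hV a ha) (hV b hb) (hV c hc) (hV d hd)
        (fun h => hab (hinj a b ha hb h)) (fun h => hcd (hinj c d hc hd h)) ?_).resolve_right hh
      intro h
      rw [Prod.mk.injEq] at h
      rcases hne with hne | hne
      · exact hne (hinj _ _ ha hc h.1)
      · exact hne (hinj _ _ hb hd h.2)
  tran a b c d i j ha hb hc hd hi hj hab hcd hij hne h1 h2 := by
    refine linear_trans hlin (hV a ha) (hV b hb) (hV c hc) (hV d hd) (hV i hi) (hV j hj)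
      (fun h => hab (hinj a b ha hb h)) (fun h => hij (hinj i j hi hj h)) ?_ h1 h2
    intro h
    rw [Prod.mk.injEq] at h
    rcases hne with hne | hne
    · exact hne (hinj _ _ ha hi h.1)
    · exact hne (hinj _ _ hb hj h.2)
  one s x hs hx := by
    rw [toS_two_pow (by omega)]
    exact ssvwin_one _ _
  mex s S hs hS h2 := by
    have hc := card_toS hS hinj
    obtain ⟨a, ha⟩ := ssvwin_exists (rel_linear hlin s) ((toS e S).card - 1) (toS e S)
      (toS_subset hS hV) (by omega)
    obtain ⟨b, hb⟩ := (ssvwin_iff _ _ (by omega) a).1 ha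
    have hbS := hb.1
    unfold toS at hbS
    rw [List.mem_toFinset, List.mem_map] at hbS
    obtain ⟨y, hy, rfl⟩ := hbS
    exact ⟨y, hy, a, hb⟩
  wex s S hs hS h2 := by
    have hc := card_toS hS hinj
    obtain ⟨a, ha⟩ := ssvwin_exists (rel_linear hlin s) ((toS e S).card - 1) (toS e S)
      (toS_subset hS hV) (by omega)
    have haS := ssvwin_mem ha
    unfold toS at haS
    rw [List.mem_toFinset, List.mem_map] at haS
    obtain ⟨y, hy, rfl⟩ := haS
    exact ⟨y, hy, ha⟩
  wun s S x y hs hS hx hy hwx hwy :=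
    hinj x y hx hy (ssvwin_unique (rel_linear hlin s) (toS_subset hS hV) hwx hwy)
  ih S x hS h2 hx := by
    have hS' : S < 2 ^ n := by omega
    have hc := card_toS hS' hinj
    refine hIH (toS e S) (toS_subset hS' hV) (by omega) ?_ (e x)
    rw [hc, hcard]
    have : ∀ n, n ≤ 6 → ∀ S, S < 2 ^ n → S + 1 < 2 ^ n → (els S).length < n := by
      intro n hn
      interval_cases n <;> decide
    exact this n hn S hS' hS
  dd s S b a hs hS hb ha hbS hM hW := by
    obtain ⟨a', hm⟩ := hM
    rw [toS_del hS hinj hb hbS] at hW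
    have : e a = a' := ssvwin_unique (rel_linear hlin s)
      ((Finset.erase_subset _ _).trans (toS_subset hS hV)) hW hm.2.2.1
    subst this
    have h2 : 2 ≤ (toS e S).card :=
      Finset.one_lt_card.2 ⟨e a, Finset.mem_of_mem_erase hm.2.1, e b, hm.1,
        Finset.ne_of_mem_erase hm.2.1⟩
    exact (ssvwin_iff _ _ h2 _).2 ⟨_, hm⟩
  ee s S b a hs hS hb ha hbS hM hW := by
    obtain ⟨a', hm⟩ := hM
    rw [toS_del hS hinj hb hbS]
    have h2 : 2 ≤ (toS e S).card :=
      Finset.one_lt_card.2 ⟨a', Finset.mem_of_mem_erase hm.2.1, e b, hm.1,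
        Finset.ne_of_mem_erase hm.2.1⟩
    have : e a = a' := ssvwin_unique (rel_linear hlin s) (toS_subset hS hV) hW
      ((ssvwin_iff _ _ h2 _).2 ⟨_, hm⟩)
    rw [this]
    exact hm.2.2.1
  ff s S b a d c hs hS hb ha hd hc hbS hdS hbd hab hcd hM hWb hWd := by
    obtain ⟨a', hm⟩ := hM
    rw [toS_del hS hinj hb hbS] at hWb
    rw [toS_del hS hinj hd hdS] at hWd
    have : e a = a' := ssvwin_unique (rel_linear hlin s)
      ((Finset.erase_subset _ _).trans (toS_subset hS hV)) hWb hm.2.2.1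
    subst this
    have hne : (e c, e d) ≠ (e a, e b) := by
      intro h
      rw [Prod.mk.injEq] at h
      exact hbd (hinj _ _ hb hd h.2.symm)
    have hdm : e d ∈ toS e S := (mem_toS hS hinj hd).2 ((mem_els_iff S d).2 ⟨by omega, hdS⟩)
    have key := hm.2.2.2 (e c) (e d) hdm (ssvwin_mem hWd) hne hWd
    constructor
    · rintro rfl
      exact key
    · intro hs0
      rw [rel, if_neg hs0] at key
      exact key
  top s hs := by
    rw [toS_full hn hV hinj hcard]
    unfold rel
    split_ifs
    · exact h0
    · exact h1

/-- An enumeration of a finite set starting with a given element. -/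
theorem exists_enum (V : Finset X) (a : X) (ha : a ∈ V) :
    ∃ e : ℕ → X, e 0 = a ∧ (∀ i, i < V.card → e i ∈ V) ∧
      ∀ i j, i < V.card → j < V.card → e i = e j → i = j := by
  have hnd : (a :: (V.erase a).toList).Nodup := by
    rw [List.nodup_cons]
    exact ⟨by simp, Finset.nodup_toList _⟩
  have hlen : (a :: (V.erase a).toList).length = V.card := by
    rw [List.length_cons, Finset.length_toList, Finset.card_erase_add_one ha]
  have hmem : ∀ x ∈ a :: (V.erase a).toList, x ∈ V := by
    intro x hx
    rcases List.mem_cons.1 hx with rfl | hx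
    · exact ha
    · exact Finset.mem_of_mem_erase (Finset.mem_toList.1 hx)
  refine ⟨fun i => (a :: (V.erase a).toList).getD i a, rfl, ?_, ?_⟩
  · intro i hi
    rw [← hlen] at hi
    apply hmem
    simp only [List.getD_eq_getElem _ _ hi]
    exact List.getElem_mem hi
  · intro i j hi hj hij
    rw [← hlen] at hi hj
    simp only [List.getD_eq_getElem _ _ hi, List.getD_eq_getElem _ _ hj] at hij
    exact (hnd.getElem_inj_iff).1 hij

end Build

theorem ssv_reversal_aux {X : Type} [DecidableEq X] (k : ℕ) : ∀ (V : Finset X)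
    (succ : X × X → X × X → Prop) (_ : IsLinearOMM V succ)
    (_ : 2 ≤ V.card) (_ : V.card ≤ 6) (_ : V.card = k),
    ∀ a, SSVwin V succ a →
      ¬ SSVwin V (fun p q => succ (p.2, p.1) (q.2, q.1)) a := by
  induction k using Nat.strong_induction_on with
  | _ k ih =>
    intro V succ hlin h2 h6 hk a h0 h1
    obtain ⟨e, rfl, hV, hinj⟩ := exists_enum V a (ssvwin_mem h0)
    rw [hk] at hV hinj
    have m : SSVCert.Model k := buildModel hlin (by omega) (by omega) hk hV hinj
      (fun S hS hS2 hSV => ih S.card (by omega) S succ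
        (isLinearOMM_mono hlin hS (Finset.card_pos.1 (by omega))) hS2 (by omega) rfl) h0 h1
    rw [hk] at h2 h6
    interval_cases k
    · exact m.run_sound _ .nil trivial 1 SSVCert.run2
    · exact m.run_sound _ .nil trivial 1 SSVCert.run3
    · exact m.run_sound _ .nil trivial 1 SSVCert.run4
    · exact m.run_sound _ .nil trivial 1 SSVCert.run5
    · exact m.run_sound _ .nil trivial 1 SSVCert.run6

/-- SSV satisfies Reversal Symmetry up to 6 alternatives: for any linear
ordinal margin matrix `(X, ≻)` with `2 ≤ |X| ≤ 6`, if `a` is the SSV winner of `(X, ≻)`,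
then `a` is not the SSV winner of the reversed matrix `(X, ≻ʳ)`, where
`(x,y) ≻ʳ (z,w)` iff `(y,x) ≻ (w,z)`. -/
theorem ssv_reversal_symmetry_up_to_six {X : Type} [DecidableEq X] (V : Finset X)
    (succ : X × X → X × X → Prop) (hlin : IsLinearOMM V succ)
    (h2 : 2 ≤ V.card) (h6 : V.card ≤ 6) :
    ∀ a, SSVwin V succ a →
      ¬ SSVwin V (fun p q => succ (p.2, p.1) (q.2, q.1)) a := by
  exact ssv_reversal_aux V.card V succ hlin h2 h6 rfl
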